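/- Let S = S_g be a closed orientable surface of genus g ≥ 2. For any isotopic separating essential simple closed curves β and γ in S, the crossing numbers are symmetric: C_γ(β) = C_β(γ). -/

import Mathlib

noncomputable section

open Set

/-- The circle, as `ℝ / ℤ`. -/
abbrev Circle1 := AddCircle (1 : ℝ)

/-- `c` is a simple closed curve in `S`: the image of a continuous injection of the circle. -/
def IsSCC {S : Type} [TopologicalSpace S] (c : Set S) : Prop :=
  ∃ f : C(Circle1, S), Function.Injective f ∧ Set.range f = c

/-- A simple closed curve is essential if no parametrization of it is null-homotopic. -/
def IsEssentialSCC {S : Type} [TopologicalSpace S] (c : Set S) : Prop :=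
  IsSCC c ∧ ∀ f : C(Circle1, S), Set.range f = c →
    ¬ ∃ x : S, f.Homotopic (ContinuousMap.const Circle1 x)

/-- A simple closed curve is nonperipheral (with respect to the boundary `Bd`) if no
parametrization of it is freely homotopic to a loop contained in `Bd`. -/
def IsNonperipheralSCC {S : Type} [TopologicalSpace S] (Bd c : Set S) : Prop :=
  ∀ f : C(Circle1, S), Set.range f = c →
    ¬ ∃ g : C(Circle1, S), Set.range g ⊆ Bd ∧ f.Homotopic g

/-- An essential nonperipheral simple closed curve in the interior of the surface. -/
def IsEssentialCurve {S : Type} [TopologicalSpace S] (Bd : Set S) (c : Set S) : Prop :=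
  IsSCC c ∧ IsEssentialSCC c ∧ IsNonperipheralSCC Bd c ∧ Disjoint c Bd

/-- Two simple closed curves are isotopic (equivalently, for essential simple closed curves
on a surface, freely homotopic): some injective parametrizations are freely homotopic. -/
def CurvesIsotopic {S : Type} [TopologicalSpace S] (c d : Set S) : Prop :=
  ∃ f g : C(Circle1, S), Function.Injective f ∧ Function.Injective g ∧
    Set.range f = c ∧ Set.range g = d ∧ f.Homotopic g

/-- Identification relation defining the Möbius band as a quotient of the square. -/
def MobiusRel (p q : unitInterval × unitInterval) : Prop :=
  p = q ∨ ((p.1 : ℝ) = 0 ∧ (q.1 : ℝ) = 1 ∧ (p.2 : ℝ) + (q.2 : ℝ) = 1)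

/-- The Möbius band. -/
def MobiusBand : Type := Quot MobiusRel

instance : TopologicalSpace MobiusBand :=
  inferInstanceAs (TopologicalSpace (Quot MobiusRel))

/-- `S` is a compact connected orientable surface of genus `g` with `b` boundary components,
with boundary `Bd`.  Orientability is expressed as the nonexistence of an embedded Möbius
band, and the genus as the maximal number of disjoint simple closed curves with connected
complement. -/
def IsOrientedSurface (g b : ℕ) (S : Type) [TopologicalSpace S] (Bd : Set S) : Prop :=
  CompactSpace S ∧ ConnectedSpace S ∧ T2Space S ∧ SecondCountableTopology S ∧
  IsClosed Bd ∧
  (∀ x : S, x ∉ Bd → ∃ U : Set S, IsOpen U ∧ x ∈ U ∧ Nonempty (U ≃ₜ (ℝ × ℝ))) ∧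
  (∀ x ∈ Bd, ∃ U : Set S, IsOpen U ∧ x ∈ U ∧
      Nonempty (U ≃ₜ ({p : ℝ × ℝ | 0 ≤ p.2} : Set (ℝ × ℝ)))) ∧
  Nat.card (ConnectedComponents ↥Bd) = b ∧
  (¬ ∃ e : C(MobiusBand, S), Function.Injective e) ∧
  (∃ F : Fin g → Set S, (∀ i, IsSCC (F i) ∧ Disjoint (F i) Bd) ∧
      Pairwise (Function.onFun Disjoint F) ∧ IsConnected (⋃ i, F i)ᶜ) ∧
  ¬ (∃ F : Fin (g + 1) → Set S, (∀ i, IsSCC (F i) ∧ Disjoint (F i) Bd) ∧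
      Pairwise (Function.onFun Disjoint F) ∧ IsConnected (⋃ i, F i)ᶜ)

/-- Vertices of the fine curve graph: essential nonperipheral simple closed curves. -/
def CurveVert (S : Type) [TopologicalSpace S] (Bd : Set S) : Type :=
  {c : Set S // IsEssentialCurve Bd c}

/-- The fine curve graph: edges connect (distinct) disjoint curves. -/
def fineCurveGraph (S : Type) [TopologicalSpace S] (Bd : Set S) :
    SimpleGraph (CurveVert S Bd) :=
  SimpleGraph.fromRel fun c d => Disjoint c.val d.val

/-- Isotopy, as a relation on vertices of the fine curve graph. -/
def isotopyRel (S : Type) [TopologicalSpace S] (Bd : Set S) :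
    CurveVert S Bd → CurveVert S Bd → Prop :=
  fun c d => CurvesIsotopic c.val d.val

/-- Isotopy classes of essential nonperipheral simple closed curves. -/
def CurveClass (S : Type) [TopologicalSpace S] (Bd : Set S) : Type :=
  Quot (isotopyRel S Bd)

/-- The (usual) curve graph: vertices are isotopy classes, edges connect classes
admitting disjoint representatives. -/
def curveGraph (S : Type) [TopologicalSpace S] (Bd : Set S) :
    SimpleGraph (CurveClass S Bd) :=
  SimpleGraph.fromRel fun x y => ∃ c d : CurveVert S Bd,
    Quot.mk _ c = x ∧ Quot.mk _ d = y ∧ Disjoint c.val d.val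

/-- The star of a vertex of a graph: the vertex together with all its neighbors. -/
def graphStar {V : Type} (G : SimpleGraph V) (v : V) : Set V :=
  insert v (G.neighborSet v)

/-- `c00`: real sequences which are eventually `0`. -/
def c00 : Type := {f : ℕ → ℝ // ∀ᶠ n in Filter.atTop, f n = 0}

/-- The `ℓ^∞` (supremum) distance on `c00`. -/
def c00Dist (f g : c00) : ℝ := ⨆ n, |f.val n - g.val n|

/-- `f : X → Y` is a quasi-isometric embedding with respect to the given distance
functions: `(1/K) d(x,x') - L ≤ d(f x, f x') ≤ K d(x,x') + L` for all `x, x'`. -/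
def IsQIEmbedding {X Y : Type} (dX : X → X → ℝ) (dY : Y → Y → ℝ) (f : X → Y) : Prop :=
  ∃ K L : ℝ, 0 < K ∧ 0 ≤ L ∧ ∀ x x' : X,
    dX x x' / K - L ≤ dY (f x) (f x') ∧ dY (f x) (f x') ≤ K * dX x x' + L

/-- Gromov hyperbolicity of a distance function, via the four-point condition
(equivalent, for geodesic spaces, to the thin-triangles condition). -/
def GromovHyperbolicDist {X : Type} (d : X → X → ℝ) : Prop :=
  ∃ δ : ℝ, 0 ≤ δ ∧ ∀ x y z w : X,
    d x y + d z w ≤ max (d x z + d y w) (d x w + d y z) + 2 * δ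

/-- The `ℓ^∞` distance on `ℤ^N`. -/
def zNDist (N : ℕ) (u v : Fin N → ℤ) : ℝ :=
  ((Finset.univ.sup fun i => (u i - v i).natAbs : ℕ) : ℝ)
open scoped Classical

/-- An annular (cyclic) cover of the surface `S`: a covering map whose total space is an
open annulus. -/
structure AnnCover (S : Type) [TopologicalSpace S] : Type 1 where
  /-- The total space of the cover. -/
  Tot : Type
  /-- The topology on the total space. -/
  top : TopologicalSpace Tot
  /-- The covering map. -/
  p : Tot → S
  cov : IsCoveringMap p
  annulus : Nonempty (Tot ≃ₜ (Circle1 × ℝ))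

attribute [instance] AnnCover.top

/-- Elevations of a curve `δ` in the cover `C`: connected components of `p ⁻¹(δ)`. -/
def Elev {S : Type} [TopologicalSpace S] (C : AnnCover S) (δ : Set S) : Type :=
  {A : Set C.Tot // ∃ x ∈ C.p ⁻¹' δ, A = connectedComponentIn (C.p ⁻¹' δ) x}

/-- Data exhibiting the compact elevation of a curve `δ` in the cover `C` (witnessing that
the cover corresponds to the homotopy class of `δ`: `δ` lifts bijectively to its compact
elevation), together with a choice of positive side of the compact elevation. -/
structure CurveLift {S : Type} [TopologicalSpace S] (C : AnnCover S) (δ : Set S) where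
  /-- A point of the compact elevation. -/
  x0 : C.Tot
  mem : C.p x0 ∈ δ
  compact : IsCompact (connectedComponentIn (C.p ⁻¹' δ) x0)
  bij : Set.BijOn C.p (connectedComponentIn (C.p ⁻¹' δ) x0) δ
  /-- A point on the chosen positive side of the compact elevation. -/
  pos : C.Tot
  pos_notin : pos ∉ connectedComponentIn (C.p ⁻¹' δ) x0

/-- The compact elevation, as a subset of the total space. -/
def hatSet {S : Type} [TopologicalSpace S] {C : AnnCover S} {δ : Set S}
    (D : CurveLift C δ) : Set C.Tot :=
  connectedComponentIn (C.p ⁻¹' δ) D.x0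

/-- The compact elevation, as an elevation. -/
def hatElev {S : Type} [TopologicalSpace S] {C : AnnCover S} {δ : Set S}
    (D : CurveLift C δ) : Elev C δ :=
  ⟨hatSet D, D.x0, D.mem, rfl⟩

/-- The tree of elevations of `δ`: two elevations are adjacent exactly when they lie in
the closure of a common connected component of the complement of `p ⁻¹(δ)`. -/
def elevTree {S : Type} [TopologicalSpace S] (C : AnnCover S) (δ : Set S) :
    SimpleGraph (Elev C δ) :=
  SimpleGraph.fromRel fun A B => ∃ x ∈ (C.p ⁻¹' δ)ᶜ,
    A.val ⊆ closure (connectedComponentIn (C.p ⁻¹' δ)ᶜ x) ∧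
    B.val ⊆ closure (connectedComponentIn (C.p ⁻¹' δ)ᶜ x)

/-- The signed level of an elevation: its distance to the compact elevation in the tree of
elevations, with positive sign exactly for elevations on the chosen positive side. -/
def level {S : Type} [TopologicalSpace S] {C : AnnCover S} {δ : Set S}
    (D : CurveLift C δ) (A : Elev C δ) : ℤ :=
  if A.val ⊆ connectedComponentIn (hatSet D)ᶜ D.pos
  then ((elevTree C δ).dist (hatElev D) A : ℤ)
  else -(((elevTree C δ).dist (hatElev D) A : ℕ) : ℤ)

/-- The set of levels of `δ` met by a subset `T` of the cover. -/
def levelsMet {S : Type} [TopologicalSpace S] {C : AnnCover S} {δ : Set S}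
    (D : CurveLift C δ) (T : Set C.Tot) : Set ℤ :=
  {k | ∃ A : Elev C δ, level D A = k ∧ (A.val ∩ T).Nonempty}

/-- The `γ`-crossing number of `β`: the number of levels of `γ` intersected by the compact
elevation of `β` (and `0` when `β = γ`). -/
def crossing {S : Type} [TopologicalSpace S] {C : AnnCover S} {γc βc : Set S}
    (D : CurveLift C γc) (E : CurveLift C βc) : ℕ :=
  if βc = γc then 0 else (levelsMet D (hatSet E)).ncard

/-- A simple closed curve is separating if its complement is disconnected. -/
def IsSeparating {S : Type} [TopologicalSpace S] (c : Set S) : Prop :=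
  ¬ IsPreconnected cᶜ

section

open scoped Topology Pointwise

theorem eq_of_exp_eq_one {α : Type*} [TopologicalSpace α] {s : Set α} (hs : IsPreconnected s)
    {φ : α → ℂ} (hφ : ContinuousOn φ s) (h1 : ∀ x ∈ s, Complex.exp (φ x) = 1)
    {x y : α} (hx : x ∈ s) (hy : y ∈ s) : φ x = φ y := by
  have hI : (2 * Real.pi * Complex.I : ℂ) ≠ 0 := Complex.two_pi_I_ne_zero
  have key : ∀ x ∈ s, ∃ n : ℤ, φ x / (2 * Real.pi * Complex.I) = n := by
    intro x hx
    obtain ⟨n, hn⟩ := Complex.exp_eq_one_iff.1 (h1 x hx)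
    exact ⟨n, by rw [hn]; field_simp⟩
  have hd : IsDiscrete (Set.range ((↑) : ℤ → ℝ)) := by
    exact ⟨Int.isClosedEmbedding_coe_real.isEmbedding.toHomeomorph.symm.isEmbedding.discreteTopology⟩
  have := hs.constant_of_mapsTo hd
    (f := fun x => (φ x / (2 * Real.pi * Complex.I)).re)
    (Complex.continuous_re.comp_continuousOn (hφ.div_const _))
    (fun x hx => by obtain ⟨n, hn⟩ := key x hx; exact ⟨n, by simp [hn]⟩) hx hy
  obtain ⟨n, hn⟩ := key x hx
  obtain ⟨m, hm⟩ := key y hy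
  simp only [hn, hm, Complex.intCast_re, Int.cast_inj] at this
  subst this
  rw [div_eq_iff hI] at hn hm
  rw [hn, hm]

/-- `F` has a continuous logarithm on `K`. -/
def HasLogOn {α : Type*} [TopologicalSpace α] (K : Set α) (F : α → ℂ) : Prop :=
  ∃ g : α → ℂ, ContinuousOn g K ∧ ∀ z ∈ K, Complex.exp (g z) = F z

theorem exists_continuous_log {α : Type*} [TopologicalSpace α] [SimplyConnectedSpace α]
    [LocallyPathConnectedSpace α] {h : α → ℂ} (hc : Continuous h) (h0 : ∀ z, h z ≠ 0) :
    ∃ g : α → ℂ, Continuous g ∧ ∀ z, Complex.exp (g z) = h z := by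
  obtain ⟨a⟩ : Nonempty α := inferInstance
  obtain ⟨F, ⟨-, hF⟩, -⟩ := Complex.isCoveringMapOn_exp.existsUnique_continuousMap_lifts
    ⟨h, hc⟩ (a₀ := a) (e₀ := Complex.log (h a)) (Complex.exp_log (h0 a))
    (fun z => by simpa using h0 z)
  exact ⟨F, F.continuous, fun z => congrFun hF z⟩

theorem not_hasLogOn_sphere (p : ℂ) {R : ℝ} (hR : 0 < R) {e : ℤ} (he : e ≠ 0) :
    ¬ HasLogOn (Metric.sphere p R) (fun z => (z - p) ^ e) := by
  rintro ⟨g, hg, hge⟩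
  have hmem : ∀ θ : ℝ, p + R * Complex.exp (θ * Complex.I) ∈ Metric.sphere p R := by
    intro θ
    simp [Complex.norm_exp_ofReal_mul_I, abs_of_pos hR]
  have hR' : (R : ℂ) ≠ 0 := by exact_mod_cast hR.ne'
  let φ : ℝ → ℂ := fun θ => g (p + R * Complex.exp (θ * Complex.I))
    - e * (θ * Complex.I) - e * Complex.log R
  have hφ : Continuous φ := by
    have : Continuous fun θ : ℝ => g (p + R * Complex.exp (θ * Complex.I)) :=
      hg.comp_continuous (by fun_prop) hmem
    exact (this.sub (by fun_prop)).sub continuous_const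
  have h1 : ∀ θ, Complex.exp (φ θ) = 1 := by
    intro θ
    simp only [φ, Complex.exp_sub, hge _ (hmem θ), Complex.exp_int_mul, Complex.exp_log hR']
    rw [add_sub_cancel_left, mul_zpow]
    have := Complex.exp_ne_zero (θ * Complex.I)
    field_simp
  have := eq_of_exp_eq_one isPreconnected_univ hφ.continuousOn (fun x _ => h1 x)
    (mem_univ (0 : ℝ)) (mem_univ (2 * Real.pi))
  simp only [φ] at this
  push_cast at this
  rw [Complex.exp_two_pi_mul_I, zero_mul, Complex.exp_zero] at this
  have h3 : (e : ℂ) * (2 * Real.pi * Complex.I) = 0 := by linear_combination this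
  simp [he, Real.pi_ne_zero] at h3

theorem not_hasLogOn_of_bounded {K O : Set ℂ} (hK : IsClosed K) (hO : IsOpen O)
    (hOb : Bornology.IsBounded O) (hcl : closure O ⊆ O ∪ K)
    {p : ℂ} (hp : p ∈ O) {Q : ℂ → ℂ}
    (hQ : ContinuousOn Q (O ∪ K)) (hQ0 : ∀ z ∈ O ∪ K, Q z ≠ 0) {e : ℤ} (he : e ≠ 0) :
    ¬ HasLogOn K (fun z => (z - p) ^ e * Q z) := by
  rintro ⟨g, hg, hge⟩
  obtain ⟨g', hg'⟩ := ContinuousMap.exists_restrict_eq hK ⟨K.domRestrict g, hg.domRestrict⟩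
  have hgg : ∀ z ∈ K, g' z = g z := fun z hz => by
    exact DFunLike.congr_fun hg' ⟨z, hz⟩
  let h : ℂ → ℂ := fun z => if z ∈ O then Complex.exp (g' z) / Q z else (z - p) ^ e
  have hfr : ∀ z ∈ frontier O, z ∈ K := fun z hz => by
    rw [hO.frontier_eq] at hz
    exact (hcl hz.1).resolve_left hz.2
  have hc : Continuous h := by
    refine continuous_if ?_ ?_ ?_
    · intro z hz
      have hzK := hfr z hz
      simp only [ofPred_mem_eq] at hz
      rw [hgg z hzK, hge z hzK, mul_div_assoc, div_self (hQ0 z (Or.inr hzK)), mul_one]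
    · exact (g'.continuous.cexp.continuousOn).div (hQ.mono hcl) fun z hz => hQ0 z (hcl hz)
    · intro z hz
      have hz' : z ∉ O := by
        have : z ∈ closure Oᶜ := hz
        rwa [hO.isClosed_compl.closure_eq] at this
      have : z - p ≠ 0 := fun h => hz' (by rw [sub_eq_zero.1 h]; exact hp)
      have h2 : ContinuousAt (fun z => z - p) z := by fun_prop
      exact (h2.zpow₀ e (Or.inl this)).continuousWithinAt
  have h0 : ∀ z, h z ≠ 0 := by
    intro z
    by_cases hz : z ∈ O
    · simp only [h, hz, if_true]
      exact div_ne_zero (Complex.exp_ne_zero _) (hQ0 z (Or.inl hz))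
    · simp only [h, hz, if_false]
      exact zpow_ne_zero _ fun h => hz (by rw [sub_eq_zero.1 h]; exact hp)
  obtain ⟨G, hG, hGe⟩ := exists_continuous_log hc h0
  obtain ⟨R, hR, hRO⟩ := hOb.subset_ball_lt 0 p
  refine not_hasLogOn_sphere p hR he ⟨G, hG.continuousOn, fun z hz => ?_⟩
  have : z ∉ O := fun hzO => by
    have := hRO hzO
    rw [Metric.mem_ball] at this
    rw [Metric.mem_sphere] at hz
    exact this.ne hz
  rw [hGe]
  simp [h, this]

theorem HasLogOn.mul {α : Type*} [TopologicalSpace α] {K : Set α} {F G : α → ℂ}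
    (hF : HasLogOn K F) (hG : HasLogOn K G) : HasLogOn K (fun z => F z * G z) := by
  obtain ⟨f, hf, hfe⟩ := hF
  obtain ⟨g, hg, hge⟩ := hG
  exact ⟨fun z => f z + g z, hf.add hg, fun z hz => by rw [Complex.exp_add, hfe z hz, hge z hz]⟩

theorem HasLogOn.inv {α : Type*} [TopologicalSpace α] {K : Set α} {F : α → ℂ}
    (hF : HasLogOn K F) : HasLogOn K (fun z => (F z)⁻¹) := by
  obtain ⟨f, hf, hfe⟩ := hF
  exact ⟨fun z => - f z, hf.neg, fun z hz => by rw [Complex.exp_neg, hfe z hz]⟩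

theorem HasLogOn.congr {α : Type*} [TopologicalSpace α] {K : Set α} {F G : α → ℂ}
    (hF : HasLogOn K F) (h : ∀ z ∈ K, F z = G z) : HasLogOn K G := by
  obtain ⟨f, hf, hfe⟩ := hF
  exact ⟨f, hf, fun z hz => by rw [hfe z hz, h z hz]⟩

theorem hasLogOn_of_near_one {α : Type*} [TopologicalSpace α] {K : Set α} {F : α → ℂ}
    (hF : ContinuousOn F K) (h : ∀ z ∈ K, ‖F z - 1‖ < 1) : HasLogOn K F := by
  have hs : ∀ z ∈ K, F z ∈ Complex.slitPlane := fun z hz => by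
    have := Complex.mem_slitPlane_of_norm_lt_one (h z hz)
    simpa using this
  exact ⟨fun z => Complex.log (F z), hF.clog hs,
    fun z hz => Complex.exp_log (Complex.slitPlane_ne_zero (hs z hz))⟩

theorem hasLogOn_div {K T : Set ℂ} (hK : IsClosed K) (hT : IsPreconnected T)
    (hTK : Disjoint T K) {p q : ℂ} (hp : p ∈ T) (hq : q ∈ T) :
    HasLogOn K (fun z => (z - p) / (z - q)) := by
  have hne : ∀ q ∈ T, ∀ z ∈ K, z - q ≠ 0 := fun q hq z hz h =>
    disjoint_left.1 hTK hq (by rw [← sub_eq_zero.1 h]; exact hz)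
  refine hT.induction₂' (fun p q => p ∈ T → q ∈ T → HasLogOn K (fun z => (z - p) / (z - q)))
    ?_ ?_ hp hq hp hq
  · intro x hx
    have hxK : x ∉ K := disjoint_left.1 hTK hx
    obtain ⟨ε, hε, hεK⟩ := Metric.isOpen_iff.1 hK.isOpen_compl x hxK
    have : ∀ y ∈ Metric.ball x ε, y ∈ T → HasLogOn K (fun z => (z - y) / (z - x)) := by
      intro y hy hyT
      refine hasLogOn_of_near_one ?_ ?_
      · exact ContinuousOn.div (by fun_prop) (by fun_prop) (hne x hx)
      · intro z hz
        have h1 := hne x hx z hz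
        have : (z - y) / (z - x) - 1 = (x - y) / (z - x) := by field_simp; ring
        rw [this, norm_div, div_lt_one (norm_pos_iff.2 h1)]
        have h2 : z ∉ Metric.ball x ε := fun h => hεK h hz
        rw [Metric.mem_ball, dist_eq_norm] at h2 hy
        rw [norm_sub_rev]; linarith
    filter_upwards [mem_nhdsWithin_of_mem_nhds (Metric.ball_mem_nhds x hε)] with y hy
    refine ⟨fun _ hyT => (this y hy hyT).inv.congr fun z _ => by rw [inv_div],
      fun hyT _ => this y hy hyT⟩
  · intro x y z hx hy hz h1 h2 _ _
    refine ((h1 hx hy).mul (h2 hy hz)).congr fun w hw => ?_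
    have := hne y hy w hw
    have := hne z hz w hw
    field_simp

/-- Every nonvanishing continuous function on `J` has a continuous logarithm. -/
def HasAllLogs {α : Type*} [TopologicalSpace α] (J : Set α) : Prop :=
  ∀ F : α → ℂ, ContinuousOn F J → (∀ z ∈ J, F z ≠ 0) → HasLogOn J F

theorem exists_arc_inverse {α : Type*} [TopologicalSpace α] [T2Space α] {f : ℝ → α} {a b : ℝ}
    (hf : ContinuousOn f (Icc a b)) (hi : InjOn f (Icc a b)) :
    ∃ k : α → ℝ, ContinuousOn k (f '' Icc a b) ∧ ∀ t ∈ Icc a b, k (f t) = t := by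
  let f' : Icc a b → α := fun t => f t
  have hf' : Continuous f' := continuousOn_iff_continuous_domRestrict.1 hf
  have hi' : Function.Injective f' := fun s t h => Subtype.ext (hi s.2 t.2 h)
  have he := (hf'.isClosedEmbedding hi').isEmbedding
  have hinv : ∀ t ∈ Icc a b, Function.invFunOn f (Icc a b) (f t) = t := fun t ht =>
    hi.leftInvOn_invFunOn ht
  refine ⟨Function.invFunOn f (Icc a b), ?_, hinv⟩
  have hr : f '' Icc a b = range f' := by
    rw [image_eq_range]
  rw [hr, continuousOn_iff_continuous_domRestrict]
  have : (range f').domRestrict (Function.invFunOn f (Icc a b)) =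
      Subtype.val ∘ he.toHomeomorph.symm := by
    funext ⟨z, t, ht⟩
    subst ht
    have h2 : he.toHomeomorph.symm ⟨f' t, mem_range_self t⟩ = t := by
      rw [Homeomorph.symm_apply_eq]; rfl
    simp only [Function.comp_apply, h2]
    exact hinv t t.2
  rw [this]
  exact continuous_subtype_val.comp he.toHomeomorph.symm.continuous

theorem hasAllLogs_arc {α : Type*} [TopologicalSpace α] [T2Space α] {f : ℝ → α} {a b : ℝ}
    (hf : ContinuousOn f (Icc a b)) (hi : InjOn f (Icc a b)) : HasAllLogs (f '' Icc a b) := by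
  intro F hF hF0
  rcases lt_or_ge b a with hab | hab
  · rw [Icc_eq_empty (not_le.2 hab), image_empty]
    exact ⟨F, continuousOn_empty _, by simp⟩
  obtain ⟨k, hk, hkf⟩ := exists_arc_inverse hf hi
  have hc : Continuous fun t : ℝ => F (f (projIcc a b hab t)) :=
    (hF.comp hf (mapsTo_image _ _)).comp_continuous (continuous_subtype_val.comp continuous_projIcc)
      fun t => (projIcc a b hab t).2
  obtain ⟨G, hG, hGe⟩ := exists_continuous_log hc
    (fun t => hF0 _ (mem_image_of_mem _ (projIcc a b hab t).2))
  refine ⟨fun z => G (k z), hG.comp_continuousOn hk, ?_⟩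
  rintro _ ⟨t, ht, rfl⟩
  simp only [hkf t ht, hGe, projIcc_of_mem hab ht]

theorem not_sphere_subset_arc {f : ℝ → ℂ} {a b : ℝ}
    (hf : ContinuousOn f (Icc a b)) (hi : InjOn f (Icc a b)) (p : ℂ) {R : ℝ} (hR : 0 < R) :
    ¬ Metric.sphere p R ⊆ f '' Icc a b := by
  intro hs
  obtain ⟨k, hk, hkf⟩ := exists_arc_inverse hf hi
  have hcon : IsConnected (Metric.sphere p R) :=
    isConnected_sphere (by simp [Complex.rank_real_complex]) p hR.le
  have hcom : IsCompact (Metric.sphere p R) := isCompact_sphere p R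
  have hIcc := eq_Icc_of_connected_compact (hcon.image k (hk.mono hs))
    (hcom.image_of_continuousOn (hk.mono hs))
  set c := sInf (k '' Metric.sphere p R)
  set d := sSup (k '' Metric.sphere p R)
  have hsub : Icc c d ⊆ Icc a b := by
    rw [← hIcc]
    rintro _ ⟨z, hz, rfl⟩
    obtain ⟨t, ht, rfl⟩ := hs hz
    rwa [hkf t ht]
  have himg : f '' Icc c d = Metric.sphere p R := by
    rw [← hIcc]
    ext w
    constructor
    · rintro ⟨_, ⟨z, hz, rfl⟩, rfl⟩
      obtain ⟨t, ht, rfl⟩ := hs hz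
      rwa [hkf t ht]
    · intro hw
      obtain ⟨t, ht, rfl⟩ := hs hw
      exact ⟨_, mem_image_of_mem _ hw, by rw [hkf t ht]⟩
  have := hasAllLogs_arc (hf.mono hsub) (hi.mono hsub)
  rw [himg] at this
  refine not_hasLogOn_sphere p hR one_ne_zero (this (fun z => (z - p) ^ (1 : ℤ)) ?_ ?_)
  · simp only [zpow_one]; fun_prop
  · intro z hz
    simp only [zpow_one, ne_eq, sub_eq_zero]
    rintro rfl
    simp [hR.ne] at hz

/-- `F` has logarithms on `K'` and on `J` that agree at `x` and differ by `2πi n` at `y`. -/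
def LogMismatch (K' J : Set ℂ) (x y : ℂ) (F : ℂ → ℂ) (n : ℤ) : Prop :=
  ∃ g₁ g₂ : ℂ → ℂ, ContinuousOn g₁ K' ∧ ContinuousOn g₂ J ∧ (∀ z ∈ K', Complex.exp (g₁ z) = F z) ∧
    (∀ z ∈ J, Complex.exp (g₂ z) = F z) ∧ (x ∈ K' ∩ J → g₁ x = g₂ x) ∧
    (y ∈ K' ∩ J → g₁ y = g₂ y + n * (2 * Real.pi * Complex.I))

theorem exists_logMismatch {K' J : Set ℂ} (x y : ℂ) {F : ℂ → ℂ} (h1 : HasLogOn K' F)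
    (h2 : HasLogOn J F) : ∃ n, LogMismatch K' J x y F n := by
  obtain ⟨g₁, hg₁, he₁⟩ := h1
  obtain ⟨g₂, hg₂, he₂⟩ := h2
  have key : ∀ z ∈ K' ∩ J, ∃ n : ℤ, g₁ z = g₂ z + n * (2 * Real.pi * Complex.I) := fun z hz =>
    Complex.exp_eq_exp_iff_exists_int.1 (by rw [he₁ z hz.1, he₂ z hz.2])
  obtain ⟨m, hm⟩ : ∃ m : ℤ, x ∈ K' ∩ J → g₁ x = g₂ x + m * (2 * Real.pi * Complex.I) := by
    by_cases hx : x ∈ K' ∩ J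
    · exact (key x hx).imp fun _ h _ => h
    · exact ⟨0, fun h => absurd h hx⟩
  obtain ⟨n, hn⟩ : ∃ m : ℤ, y ∈ K' ∩ J → g₁ y = g₂ y + m * (2 * Real.pi * Complex.I) := by
    by_cases hx : y ∈ K' ∩ J
    · exact (key y hx).imp fun _ h _ => h
    · exact ⟨0, fun h => absurd h hx⟩
  refine ⟨n - m, g₁, fun z => g₂ z + m * (2 * Real.pi * Complex.I), hg₁, hg₂.add continuousOn_const,
    he₁, fun z hz => ?_, hm, fun h => ?_⟩
  · rw [Complex.exp_add, he₂ z hz, Complex.exp_int_mul_two_pi_mul_I, mul_one]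
  · rw [hn h]; push_cast; ring

theorem LogMismatch.zpow_mul_zpow {K' J : Set ℂ} {x y : ℂ} {F G : ℂ → ℂ} {n m : ℤ}
    (hF : LogMismatch K' J x y F n) (hG : LogMismatch K' J x y G m) (k l : ℤ) :
    LogMismatch K' J x y (fun z => F z ^ k * G z ^ l) (k * n + l * m) := by
  obtain ⟨g₁, g₂, hg₁, hg₂, he₁, he₂, hx, hy⟩ := hF
  obtain ⟨f₁, f₂, hf₁, hf₂, hd₁, hd₂, hx', hy'⟩ := hG
  refine ⟨fun z => k * g₁ z + l * f₁ z, fun z => k * g₂ z + l * f₂ z, ?_, ?_, fun z hz => ?_,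
    fun z hz => ?_, fun h => ?_, fun h => ?_⟩
  · fun_prop
  · fun_prop
  · rw [Complex.exp_add, Complex.exp_int_mul, Complex.exp_int_mul, he₁ z hz, hd₁ z hz]
  · rw [Complex.exp_add, Complex.exp_int_mul, Complex.exp_int_mul, he₂ z hz, hd₂ z hz]
  · simp only [hx h, hx' h]
  · simp only [hy h, hy' h]; push_cast; ring

theorem LogMismatch.hasLogOn {K' J : Set ℂ} (hK : IsClosed K') (hJ : IsClosed J) {x y : ℂ}
    (hKJ : K' ∩ J ⊆ {x, y}) {F : ℂ → ℂ} (hF : LogMismatch K' J x y F 0) :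
    HasLogOn (K' ∪ J) F := by
  obtain ⟨g₁, g₂, hg₁, hg₂, he₁, he₂, hx, hy⟩ := hF
  have hag : ∀ z ∈ K' ∩ J, g₁ z = g₂ z := by
    intro z hz
    rcases hKJ hz with rfl | h
    · exact hx hz
    · obtain rfl : z = y := h
      simpa using hy hz
  let g : ℂ → ℂ := fun z => if z ∈ K' then g₁ z else g₂ z
  have e1 : EqOn g g₁ K' := fun z hz => if_pos hz
  have e2 : EqOn g g₂ J := fun z hz => by
    by_cases h : z ∈ K'
    · rw [e1 h, hag z ⟨h, hz⟩]
    · exact if_neg h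
  refine ⟨g, (hg₁.congr e1).union_of_isClosed (hg₂.congr e2) hK hJ, ?_⟩
  rintro z (hz | hz)
  · rw [e1 hz, he₁ z hz]
  · rw [e2 hz, he₂ z hz]

theorem closure_connectedComponentIn_subset {α : Type*} [TopologicalSpace α]
    [LocallyConnectedSpace α] {K : Set α} (hK : IsClosed K) (p : α) :
    closure (connectedComponentIn Kᶜ p) ⊆ connectedComponentIn Kᶜ p ∪ K := by
  intro z hz
  by_cases hzK : z ∈ K
  · exact Or.inr hzK
  left
  have ho : IsOpen (connectedComponentIn Kᶜ z) := hK.isOpen_compl.connectedComponentIn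
  obtain ⟨w, hw1, hw2⟩ := mem_closure_iff.1 hz _ ho (mem_connectedComponentIn hzK)
  rw [connectedComponentIn_eq hw2, ← connectedComponentIn_eq hw1]
  exact mem_connectedComponentIn hzK

theorem connectedComponentIn_subset_ball {K : Set ℂ} {m : ℂ} {r : ℝ}
    (hs : Metric.sphere m r ⊆ K) {p : ℂ} (hp : p ∈ Metric.ball m r) :
    connectedComponentIn Kᶜ p ⊆ Metric.ball m r := by
  by_cases hpK : p ∈ Kᶜ
  swap
  · rw [connectedComponentIn_eq_empty hpK]; exact empty_subset _
  refine isPreconnected_connectedComponentIn.subset_left_of_subset_union Metric.isOpen_ball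
    (Metric.isClosed_closedBall (x := m) (ε := r)).isOpen_compl ?_ ?_
    ⟨p, mem_connectedComponentIn hpK, hp⟩
  · exact disjoint_compl_right_iff_subset.2 Metric.ball_subset_closedBall
  · intro z hz
    have hzK : z ∉ K := connectedComponentIn_subset _ _ hz
    have : z ∉ Metric.sphere m r := fun h => hzK (hs h)
    rw [Metric.mem_sphere] at this
    rcases lt_or_gt_of_ne this with h | h
    · exact Or.inl h
    · right; simpa using h

theorem not_hasLogOn_of_component {K : Set ℂ} (hK : IsClosed K) {m : ℂ} {r : ℝ}
    (hs : Metric.sphere m r ⊆ K) {p : ℂ} (hp : p ∈ Metric.ball m r) (hpK : p ∉ K) {Q : ℂ → ℂ}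
    (hQ : ContinuousOn Q (connectedComponentIn Kᶜ p ∪ K))
    (hQ0 : ∀ z ∈ connectedComponentIn Kᶜ p ∪ K, Q z ≠ 0) {e : ℤ} (he : e ≠ 0) :
    ¬ HasLogOn K (fun z => (z - p) ^ e * Q z) :=
  not_hasLogOn_of_bounded hK hK.isOpen_compl.connectedComponentIn
    (Metric.isBounded_ball.subset (connectedComponentIn_subset_ball hs hp))
    (closure_connectedComponentIn_subset hK p) (mem_connectedComponentIn hpK) hQ hQ0 he

theorem sub_ne_zero_of_component {K : Set ℂ} {p q : ℂ} (hq : q ∉ K)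
    (hpq : q ∉ connectedComponentIn Kᶜ p) : ∀ z ∈ connectedComponentIn Kᶜ p ∪ K, z - q ≠ 0 := by
  intro z hz h
  rw [sub_eq_zero] at h
  subst h
  exact hz.elim hpq hq

theorem same_component_of_one_point {K' J : Set ℂ} (hK : IsClosed K') (hJ : IsClosed J)
    (hJl : HasAllLogs J) {x : ℂ} (hKJ : K' ∩ J ⊆ {x}) {m : ℂ} {r : ℝ}
    (hs : Metric.sphere m r ⊆ K') {V : Set ℂ} (hV : IsPreconnected V) (hVK : Disjoint V K')
    (hVr : V ⊆ Metric.ball m r) {p q : ℂ} (hp : p ∈ V \ J) (hq : q ∈ V \ J) :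
    q ∈ connectedComponentIn (K' ∪ J)ᶜ p := by
  by_contra hpq
  have hpK : p ∉ K' ∪ J := fun h => h.elim (disjoint_left.1 hVK hp.1) hp.2
  have hqK : q ∉ K' ∪ J := fun h => h.elim (disjoint_left.1 hVK hq.1) hq.2
  have hpq' := sub_ne_zero_of_component hqK hpq
  have hpJ : ∀ z ∈ J, z - p ≠ 0 := fun z hz h => hp.2 (by rw [← sub_eq_zero.1 h]; exact hz)
  obtain ⟨n, hn⟩ := exists_logMismatch x x (hasLogOn_div hK hV hVK hp.1 hq.1)
    (hJl (fun z => (z - p) / (z - q))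
      (ContinuousOn.div (by fun_prop) (by fun_prop) fun z hz => hpq' z (Or.inr (Or.inr hz)))
      (fun z hz => div_ne_zero (hpJ z hz) (hpq' z (Or.inr (Or.inr hz)))))
  have hn0 : LogMismatch K' J x x (fun z => (z - p) / (z - q)) 0 := by
    obtain ⟨g₁, g₂, a1, a2, a3, a4, a5, -⟩ := hn
    exact ⟨g₁, g₂, a1, a2, a3, a4, a5, fun h => by simpa using a5 h⟩
  have hl := hn0.hasLogOn hK hJ (by simpa using hKJ)
  refine not_hasLogOn_of_component (hK.union hJ) (hs.trans subset_union_left) (hVr hp.1) hpK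
    (Q := fun z => (z - q)⁻¹) (ContinuousOn.inv₀ (by fun_prop) hpq')
    (fun z hz => inv_ne_zero (hpq' z hz)) one_ne_zero (hl.congr fun z _ => ?_)
  rw [zpow_one, div_eq_mul_inv]

theorem same_component_of_two_points {K' J : Set ℂ} (hK : IsClosed K') (hJ : IsClosed J)
    (hJl : HasAllLogs J) {x y : ℂ} (hKJ : K' ∩ J ⊆ {x, y}) {m : ℂ} {r : ℝ}
    (hs : Metric.sphere m r ⊆ K') {V : Set ℂ} (hV : IsPreconnected V) (hVK : Disjoint V K')
    (hVr : V ⊆ Metric.ball m r) {p q s : ℂ} (hp : p ∈ V \ J) (hq : q ∈ V \ J) (hs' : s ∈ V \ J) :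
    q ∈ connectedComponentIn (K' ∪ J)ᶜ p ∨ s ∈ connectedComponentIn (K' ∪ J)ᶜ p ∨
      s ∈ connectedComponentIn (K' ∪ J)ᶜ q := by
  by_contra! hcon
  obtain ⟨hpq, hps, hqs⟩ := hcon
  have hnK : ∀ p ∈ V \ J, p ∉ K' ∪ J := fun p hp h => h.elim (disjoint_left.1 hVK hp.1) hp.2
  have hsym : ∀ a b, a ∉ K' ∪ J → b ∉ K' ∪ J → b ∉ connectedComponentIn (K' ∪ J)ᶜ a →
      a ∉ connectedComponentIn (K' ∪ J)ᶜ b := by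
    intro a b ha hb h h'
    exact h (by rw [← connectedComponentIn_eq h']; exact mem_connectedComponentIn hb)
  have hqp := hsym _ _ (hnK p hp) (hnK q hq) hpq
  have hsp := hsym _ _ (hnK p hp) (hnK s hs') hps
  have hsq := hsym _ _ (hnK q hq) (hnK s hs') hqs
  have hJ0 : ∀ p ∈ V \ J, ∀ z ∈ J, z - p ≠ 0 := fun p hp z hz h =>
    hp.2 (by rw [← sub_eq_zero.1 h]; exact hz)
  have hJd : ∀ p ∈ V \ J, ∀ q ∈ V \ J, HasLogOn J (fun z => (z - p) / (z - q)) :=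
    fun p hp q hq => hJl _ (ContinuousOn.div (by fun_prop) (by fun_prop) (hJ0 q hq))
      (fun z hz => div_ne_zero (hJ0 p hp z hz) (hJ0 q hq z hz))
  obtain ⟨n, hn⟩ := exists_logMismatch x y (hasLogOn_div hK hV hVK hp.1 hq.1) (hJd p hp q hq)
  obtain ⟨l, hl⟩ := exists_logMismatch x y (hasLogOn_div hK hV hVK hp.1 hs'.1) (hJd p hp s hs')
  obtain ⟨a, b, hab, hne⟩ : ∃ a b : ℤ, a * n + b * l = 0 ∧ (a ≠ 0 ∨ b ≠ 0) := by
    by_cases h : n = 0 ∧ l = 0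
    · exact ⟨1, 0, by simp [h.1], Or.inl one_ne_zero⟩
    · exact ⟨l, -n, by ring, by by_contra! h'; exact h ⟨by linarith [h'.2], h'.1⟩⟩
  have hm := hn.zpow_mul_zpow hl a b
  rw [hab] at hm
  have hlog := hm.hasLogOn hK hJ hKJ
  have hK0 : ∀ p ∈ V \ J, ∀ z ∈ K' ∪ J, z - p ≠ 0 := fun p hp z hz h =>
    hnK p hp (by rw [← sub_eq_zero.1 h]; exact hz)
  have hcz : ∀ (A : Set ℂ) (p : ℂ) (e : ℤ), (∀ z ∈ A, z - p ≠ 0) →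
      ContinuousOn (fun z => (z - p) ^ e) A := fun A p e h =>
    ContinuousOn.zpow₀ (by fun_prop) e fun z hz => Or.inl (h z hz)
  rcases hne with ha | hb
  · have h1 := sub_ne_zero_of_component (hnK p hp) hqp
    have h2 := sub_ne_zero_of_component (hnK s hs') hqs
    refine not_hasLogOn_of_component (hK.union hJ) (hs.trans subset_union_left) (hVr hq.1)
      (hnK q hq) (Q := fun z => (z - p) ^ (a + b) * (z - s) ^ (-b))
      ((hcz _ p _ h1).mul (hcz _ s _ h2))
      (fun z hz => mul_ne_zero (zpow_ne_zero _ (h1 z hz)) (zpow_ne_zero _ (h2 z hz)))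
      (neg_ne_zero.2 ha) (hlog.congr fun z hz => ?_)
    have := hK0 p hp z hz
    have := hK0 q hq z hz
    have := hK0 s hs' z hz
    rw [div_zpow, div_zpow, zpow_add₀ (hK0 p hp z hz), zpow_neg, zpow_neg]
    field_simp
  · have h1 := sub_ne_zero_of_component (hnK p hp) hsp
    have h2 := sub_ne_zero_of_component (hnK q hq) hsq
    refine not_hasLogOn_of_component (hK.union hJ) (hs.trans subset_union_left) (hVr hs'.1)
      (hnK s hs') (Q := fun z => (z - p) ^ (a + b) * (z - q) ^ (-a))
      ((hcz _ p _ h1).mul (hcz _ q _ h2))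
      (fun z hz => mul_ne_zero (zpow_ne_zero _ (h1 z hz)) (zpow_ne_zero _ (h2 z hz)))
      (neg_ne_zero.2 hb) (hlog.congr fun z hz => ?_)
    have := hK0 p hp z hz
    have := hK0 q hq z hz
    have := hK0 s hs' z hz
    rw [div_zpow, div_zpow, zpow_add₀ (hK0 p hp z hz), zpow_neg, zpow_neg]
    field_simp

theorem arc_local_three {f : ℝ → ℂ} {a b t₀ : ℝ} (hf : ContinuousOn f (Icc a b))
    (hi : InjOn f (Icc a b)) (ht : t₀ ∈ Ioo a b) {r : ℝ} (hr : 0 < r) :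
    ∃ ρ > 0, ρ ≤ r ∧ ∀ p ∈ Metric.ball (f t₀) ρ \ f '' Icc a b,
    ∀ q ∈ Metric.ball (f t₀) ρ \ f '' Icc a b,
      ∀ s ∈ Metric.ball (f t₀) ρ \ f '' Icc a b,
      ∃ T, IsPreconnected T ∧ T ⊆ Metric.ball (f t₀) r \ f '' Icc a b ∧
        (p ∈ T ∧ q ∈ T ∨ p ∈ T ∧ s ∈ T ∨ q ∈ T ∧ s ∈ T) := by
  have hct : ContinuousAt f t₀ := hf.continuousAt (Icc_mem_nhds ht.1 ht.2)
  obtain ⟨δ₀, hδ₀, hδr⟩ := Metric.continuousAt_iff.1 hct r hr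
  obtain ⟨δ, hδ, hδ1, hδ2, hδ3⟩ : ∃ δ > 0, δ < δ₀ ∧ a ≤ t₀ - δ ∧ t₀ + δ ≤ b := by
    refine ⟨min (δ₀ / 2) (min (t₀ - a) (b - t₀)), ?_, ?_, ?_, ?_⟩
    · simp [hδ₀, ht.1, ht.2]
    · exact (min_le_left _ _).trans_lt (by linarith)
    · linarith [(min_le_right (δ₀ / 2) (min (t₀ - a) (b - t₀))).trans (min_le_left _ _)]
    · linarith [(min_le_right (δ₀ / 2) (min (t₀ - a) (b - t₀))).trans (min_le_right _ _)]
  set J := f '' Icc (t₀ - δ) (t₀ + δ) with hJdef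
  set K' := Metric.sphere (f t₀) r ∪ (f '' Icc a (t₀ - δ) ∪ f '' Icc (t₀ + δ) b) with hKdef
  have s0 : Icc (t₀ - δ) (t₀ + δ) ⊆ Icc a b := Icc_subset_Icc hδ2 hδ3
  have s1 : Icc a (t₀ - δ) ⊆ Icc a b := Icc_subset_Icc le_rfl (by linarith)
  have s2 : Icc (t₀ + δ) b ⊆ Icc a b := Icc_subset_Icc (by linarith) le_rfl
  have hJr : J ⊆ Metric.ball (f t₀) r := by
    rintro _ ⟨t, ht', rfl⟩
    exact hδr (by rw [Real.dist_eq, abs_lt]; constructor <;> linarith [ht'.1, ht'.2])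
  have hcl : ∀ {c d}, Icc c d ⊆ Icc a b → IsClosed (f '' Icc c d) := fun h =>
    (isCompact_Icc.image_of_continuousOn (hf.mono h)).isClosed
  have hJ : IsClosed J := hcl s0
  have hK : IsClosed K' := Metric.isClosed_sphere.union ((hcl s1).union (hcl s2))
  have hunion : K' ∪ J = Metric.sphere (f t₀) r ∪ f '' Icc a b := by
    have : Icc a b = Icc a (t₀ - δ) ∪ Icc (t₀ + δ) b ∪ Icc (t₀ - δ) (t₀ + δ) := by
      ext t; simp only [mem_Icc, mem_union]; grind
    rw [hKdef, hJdef, this, image_union, image_union, union_assoc]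
  have hKJ : K' ∩ J ⊆ {f (t₀ - δ), f (t₀ + δ)} := by
    rintro _ ⟨hz, t, ht', rfl⟩
    rcases hz with hz | ⟨u, hu, hut⟩ | ⟨u, hu, hut⟩
    · exact absurd (hJr (mem_image_of_mem f ht')) (by simpa using (Metric.mem_sphere.1 hz).ge)
    · have := hi (s1 hu) (s0 ht') hut
      left; rw [show t = t₀ - δ by linarith [hu.2, ht'.1]]
    · have := hi (s2 hu) (s0 ht') hut
      right; rw [show t = t₀ + δ by linarith [hu.1, ht'.2]]; rfl
  have hmK : f t₀ ∉ K' := by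
    rintro (hz | ⟨u, hu, hut⟩ | ⟨u, hu, hut⟩)
    · simp [hr.ne] at hz
    · have := hi (s1 hu) (Ioo_subset_Icc_self ht) hut; linarith [hu.2]
    · have := hi (s2 hu) (Ioo_subset_Icc_self ht) hut; linarith [hu.1]
  obtain ⟨ε, hε, hεK⟩ := Metric.isOpen_iff.1 hK.isOpen_compl _ hmK
  refine ⟨min ε r, lt_min hε hr, min_le_right _ _, ?_⟩
  have hVε : Metric.ball (f t₀) (min ε r) ⊆ Metric.ball (f t₀) ε :=
    Metric.ball_subset_ball (min_le_left _ _)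
  have hVr : Metric.ball (f t₀) (min ε r) ⊆ Metric.ball (f t₀) r :=
    Metric.ball_subset_ball (min_le_right _ _)
  intro p hp q hq s hs
  have hJs : J ⊆ f '' Icc a b := image_mono s0
  have hV' : ∀ p ∈ Metric.ball (f t₀) (min ε r) \ f '' Icc a b,
      p ∈ Metric.ball (f t₀) (min ε r) \ J :=
    fun p hp => ⟨hp.1, fun h => hp.2 (hJs h)⟩
  have hmain := same_component_of_two_points hK hJ (hasAllLogs_arc (hf.mono s0) (hi.mono s0)) hKJ
    (subset_union_left : Metric.sphere (f t₀) r ⊆ K') (V := Metric.ball (f t₀) (min ε r))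
    (convex_ball _ _).isPreconnected
    (disjoint_left.2 fun z hz hzK => hεK (hVε hz) hzK) hVr (hV' p hp) (hV' q hq) (hV' s hs)
  have hself : ∀ p ∈ Metric.ball (f t₀) (min ε r) \ f '' Icc a b,
      p ∈ connectedComponentIn (K' ∪ J)ᶜ p := fun p hp => mem_connectedComponentIn (by
    rintro (h | h)
    · exact hεK (hVε hp.1) h
    · exact (hV' p hp).2 h)
  have hsub : ∀ p ∈ Metric.ball (f t₀) (min ε r) \ f '' Icc a b,
      connectedComponentIn (K' ∪ J)ᶜ p ⊆ Metric.ball (f t₀) r \ f '' Icc a b := fun p hp z hz => by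
    refine ⟨connectedComponentIn_subset_ball (subset_union_left.trans subset_union_left)
      (hVr hp.1) hz, ?_⟩
    have := connectedComponentIn_subset _ _ hz
    rw [hunion] at this
    exact fun h => this (Or.inr h)
  rcases hmain with h | h | h
  · exact ⟨_, isPreconnected_connectedComponentIn, hsub p hp, Or.inl ⟨hself p hp, h⟩⟩
  · exact ⟨_, isPreconnected_connectedComponentIn, hsub p hp, Or.inr (Or.inl ⟨hself p hp, h⟩)⟩
  · exact ⟨_, isPreconnected_connectedComponentIn, hsub q hq, Or.inr (Or.inr ⟨hself q hq, h⟩)⟩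

theorem arc_local_end {f : ℝ → ℂ} {a b : ℝ} (hab : a < b) (hf : ContinuousOn f (Icc a b))
    (hi : InjOn f (Icc a b)) {r : ℝ} (hr : 0 < r) :
    ∃ ρ > 0, ρ ≤ r ∧ ∀ p ∈ Metric.ball (f a) ρ \ f '' Icc a b,
    ∀ q ∈ Metric.ball (f a) ρ \ f '' Icc a b,
      ∃ T, IsPreconnected T ∧ T ⊆ Metric.ball (f a) r \ f '' Icc a b ∧ p ∈ T ∧ q ∈ T := by
  have ha : a ∈ Icc a b := left_mem_Icc.2 hab.le
  obtain ⟨δ₀, hδ₀, hδr⟩ := Metric.continuousWithinAt_iff.1 (hf a ha) r hr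
  obtain ⟨δ, hδ, hδ1, hδ3⟩ : ∃ δ > 0, δ < δ₀ ∧ a + δ ≤ b := by
    refine ⟨min (δ₀ / 2) (b - a), ?_, ?_, ?_⟩
    · simp [hδ₀, hab]
    · exact (min_le_left _ _).trans_lt (by linarith)
    · linarith [min_le_right (δ₀ / 2) (b - a)]
  set J := f '' Icc a (a + δ) with hJdef
  set K' := Metric.sphere (f a) r ∪ f '' Icc (a + δ) b with hKdef
  have s0 : Icc a (a + δ) ⊆ Icc a b := Icc_subset_Icc le_rfl hδ3
  have s2 : Icc (a + δ) b ⊆ Icc a b := Icc_subset_Icc (by linarith) le_rfl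
  have hJr : J ⊆ Metric.ball (f a) r := by
    rintro _ ⟨t, ht', rfl⟩
    exact hδr (s0 ht') (by rw [Real.dist_eq, abs_lt]; constructor <;> linarith [ht'.1, ht'.2])
  have hcl : ∀ {c d}, Icc c d ⊆ Icc a b → IsClosed (f '' Icc c d) := fun h =>
    (isCompact_Icc.image_of_continuousOn (hf.mono h)).isClosed
  have hJ : IsClosed J := hcl s0
  have hK : IsClosed K' := Metric.isClosed_sphere.union (hcl s2)
  have hunion : K' ∪ J = Metric.sphere (f a) r ∪ f '' Icc a b := by
    have : Icc a b = Icc (a + δ) b ∪ Icc a (a + δ) := by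
      ext t; simp only [mem_Icc, mem_union]; grind
    rw [hKdef, hJdef, this, image_union, union_assoc]
  have hKJ : K' ∩ J ⊆ {f (a + δ)} := by
    rintro _ ⟨hz, t, ht', rfl⟩
    rcases hz with hz | ⟨u, hu, hut⟩
    · exact absurd (hJr (mem_image_of_mem f ht')) (by simpa using (Metric.mem_sphere.1 hz).ge)
    · have := hi (s2 hu) (s0 ht') hut
      rw [show t = a + δ by linarith [hu.1, ht'.2]]; rfl
  have hmK : f a ∉ K' := by
    rintro (hz | ⟨u, hu, hut⟩)
    · simp [hr.ne] at hz
    · have := hi (s2 hu) ha hut; linarith [hu.1]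
  obtain ⟨ε, hε, hεK⟩ := Metric.isOpen_iff.1 hK.isOpen_compl _ hmK
  refine ⟨min ε r, lt_min hε hr, min_le_right _ _, ?_⟩
  have hVε : Metric.ball (f a) (min ε r) ⊆ Metric.ball (f a) ε :=
    Metric.ball_subset_ball (min_le_left _ _)
  have hVr : Metric.ball (f a) (min ε r) ⊆ Metric.ball (f a) r :=
    Metric.ball_subset_ball (min_le_right _ _)
  intro p hp q hq
  have hV' : ∀ p ∈ Metric.ball (f a) (min ε r) \ f '' Icc a b,
      p ∈ Metric.ball (f a) (min ε r) \ J :=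
    fun p hp => ⟨hp.1, fun h => hp.2 (image_mono s0 h)⟩
  have hmain := same_component_of_one_point hK hJ (hasAllLogs_arc (hf.mono s0) (hi.mono s0)) hKJ
    (subset_union_left : Metric.sphere (f a) r ⊆ K') (V := Metric.ball (f a) (min ε r))
    (convex_ball _ _).isPreconnected
    (disjoint_left.2 fun z hz hzK => hεK (hVε hz) hzK) hVr (hV' p hp) (hV' q hq)
  have hself : p ∈ connectedComponentIn (K' ∪ J)ᶜ p := mem_connectedComponentIn (by
    rintro (h | h)
    · exact hεK (hVε hp.1) h
    · exact (hV' p hp).2 h)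
  refine ⟨_, isPreconnected_connectedComponentIn, fun z hz => ⟨connectedComponentIn_subset_ball
    (subset_union_left.trans subset_union_left)
      (hVr hp.1) hz, ?_⟩, hself, hmain⟩
  have := connectedComponentIn_subset _ _ hz
  rw [hunion] at this
  exact fun h => this (Or.inr h)

/-- Every point of `S` lies in an open subset homeomorphic to the plane. -/
def IsPlanar (S : Type*) [TopologicalSpace S] : Prop :=
  ∀ m : S, ∃ φ : ℂ → S, Topology.IsOpenEmbedding φ ∧ m ∈ range φ

/-- A closed subset `Z` with a two-colouring of its complement, for which near every point of `Z`
each of the two colours is a single local side. -/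
structure IsWall {M : Type*} [TopologicalSpace M] (Z : Set M) (col : Bool → Set M) : Prop where
  isClosed : IsClosed Z
  isOpen : ∀ c, IsOpen (col c)
  disjoint : Disjoint (col true) (col false)
  union : col true ∪ col false = Zᶜ
  subset_closure : ∀ c, Z ⊆ closure (col c)
  side : ∀ m ∈ Z, ∀ U ∈ 𝓝 m, ∃ V ∈ 𝓝 m, V ⊆ U ∧ ∀ c, ∀ p ∈ V ∩ col c, ∀ q ∈ V ∩ col c,
    ∃ T ⊆ U ∩ Zᶜ, IsPreconnected T ∧ p ∈ T ∧ q ∈ T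
  along : ∀ m ∈ Z, ∀ U ∈ 𝓝 m, ∃ V ∈ 𝓝 m, V ⊆ U ∧ ∀ q ∈ V ∩ Z,
    ∃ T ⊆ U ∩ Z, IsPreconnected T ∧ m ∈ T ∧ q ∈ T

theorem coe_circle_eq_iff {s t : ℝ} : (s : Circle1) = (t : Circle1) ↔ ∃ n : ℤ, s = t + n := by
  rw [← sub_eq_zero, ← AddCircle.coe_sub, AddCircle.coe_eq_zero_iff]
  simp only [zsmul_eq_mul, mul_one]
  exact exists_congr fun n => ⟨fun h => by linarith, fun h => by linarith⟩

theorem injOn_circle_param {S : Type*} [TopologicalSpace S] {f : C(Circle1, S)}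
    (hf : Function.Injective f) (t₀ : ℝ) :
    InjOn (fun t : ℝ => f t) (Icc (t₀ - 1 / 4) (t₀ + 1 / 4)) := by
  intro s hs t ht h
  obtain ⟨n, hn⟩ := coe_circle_eq_iff.1 (hf h)
  have h1 : (n : ℝ) < 1 := by linarith [hs.2, ht.1]
  have h2 : (-1 : ℝ) < n := by linarith [hs.1, ht.2]
  have : n = 0 := by
    have h1' : n < 1 := by exact_mod_cast h1
    have h2' : -1 < n := by exact_mod_cast h2
    omega
  simpa [this] using hn

theorem curve_chart {S : Type*} [TopologicalSpace S] [T2Space S] (hS : IsPlanar S)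
    {f : C(Circle1, S)} (hf : Function.Injective f) (t₀ : ℝ) {U : Set S}
    (hU : U ∈ 𝓝 (f t₀)) {ε : ℝ} (hε : 0 < ε) :
    ∃ (φ : ℂ → S) (δ : ℝ) (g : ℝ → ℂ) (r : ℝ), Topology.IsOpenEmbedding φ ∧ 0 < δ ∧ δ < ε ∧ 0 < r ∧
      ContinuousOn g (Icc (t₀ - δ) (t₀ + δ)) ∧ InjOn g (Icc (t₀ - δ) (t₀ + δ)) ∧
      (∀ t ∈ Icc (t₀ - δ) (t₀ + δ), φ (g t) = f t ∧ f t ∈ U) ∧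
      (∀ z ∈ Metric.ball (g t₀) r, φ z ∈ U ∧
        (φ z ∈ range f → ∃ t ∈ Ioo (t₀ - δ) (t₀ + δ), z = g t)) := by
  obtain ⟨φ, hφ, hm⟩ := hS (f t₀)
  have hcF : Continuous fun t : ℝ => f t := f.continuous.comp (AddCircle.continuous_mk' 1)
  have hU' : U ∩ range φ ∈ 𝓝 (f t₀) := Filter.inter_mem hU (hφ.isOpen_range.mem_nhds hm)
  obtain ⟨δ₀, hδ₀, hδU⟩ := Metric.mem_nhds_iff.1 (hcF.continuousAt.preimage_mem_nhds hU')
  obtain ⟨δ, hδ, hδ1, hδ2, hδ3⟩ : ∃ δ > 0, δ < δ₀ ∧ δ < ε ∧ δ ≤ 1 / 4 := by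
    refine ⟨min (δ₀ / 2) (min (ε / 2) (1 / 4)), ?_, ?_, ?_, ?_⟩
    · simp [hδ₀, hε]
    · exact (min_le_left _ _).trans_lt (by linarith)
    · exact ((min_le_right _ _).trans (min_le_left _ _)).trans_lt (by linarith)
    · exact (min_le_right _ _).trans (min_le_right _ _)
  have hsub : Icc (t₀ - δ) (t₀ + δ) ⊆ Icc (t₀ - 1 / 4) (t₀ + 1 / 4) :=
    Icc_subset_Icc (by linarith) (by linarith)
  have hin : ∀ t ∈ Icc (t₀ - δ) (t₀ + δ), f t ∈ U ∩ range φ := fun t ht => by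
    apply hδU
    rw [Metric.mem_ball, Real.dist_eq, abs_lt]
    constructor <;> linarith [ht.1, ht.2]
  have hinj := (injOn_circle_param hf t₀).mono hsub
  let g : ℝ → ℂ := fun t => Function.invFun φ (f t)
  have hg : ∀ t ∈ Icc (t₀ - δ) (t₀ + δ), φ (g t) = f t := fun t ht =>
    Function.invFun_eq (hin t ht).2
  have ht₀ : t₀ ∈ Icc (t₀ - δ) (t₀ + δ) := ⟨by linarith, by linarith⟩
  have hgc : ContinuousOn g (Icc (t₀ - δ) (t₀ + δ)) := by
    rw [hφ.isInducing.continuousOn_iff]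
    exact hcF.continuousOn.congr fun t ht => hg t ht
  have hgi : InjOn g (Icc (t₀ - δ) (t₀ + δ)) := fun s hs t ht h =>
    hinj hs ht (by simp only [← hg s hs, ← hg t ht, h])
  let K : Set S := (fun t : ℝ => f t) '' (Icc (t₀ - 1 / 2) (t₀ - δ) ∪ Icc (t₀ + δ) (t₀ + 1 / 2))
  have hK : IsClosed K := ((isCompact_Icc.union isCompact_Icc).image hcF).isClosed
  have hmK : f t₀ ∉ K := by
    rintro ⟨t, ht, h⟩
    obtain ⟨n, hn⟩ := coe_circle_eq_iff.1 (hf h)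
    have h3 : |t - t₀| ≤ 1 / 2 ∧ δ ≤ |t - t₀| := by
      rcases ht with ht | ht
      · rw [abs_of_nonpos (by linarith [ht.2])]; constructor <;> linarith [ht.1, ht.2]
      · rw [abs_of_nonneg (by linarith [ht.1])]; constructor <;> linarith [ht.1, ht.2]
    rw [show t - t₀ = n by linarith] at h3
    have h4 : |(n : ℝ)| < 1 := by linarith [h3.1]
    have h5 : n = 0 := by
      have : |n| < 1 := by exact_mod_cast h4
      exact Int.abs_lt_one_iff.1 this
    rw [h5] at h3
    simp at h3; linarith
  have hW : φ ⁻¹' (U ∩ Kᶜ) ∈ 𝓝 (g t₀) := by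
    apply hφ.continuous.continuousAt.preimage_mem_nhds
    rw [hg t₀ ht₀]
    exact Filter.inter_mem hU (hK.isOpen_compl.mem_nhds hmK)
  obtain ⟨r, hr, hrW⟩ := Metric.mem_nhds_iff.1 hW
  refine ⟨φ, δ, g, r, hφ, hδ, hδ2, hr, hgc, hgi, fun t ht => ⟨hg t ht, (hin t ht).1⟩, fun z hz =>
    ⟨(hrW hz).1, ?_⟩⟩
  rintro ⟨x, hx⟩
  obtain ⟨t, ht, rfl⟩ : ∃ t ∈ Icc (t₀ - 1 / 2) (t₀ + 1 / 2), (t : Circle1) = x := by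
    have hx' : x ∈ (fun t : ℝ => (t : Circle1)) '' Icc (t₀ - 1 / 2) (t₀ - 1 / 2 + 1) := by
      rw [AddCircle.coe_image_Icc_eq]; trivial
    obtain ⟨t, ht, h⟩ := hx'
    exact ⟨t, ⟨ht.1, by linarith [ht.2]⟩, h⟩
  by_cases hti : t ∈ Ioo (t₀ - δ) (t₀ + δ)
  · refine ⟨t, hti, hφ.injective ?_⟩
    rw [hg t (Ioo_subset_Icc_self hti), hx]
  · exfalso
    apply (hrW hz).2
    rw [← hx]
    refine mem_image_of_mem (fun t : ℝ => f t) ?_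
    simp only [mem_Ioo, not_and_or, not_lt] at hti
    rcases hti with h | h
    · exact Or.inl ⟨ht.1, h⟩
    · exact Or.inr ⟨h, ht.2⟩

theorem curve_local_three {S : Type*} [TopologicalSpace S] [T2Space S] (hS : IsPlanar S)
    {f : C(Circle1, S)} (hf : Function.Injective f) {m : S} (hm : m ∈ range f) {U : Set S}
    (hU : U ∈ 𝓝 m) : ∃ V ∈ 𝓝 m, V ⊆ U ∧ ∀ p ∈ V \ range f, ∀ q ∈ V \ range f, ∀ s ∈ V \ range f,
      ∃ T ⊆ U ∩ (range f)ᶜ, IsPreconnected T ∧ (p ∈ T ∧ q ∈ T ∨ p ∈ T ∧ s ∈ T ∨ q ∈ T ∧ s ∈ T) := by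
  obtain ⟨x, rfl⟩ := hm
  obtain ⟨t₀, rfl⟩ := QuotientAddGroup.mk_surjective x
  obtain ⟨φ, δ, g, r, hφ, hδ, -, hr, hgc, hgi, hg, hz⟩ := curve_chart hS hf t₀ hU one_pos
  have ht₀ : t₀ ∈ Icc (t₀ - δ) (t₀ + δ) := ⟨by linarith, by linarith⟩
  obtain ⟨ρ, hρ, hρr, H⟩ := arc_local_three hgc hgi (t₀ := t₀) ⟨by linarith, by linarith⟩ hr
  have hbr := Metric.ball_subset_ball (x := g t₀) hρr
  refine ⟨φ '' Metric.ball (g t₀) ρ, ?_, ?_, ?_⟩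
  · have := hφ.image_mem_nhds.2 (Metric.ball_mem_nhds (g t₀) hρ)
    rwa [(hg t₀ ht₀).1] at this
  · rintro _ ⟨z, hz', rfl⟩
    exact (hz z (hbr hz')).1
  · have hnJ : ∀ z, φ z ∉ range f → z ∉ g '' Icc (t₀ - δ) (t₀ + δ) := by
      rintro _ h ⟨t, ht, rfl⟩
      exact h ⟨t, ((hg t ht).1).symm⟩
    rintro _ ⟨⟨p, hp, rfl⟩, hp'⟩ _ ⟨⟨q, hq, rfl⟩, hq'⟩ _ ⟨⟨s, hs, rfl⟩, hs'⟩
    obtain ⟨T, hT, hTs, hor⟩ := H p ⟨hp, hnJ _ hp'⟩ q ⟨hq, hnJ _ hq'⟩ s ⟨hs, hnJ _ hs'⟩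
    refine ⟨φ '' T, ?_, hT.image φ hφ.continuous.continuousOn, ?_⟩
    · rintro _ ⟨z, hzT, rfl⟩
      refine ⟨(hz z (hTs hzT).1).1, fun h => ?_⟩
      obtain ⟨t, ht, rfl⟩ := (hz z (hTs hzT).1).2 h
      exact (hTs hzT).2 (mem_image_of_mem g (Ioo_subset_Icc_self ht))
    · rcases hor with h | h | h
      · exact Or.inl ⟨mem_image_of_mem φ h.1, mem_image_of_mem φ h.2⟩
      · exact Or.inr (Or.inl ⟨mem_image_of_mem φ h.1, mem_image_of_mem φ h.2⟩)
      · exact Or.inr (Or.inr ⟨mem_image_of_mem φ h.1, mem_image_of_mem φ h.2⟩)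

theorem closure_compl_curve {S : Type*} [TopologicalSpace S] [T2Space S] (hS : IsPlanar S)
    {f : C(Circle1, S)} (hf : Function.Injective f) : closure (range f)ᶜ = univ := by
  rw [eq_univ_iff_forall]
  intro m
  by_cases hm : m ∈ range f
  swap
  · exact subset_closure hm
  rw [mem_closure_iff_nhds]
  intro U hU
  obtain ⟨x, rfl⟩ := hm
  obtain ⟨t₀, rfl⟩ := QuotientAddGroup.mk_surjective x
  obtain ⟨φ, δ, g, r, hφ, hδ, -, hr, hgc, hgi, hg, hz⟩ := curve_chart hS hf t₀ hU one_pos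
  by_contra hne
  rw [not_nonempty_iff_eq_empty, ← disjoint_iff_inter_eq_empty,
    disjoint_compl_right_iff_subset] at hne
  refine not_sphere_subset_arc hgc hgi (g t₀) (half_pos hr) fun z hzs => ?_
  have hzb : z ∈ Metric.ball (g t₀) r := by
    rw [Metric.mem_sphere] at hzs
    rw [Metric.mem_ball]; linarith
  obtain ⟨t, ht, rfl⟩ := (hz z hzb).2 (hne (hz z hzb).1)
  exact mem_image_of_mem g (Ioo_subset_Icc_self ht)

theorem curve_subset_closure {S : Type*} [TopologicalSpace S] [T2Space S] [ConnectedSpace S]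
    (hS : IsPlanar S) {f : C(Circle1, S)} (hf : Function.Injective f) {A B : Set S}
    (hA : IsOpen A) (hB : IsOpen B) (hA0 : A.Nonempty) (hB0 : B.Nonempty) (hAB : Disjoint A B)
    (hu : A ∪ B = (range f)ᶜ) : range f ⊆ closure A ∩ closure B := by
  set E := closure A ∩ closure B with hE
  have hEc : IsClosed E := isClosed_closure.inter isClosed_closure
  have hcov : closure A ∪ closure B = univ := by
    rw [← closure_union, hu, closure_compl_curve hS hf]
  have hAcB : ∀ x ∈ A, x ∉ closure B := fun x hx => disjoint_left.1 (hAB.closure_right hA) hx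
  have hBcA : ∀ x ∈ B, x ∉ closure A := fun x hx h => disjoint_left.1 (hAB.closure_left hB) h hx
  have hEγ : E ⊆ range f := by
    intro x hx
    by_contra h
    have : x ∈ A ∪ B := by rw [hu]; exact h
    rcases this with h | h
    · exact hAcB x h hx.2
    · exact hBcA x h hx.1
  have hE0 : E.Nonempty := by
    have := isPreconnected_closed_iff.1 (isPreconnected_univ (α := S)) (closure A) (closure B)
      isClosed_closure isClosed_closure hcov.ge (by simpa using hA0) (by simpa using hB0)
    simpa using this
  by_contra hcon
  obtain ⟨_, ⟨x, rfl⟩, hxE⟩ := not_subset.1 hcon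
  obtain ⟨s, rfl⟩ := QuotientAddGroup.mk_surjective x
  have hcF : Continuous fun t : ℝ => f t := f.continuous.comp (AddCircle.continuous_mk' 1)
  set D : Set ℝ := (fun t : ℝ => f t) ⁻¹' E ∩ Ici s with hD
  have hDc : IsClosed D := (hEc.preimage hcF).inter isClosed_Ici
  have hD0 : D.Nonempty := by
    obtain ⟨y, hy⟩ := hE0
    obtain ⟨x, rfl⟩ := hEγ hy
    obtain ⟨t, rfl⟩ := QuotientAddGroup.mk_surjective x
    obtain ⟨n, hn⟩ := exists_nat_ge (s - t)
    refine ⟨t + n, ?_, ?_⟩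
    · have : ((t + n : ℝ) : Circle1) = t := coe_circle_eq_iff.2 ⟨n, by simp⟩
      simp only [mem_preimage, this]
      exact hy
    · simp only [mem_Ici]; linarith
  have hDb : BddBelow D := ⟨s, fun t ht => ht.2⟩
  have ht₀ := hDc.csInf_mem hD0 hDb
  set t₀ := sInf D
  have hst : s < t₀ := lt_of_le_of_ne ht₀.2 (by rintro h; exact hxE (h ▸ ht₀.1))
  obtain ⟨φ, δ, g, r, hφ, hδ, hδs, hr, hgc, hgi, hg, hz⟩ :=
    curve_chart hS hf t₀ Filter.univ_mem (sub_pos.2 hst)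
  have hsub : Icc t₀ (t₀ + δ) ⊆ Icc (t₀ - δ) (t₀ + δ) := Icc_subset_Icc (by linarith) le_rfl
  have ht₀' : t₀ ∈ Icc (t₀ - δ) (t₀ + δ) := ⟨by linarith, by linarith⟩
  obtain ⟨ρ, hρ, hρr, H⟩ := arc_local_end (by linarith) (hgc.mono hsub) (hgi.mono hsub) hr
  have hV : φ '' Metric.ball (g t₀) ρ ∈ 𝓝 (f t₀) := by
    have := hφ.image_mem_nhds.2 (Metric.ball_mem_nhds (g t₀) hρ)
    rwa [(hg t₀ ht₀').1] at this
  obtain ⟨_, ⟨p, hp, rfl⟩, hpA⟩ := mem_closure_iff_nhds.1 ht₀.1.1 _ hV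
  obtain ⟨_, ⟨q, hq, rfl⟩, hqB⟩ := mem_closure_iff_nhds.1 ht₀.1.2 _ hV
  have hnJ : ∀ z, φ z ∉ range f → z ∉ g '' Icc t₀ (t₀ + δ) := by
    rintro _ h ⟨t, ht, rfl⟩
    exact h ⟨t, ((hg t (hsub ht)).1).symm⟩
  obtain ⟨T, hT, hTs, hpT, hqT⟩ := H p ⟨hp, hnJ p (by
    have : φ p ∈ A ∪ B := Or.inl hpA
    rwa [hu] at this)⟩ q ⟨hq, hnJ q (by
    have : φ q ∈ A ∪ B := Or.inr hqB
    rwa [hu] at this)⟩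
  have hTE : φ '' T ⊆ (closure A)ᶜ ∪ (closure B)ᶜ := by
    rw [← compl_inter]
    rintro _ ⟨z, hzT, rfl⟩ hzE
    obtain ⟨t, ht, rfl⟩ := (hz z (hTs hzT).1).2 (hEγ hzE)
    refine (hTs hzT).2 (mem_image_of_mem g ⟨?_, ht.2.le⟩)
    by_contra hlt
    have htD : t ∈ D := ⟨by
      have := (hg t (Ioo_subset_Icc_self ht)).1
      simp only [mem_preimage, ← this]; exact hzE, by simp only [mem_Ici]; linarith [ht.1]⟩
    exact hlt (csInf_le hDb htD)
  obtain ⟨w, -, hw1, hw2⟩ := hT.image φ hφ.continuous.continuousOn _ _ isClosed_closure.isOpen_compl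
    isClosed_closure.isOpen_compl hTE ⟨φ q, mem_image_of_mem φ hqT, hBcA _ hqB⟩
    ⟨φ p, mem_image_of_mem φ hpT, hAcB _ hpA⟩
  have : w ∈ closure A ∪ closure B := by rw [hcov]; trivial
  exact this.elim hw1 hw2

theorem exists_isWall {S : Type*} [TopologicalSpace S] [T2Space S] [ConnectedSpace S]
    (hS : IsPlanar S) {f : C(Circle1, S)} (hf : Function.Injective f)
    (hsep : ¬ IsPreconnected (range f)ᶜ) : ∃ col, IsWall (range f) col := by
  have hcl : IsClosed (range f) := (isCompact_range f.continuous).isClosed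
  simp only [IsPreconnected, not_forall] at hsep
  obtain ⟨u, v, hu, hv, huv, hu0, hv0, hne⟩ := hsep
  set A := (range f)ᶜ ∩ u with hA
  set B := (range f)ᶜ ∩ v with hB
  have hAo : IsOpen A := hcl.isOpen_compl.inter hu
  have hBo : IsOpen B := hcl.isOpen_compl.inter hv
  have hAB : Disjoint A B := disjoint_left.2 fun x hx hy => hne ⟨x, hx.1, hx.2, hy.2⟩
  have hun : A ∪ B = (range f)ᶜ := by
    rw [hA, hB, ← inter_union_distrib_left, inter_eq_left.2 huv]
  have hcc := curve_subset_closure hS hf hAo hBo hu0 hv0 hAB hun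
  let col : Bool → Set S := fun c => bif c then A else B
  have hopen : ∀ c, IsOpen (col c) := by rintro (_ | _); exacts [hBo, hAo]
  have hclos : ∀ c, range f ⊆ closure (col c) := by
    rintro (_ | _)
    exacts [hcc.trans inter_subset_right, hcc.trans inter_subset_left]
  have hcolc : ∀ c, col c ⊆ (range f)ᶜ := by
    rw [← hun]; rintro (_ | _)
    exacts [subset_union_right, subset_union_left]
  have hmix : ∀ T ⊆ (range f)ᶜ, IsPreconnected T → ∀ c,
      ∀ p ∈ T, ∀ q ∈ T, p ∈ col c → q ∉ col !c := by
    intro T hT hTp c p hp q hq hpc hqc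
    have hcov : T ⊆ col c ∪ col !c := by
      refine hT.trans ?_
      rw [← hun]; cases c
      · rw [union_comm]; exact subset_rfl
      · exact subset_rfl
    obtain ⟨x, -, hx1, hx2⟩ := hTp _ _ (hopen c) (hopen !c) hcov ⟨p, hp, hpc⟩ ⟨q, hq, hqc⟩
    cases c
    · exact disjoint_left.1 hAB hx2 hx1
    · exact disjoint_left.1 hAB hx1 hx2
  refine ⟨col, hcl, hopen, hAB, hun, hclos, ?_, ?_⟩
  · intro m hm U hU
    obtain ⟨V, hV, hVU, H⟩ := curve_local_three hS hf hm hU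
    refine ⟨V, hV, hVU, fun c p hp q hq => ?_⟩
    obtain ⟨s, hsV, hs⟩ := mem_closure_iff_nhds.1 (hclos (!c) hm) V hV
    obtain ⟨T, hTU, hT, h | h | h⟩ := H p ⟨hp.1, hcolc c hp.2⟩ q ⟨hq.1, hcolc c hq.2⟩
      s ⟨hsV, hcolc _ hs⟩
    · exact ⟨T, hTU, hT, h⟩
    · exact absurd hs (hmix T (hTU.trans inter_subset_right) hT c p h.1 s h.2 hp.2)
    · exact absurd hs (hmix T (hTU.trans inter_subset_right) hT c q h.1 s h.2 hq.2)
  · rintro _ ⟨x, rfl⟩ U hU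
    obtain ⟨t₀, rfl⟩ := QuotientAddGroup.mk_surjective x
    obtain ⟨φ, δ, g, r, hφ, hδ, -, hr, hgc, hgi, hg, hz⟩ := curve_chart hS hf t₀ hU one_pos
    have ht₀ : t₀ ∈ Icc (t₀ - δ) (t₀ + δ) := ⟨by linarith, by linarith⟩
    refine ⟨φ '' Metric.ball (g t₀) r, ?_, ?_, ?_⟩
    · have := hφ.image_mem_nhds.2 (Metric.ball_mem_nhds (g t₀) hr)
      rwa [(hg t₀ ht₀).1] at this
    · rintro _ ⟨z, hz', rfl⟩
      exact (hz z hz').1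
    · rintro _ ⟨⟨z, hz', rfl⟩, hzγ⟩
      obtain ⟨t, ht, rfl⟩ := (hz z hz').2 hzγ
      have hcF : Continuous fun t : ℝ => f t := f.continuous.comp (AddCircle.continuous_mk' 1)
      refine ⟨(fun t : ℝ => f t) '' Icc (t₀ - δ) (t₀ + δ), ?_,
        isPreconnected_Icc.image _ hcF.continuousOn, ⟨t₀, ht₀, rfl⟩,
        ⟨t, Ioo_subset_Icc_self ht, ((hg t (Ioo_subset_Icc_self ht)).1).symm⟩⟩
      rintro _ ⟨u, hu, rfl⟩
      exact ⟨(hg u hu).2, mem_range_self _⟩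

theorem IsWall.preimage {M N : Type*} [TopologicalSpace M] [TopologicalSpace N] {Z : Set N}
    {col : Bool → Set N} (h : IsWall Z col) {P : M → N} (hP : IsLocalHomeomorph P) :
    IsWall (P ⁻¹' Z) (fun c => P ⁻¹' col c) where
  isClosed := h.isClosed.preimage hP.continuous
  isOpen c := (h.isOpen c).preimage hP.continuous
  disjoint := h.disjoint.preimage P
  union := by rw [← preimage_union, h.union, preimage_compl]
  subset_closure c := by
    rw [← hP.isOpenMap.preimage_closure_eq_closure_preimage hP.continuous]
    exact preimage_mono (h.subset_closure c)
  side := by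
    intro m hm U hU
    obtain ⟨e, hme, rfl⟩ := hP m
    have hU' : e.symm ⁻¹' (U ∩ e.source) ∩ e.target ∈ 𝓝 (e m) := by
      refine Filter.inter_mem ?_ (e.open_target.mem_nhds (e.map_source hme))
      apply (e.symm.continuousAt (e.map_source hme)).preimage_mem_nhds
      rw [e.left_inv hme]
      exact Filter.inter_mem hU (e.open_source.mem_nhds hme)
    obtain ⟨V, hV, hVU, H⟩ := h.side (e m) hm _ hU'
    refine ⟨e ⁻¹' V ∩ e.source, Filter.inter_mem (hP.continuous.continuousAt.preimage_mem_nhds hV)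
      (e.open_source.mem_nhds hme), ?_, ?_⟩
    · rintro x ⟨hx, hxs⟩
      have := (hVU hx).1.1
      rwa [e.left_inv hxs] at this
    · rintro c p ⟨⟨hpV, hps⟩, hpc⟩ q ⟨⟨hqV, hqs⟩, hqc⟩
      obtain ⟨T, hTU, hT, hpT, hqT⟩ := H c (e p) ⟨hpV, hpc⟩ (e q) ⟨hqV, hqc⟩
      refine ⟨e.symm '' T, ?_, hT.image _ (e.continuousOn_symm.mono fun x hx => (hTU hx).1.2),
        ⟨e p, hpT, e.left_inv hps⟩, ⟨e q, hqT, e.left_inv hqs⟩⟩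
      rintro _ ⟨x, hx, rfl⟩
      refine ⟨(hTU hx).1.1.1, ?_⟩
      have := (hTU hx).2
      simp only [mem_compl_iff, mem_preimage, e.right_inv (hTU hx).1.2] at this ⊢
      exact this
  along := by
    intro m hm U hU
    obtain ⟨e, hme, rfl⟩ := hP m
    have hU' : e.symm ⁻¹' (U ∩ e.source) ∩ e.target ∈ 𝓝 (e m) := by
      refine Filter.inter_mem ?_ (e.open_target.mem_nhds (e.map_source hme))
      apply (e.symm.continuousAt (e.map_source hme)).preimage_mem_nhds
      rw [e.left_inv hme]
      exact Filter.inter_mem hU (e.open_source.mem_nhds hme)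
    obtain ⟨V, hV, hVU, H⟩ := h.along (e m) hm _ hU'
    refine ⟨e ⁻¹' V ∩ e.source, Filter.inter_mem (hP.continuous.continuousAt.preimage_mem_nhds hV)
      (e.open_source.mem_nhds hme), ?_, ?_⟩
    · rintro x ⟨hx, hxs⟩
      have := (hVU hx).1.1
      rwa [e.left_inv hxs] at this
    · rintro q ⟨⟨hqV, hqs⟩, hqc⟩
      obtain ⟨T, hTU, hT, hpT, hqT⟩ := H (e q) ⟨hqV, hqc⟩
      refine ⟨e.symm '' T, ?_, hT.image _ (e.continuousOn_symm.mono fun x hx => (hTU hx).1.2),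
        ⟨e m, hpT, e.left_inv hme⟩, ⟨e q, hqT, e.left_inv hqs⟩⟩
      rintro _ ⟨x, hx, rfl⟩
      refine ⟨(hTU hx).1.1.1, ?_⟩
      have := (hTU hx).2
      simp only [mem_preimage, e.right_inv (hTU hx).1.2] at this ⊢
      exact this

/-- The part of the complement of a wall lying on the side of colour `c` at the point `z`. -/
def sideAt {X : Type*} [TopologicalSpace X] (Z : Set X) (col : Bool → Set X) (c : Bool) (z : X) :
    Set X :=
  {w | w ∈ col c ∧ z ∈ closure (connectedComponentIn Zᶜ w)}

namespace IsWall

variable {X : Type*} [TopologicalSpace X] {Z : Set X} {col : Bool → Set X}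

theorem not_mem (h : IsWall Z col) {c : Bool} {w : X} (hw : w ∈ col c) : w ∉ Z := by
  have : w ∈ Zᶜ := by
    rw [← h.union]
    cases c
    · exact Or.inr hw
    · exact Or.inl hw
  exact this

theorem exists_mem_col (h : IsWall Z col) {w : X} (hw : w ∉ Z) : ∃ c, w ∈ col c := by
  have : w ∈ col true ∪ col false := by rw [h.union]; exact hw
  exact this.elim (fun h => ⟨_, h⟩) fun h => ⟨_, h⟩

theorem disjoint_of_ne (h : IsWall Z col) {c d : Bool} (hcd : c ≠ d) :
    Disjoint (col c) (col d) := by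
  cases c <;> cases d <;> first | exact absurd rfl hcd | exact h.disjoint | exact h.disjoint.symm

theorem color_unique (h : IsWall Z col) {c d : Bool} {w : X} (hc : w ∈ col c) (hd : w ∈ col d) :
    c = d := by
  by_contra hcd
  exact disjoint_left.1 (h.disjoint_of_ne hcd) hc hd

theorem component_subset (h : IsWall Z col) {c : Bool} {w : X} (hw : w ∈ col c) :
    connectedComponentIn Zᶜ w ⊆ col c := by
  have hsub : connectedComponentIn Zᶜ w ⊆ col c ∪ col (!c) := by
    refine (connectedComponentIn_subset _ _).trans ?_
    rw [← h.union]
    cases c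
    · exact (union_comm _ _).subset
    · exact subset_rfl
  refine isPreconnected_connectedComponentIn.subset_left_of_subset_union (h.isOpen c)
    (h.isOpen (!c)) (h.disjoint_of_ne (by cases c <;> simp)) hsub
    ⟨w, mem_connectedComponentIn (h.not_mem hw), hw⟩

theorem exists_nhds_subset_sideAt (h : IsWall Z col) {z : X} (hz : z ∈ Z) :
    ∃ V ∈ 𝓝 z, ∀ c, V ∩ col c ⊆ sideAt Z col c z := by
  obtain ⟨V, hV, -, hVc⟩ := h.side z hz univ Filter.univ_mem
  refine ⟨V, hV, fun c w hw => ⟨hw.2, ?_⟩⟩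
  rw [mem_closure_iff_nhds]
  intro U hU
  obtain ⟨q, hq1, hq2⟩ := mem_closure_iff_nhds.1 (h.subset_closure c hz) _
    (Filter.inter_mem hU hV)
  obtain ⟨T, hTs, hT, hp, hq⟩ := hVc c w hw q ⟨hq1.2, hq2⟩
  exact ⟨q, hq1.1, hT.subset_connectedComponentIn hp (fun x hx => (hTs hx).2) hq⟩

theorem sideAt_nonempty (h : IsWall Z col) (c : Bool) {z : X} (hz : z ∈ Z) :
    (sideAt Z col c z).Nonempty := by
  obtain ⟨V, hV, hVc⟩ := h.exists_nhds_subset_sideAt hz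
  obtain ⟨q, hq⟩ := mem_closure_iff_nhds.1 (h.subset_closure c hz) V hV
  exact ⟨q, hVc c hq⟩

theorem sideAt_eq (h : IsWall Z col) {c : Bool} {z w : X} (hz : z ∈ Z)
    (hw : w ∈ sideAt Z col c z) : sideAt Z col c z = connectedComponentIn Zᶜ w := by
  obtain ⟨V, hV, -, hVc⟩ := h.side z hz univ Filter.univ_mem
  apply Subset.antisymm
  · intro v hv
    obtain ⟨p, hp1, hp2⟩ := mem_closure_iff_nhds.1 hw.2 V hV
    obtain ⟨q, hq1, hq2⟩ := mem_closure_iff_nhds.1 hv.2 V hV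
    obtain ⟨T, hTs, hT, hpT, hqT⟩ := hVc c p ⟨hp1, h.component_subset hw.1 hp2⟩ q
      ⟨hq1, h.component_subset hv.1 hq2⟩
    have := hT.subset_connectedComponentIn hpT (fun x hx => (hTs hx).2) hqT
    rw [connectedComponentIn_eq hp2, connectedComponentIn_eq this, ← connectedComponentIn_eq hq2]
    exact mem_connectedComponentIn (h.not_mem hv.1)
  · intro v hv
    refine ⟨h.component_subset hw.1 hv, ?_⟩
    rw [← connectedComponentIn_eq hv]
    exact hw.2

theorem isPreconnected_sideAt (h : IsWall Z col) (c : Bool) {z : X} (hz : z ∈ Z) :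
    IsPreconnected (sideAt Z col c z) := by
  obtain ⟨w, hw⟩ := h.sideAt_nonempty c hz
  rw [h.sideAt_eq hz hw]
  exact isPreconnected_connectedComponentIn

theorem sideAt_eq_of_mem (h : IsWall Z col) {c : Bool} {z z' w : X} (hz : z ∈ Z) (hz' : z' ∈ Z)
    (hw : w ∈ sideAt Z col c z) (hw' : w ∈ sideAt Z col c z') :
    sideAt Z col c z = sideAt Z col c z' := by
  rw [h.sideAt_eq hz hw, h.sideAt_eq hz' hw']

theorem mem_closure_sideAt (h : IsWall Z col) (c : Bool) {z : X} (hz : z ∈ Z) :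
    z ∈ closure (sideAt Z col c z) := by
  obtain ⟨w, hw⟩ := h.sideAt_nonempty c hz
  rw [h.sideAt_eq hz hw]
  exact hw.2

theorem sideAt_locally_constant (h : IsWall Z col) (c : Bool) {z : X} (hz : z ∈ Z) :
    ∃ V ∈ 𝓝 z, ∀ z' ∈ V ∩ Z, sideAt Z col c z' = sideAt Z col c z := by
  obtain ⟨V, hV, hVc⟩ := h.exists_nhds_subset_sideAt hz
  refine ⟨interior V, interior_mem_nhds.2 hV, fun z' hz' => ?_⟩
  obtain ⟨W, hW, hWc⟩ := h.exists_nhds_subset_sideAt hz'.2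
  obtain ⟨q, hq, hqc⟩ := mem_closure_iff_nhds.1 (h.subset_closure c hz'.2) _
    (Filter.inter_mem hW (mem_interior_iff_mem_nhds.1 hz'.1))
  exact h.sideAt_eq_of_mem hz'.2 hz (hWc c ⟨hq.1, hqc⟩) (hVc c ⟨hq.2, hqc⟩)

theorem sideAt_eq_of_isPreconnected (h : IsWall Z col) (c : Bool) {T : Set X} (hTZ : T ⊆ Z)
    (hT : IsPreconnected T) {z z' : X} (hz : z ∈ T) (hz' : z' ∈ T) :
    sideAt Z col c z = sideAt Z col c z' := by
  refine hT.induction₂' (fun x y => sideAt Z col c x = sideAt Z col c y) ?_ ?_ hz hz'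
  · intro x hx
    obtain ⟨V, hV, hVc⟩ := h.sideAt_locally_constant c (hTZ hx)
    filter_upwards [mem_nhdsWithin_of_mem_nhds hV, self_mem_nhdsWithin] with y hy hyT
    have := hVc y ⟨hy, hTZ hyT⟩
    exact ⟨this.symm, this⟩
  · intro x y z _ _ _ h1 h2
    exact h1.trans h2

theorem sideAt_line (h : IsWall Z col) (c : Bool) {z z' : X}
    (hz' : z' ∈ connectedComponentIn Z z) : sideAt Z col c z' = sideAt Z col c z := by
  have hz : z ∈ Z := by
    by_contra hz
    rw [connectedComponentIn_eq_empty hz] at hz'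
    exact hz'
  exact h.sideAt_eq_of_isPreconnected c (connectedComponentIn_subset Z z)
    isPreconnected_connectedComponentIn hz' (mem_connectedComponentIn hz)

theorem exists_nhds_inter_subset_line (h : IsWall Z col) {z : X} (hz : z ∈ Z) :
    ∃ V ∈ 𝓝 z, V ∩ Z ⊆ connectedComponentIn Z z := by
  obtain ⟨V, hV, -, hVc⟩ := h.along z hz univ Filter.univ_mem
  refine ⟨V, hV, fun q hq => ?_⟩
  obtain ⟨T, hTs, hT, hz, hqT⟩ := hVc q hq
  exact hT.subset_connectedComponentIn hz (fun x hx => (hTs hx).2) hqT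

theorem isClosed_line (h : IsWall Z col) (z : X) : IsClosed (connectedComponentIn Z z) := by
  by_cases hz : z ∈ Z
  · apply isClosed_of_closure_subset
    intro y hy
    have hyZ : y ∈ Z := closure_minimal (connectedComponentIn_subset Z z) h.isClosed hy
    refine (isPreconnected_connectedComponentIn
      (F := Z) (x := z)).closure.subset_connectedComponentIn
      (_root_.subset_closure (mem_connectedComponentIn hz)) ?_ hy
    exact closure_minimal (connectedComponentIn_subset Z z) h.isClosed
  · rw [connectedComponentIn_eq_empty hz]
    exact isClosed_empty

/-- The component of the complement of the line through `z` on the side of colour `c`. -/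
def _root_.halfAt (Z : Set X) (col : Bool → Set X) (c : Bool) (z : X) : Set X :=
  {y | ∃ w ∈ sideAt Z col c z, y ∈ connectedComponentIn (connectedComponentIn Z z)ᶜ w}

theorem not_mem_line (h : IsWall Z col) {c : Bool} {w z : X} (hw : w ∈ col c) :
    w ∉ connectedComponentIn Z z :=
  fun hh => h.not_mem hw (connectedComponentIn_subset Z z hh)

theorem sideAt_subset_compl (h : IsWall Z col) (c : Bool) (z z' : X) :
    sideAt Z col c z ⊆ (connectedComponentIn Z z')ᶜ :=
  fun _ hw => h.not_mem_line hw.1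

theorem halfAt_eq (h : IsWall Z col) {c : Bool} {z w : X} (hz : z ∈ Z)
    (hw : w ∈ sideAt Z col c z) :
    halfAt Z col c z = connectedComponentIn (connectedComponentIn Z z)ᶜ w := by
  apply Subset.antisymm
  · rintro y ⟨v, hv, hy⟩
    have := (h.isPreconnected_sideAt c hz).subset_connectedComponentIn hw
      (h.sideAt_subset_compl c z z) hv
    rwa [connectedComponentIn_eq this]
  · intro y hy
    exact ⟨w, hw, hy⟩

theorem sideAt_subset_halfAt (h : IsWall Z col) (c : Bool) (z : X) :
    sideAt Z col c z ⊆ halfAt Z col c z :=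
  fun w hw => ⟨w, hw, mem_connectedComponentIn (h.not_mem_line hw.1)⟩

theorem halfAt_eq_component (h : IsWall Z col) {c : Bool} {z y : X} (hz : z ∈ Z)
    (hy : y ∈ halfAt Z col c z) :
    halfAt Z col c z = connectedComponentIn (connectedComponentIn Z z)ᶜ y := by
  obtain ⟨w, hw⟩ := h.sideAt_nonempty c hz
  rw [h.halfAt_eq hz hw] at hy ⊢
  exact connectedComponentIn_eq hy

theorem halfAt_nonempty (h : IsWall Z col) (c : Bool) {z : X} (hz : z ∈ Z) :
    (halfAt Z col c z).Nonempty :=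
  (h.sideAt_nonempty c hz).mono (h.sideAt_subset_halfAt c z)

theorem isPreconnected_halfAt (h : IsWall Z col) (c : Bool) {z : X} (hz : z ∈ Z) :
    IsPreconnected (halfAt Z col c z) := by
  obtain ⟨y, hy⟩ := h.halfAt_nonempty c hz
  rw [h.halfAt_eq_component hz hy]
  exact isPreconnected_connectedComponentIn

theorem halfAt_subset_compl (c : Bool) (z : X) :
    halfAt Z col c z ⊆ (connectedComponentIn Z z)ᶜ := by
  rintro y ⟨w, -, hy⟩
  exact connectedComponentIn_subset _ _ hy

theorem subset_halfAt (h : IsWall Z col) {c : Bool} {z : X} (hz : z ∈ Z) {A : Set X}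
    (hA : IsPreconnected A) (hAL : A ⊆ (connectedComponentIn Z z)ᶜ)
    (hne : (A ∩ halfAt Z col c z).Nonempty) : A ⊆ halfAt Z col c z := by
  obtain ⟨y, hyA, hy⟩ := hne
  rw [h.halfAt_eq_component hz hy]
  exact hA.subset_connectedComponentIn hyA hAL

theorem isOpen_halfAt [LocallyConnectedSpace X] (h : IsWall Z col) (c : Bool) {z : X}
    (hz : z ∈ Z) : IsOpen (halfAt Z col c z) := by
  obtain ⟨y, hy⟩ := h.halfAt_nonempty c hz
  rw [h.halfAt_eq_component hz hy]
  exact (h.isClosed_line z).isOpen_compl.connectedComponentIn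

theorem line_subset_closure_sideAt (h : IsWall Z col) (c : Bool) (z : X) :
    connectedComponentIn Z z ⊆ closure (sideAt Z col c z) := by
  intro y hy
  rw [← h.sideAt_line c hy]
  exact h.mem_closure_sideAt c (connectedComponentIn_subset Z z hy)

theorem closure_halfAt_subset [LocallyConnectedSpace X] (h : IsWall Z col) (c : Bool) {z : X}
    (hz : z ∈ Z) : closure (halfAt Z col c z) ⊆ halfAt Z col c z ∪ connectedComponentIn Z z := by
  obtain ⟨y, hy⟩ := h.halfAt_nonempty c hz
  rw [h.halfAt_eq_component hz hy]
  exact closure_connectedComponentIn_subset (h.isClosed_line z) y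

theorem halfAt_union [LocallyConnectedSpace X] [PreconnectedSpace X] (h : IsWall Z col) {z : X}
    (hz : z ∈ Z) : halfAt Z col true z ∪ halfAt Z col false z = (connectedComponentIn Z z)ᶜ := by
  have hclo : IsClopen (halfAt Z col true z ∪ halfAt Z col false z ∪ connectedComponentIn Z z) := by
    constructor
    · apply isClosed_of_closure_subset
      rw [closure_union, closure_union, (h.isClosed_line z).closure_eq]
      have h1 := h.closure_halfAt_subset true hz
      have h2 := h.closure_halfAt_subset false hz
      rintro y ((hy | hy) | hy)
      · rcases h1 hy with hy | hy
        · exact Or.inl (Or.inl hy)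
        · exact Or.inr hy
      · rcases h2 hy with hy | hy
        · exact Or.inl (Or.inr hy)
        · exact Or.inr hy
      · exact Or.inr hy
    · rw [isOpen_iff_mem_nhds]
      rintro y ((hy | hy) | hy)
      · filter_upwards [(h.isOpen_halfAt true hz).mem_nhds hy] with x hx
        exact Or.inl (Or.inl hx)
      · filter_upwards [(h.isOpen_halfAt false hz).mem_nhds hy] with x hx
        exact Or.inl (Or.inr hx)
      · have hyZ := connectedComponentIn_subset Z z hy
        obtain ⟨V, hV, hVc⟩ := h.exists_nhds_subset_sideAt hyZ
        obtain ⟨W, hW, hWc⟩ := h.exists_nhds_inter_subset_line hyZ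
        filter_upwards [hV, hW] with x hxV hxW
        by_cases hxZ : x ∈ Z
        · right
          rw [connectedComponentIn_eq hy]
          exact hWc ⟨hxW, hxZ⟩
        · left
          obtain ⟨c, hc⟩ := h.exists_mem_col hxZ
          have := hVc c ⟨hxV, hc⟩
          rw [h.sideAt_line c hy] at this
          have := h.sideAt_subset_halfAt c z this
          cases c
          · exact Or.inr this
          · exact Or.inl this
  have huniv := hclo.eq_univ ⟨z, Or.inr (mem_connectedComponentIn hz)⟩
  apply Subset.antisymm
  · exact union_subset (halfAt_subset_compl true z) (halfAt_subset_compl false z)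
  · intro y hy
    have : y ∈ halfAt Z col true z ∪ halfAt Z col false z ∪ connectedComponentIn Z z := by
      rw [huniv]; trivial
    exact this.resolve_right hy

theorem exists_mem_halfAt [LocallyConnectedSpace X] [PreconnectedSpace X] (h : IsWall Z col)
    {z y : X} (hz : z ∈ Z) (hy : y ∉ connectedComponentIn Z z) : ∃ c, y ∈ halfAt Z col c z := by
  have : y ∈ halfAt Z col true z ∪ halfAt Z col false z := by rw [h.halfAt_union hz]; exact hy
  exact this.elim (fun h => ⟨_, h⟩) fun h => ⟨_, h⟩

end IsWall

theorem smul_set_connectedComponentIn {G X : Type*} [Group G] [TopologicalSpace X] [MulAction G X]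
    [ContinuousConstSMul G X] (g : G) (s : Set X) (x : X) :
    g • connectedComponentIn s x = connectedComponentIn (g • s) (g • x) := by
  by_cases hx : x ∈ s
  · exact (Homeomorph.smul g).image_connectedComponentIn hx
  · rw [connectedComponentIn_eq_empty hx, connectedComponentIn_eq_empty
      (fun h => hx (smul_mem_smul_set_iff.1 h)), smul_set_empty]

/-- A wall in `X` which is invariant under a group action, whose components are permuted
transitively, and such that the stabilizer of the component of `x₀` is `Γ`. -/
structure LineSystem {G X : Type*} [Group G] [TopologicalSpace X] [MulAction G X] (Γ : Subgroup G)
    (Z : Set X) (col : Bool → Set X) (x₀ : X) : Prop where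
  wall : IsWall Z col
  smul_mem_col : ∀ (g : G) c z, g • z ∈ col c ↔ z ∈ col c
  mem : x₀ ∈ Z
  trans : ∀ z ∈ Z, ∃ g : G, z ∈ connectedComponentIn Z (g • x₀)
  stab : ∀ g : G, g • x₀ ∈ connectedComponentIn Z x₀ ↔ g ∈ Γ
  disj : Disjoint (halfAt Z col true x₀) (halfAt Z col false x₀)

namespace LineSystem

variable {G X : Type*} [Group G] [TopologicalSpace X] [MulAction G X]
  {Γ : Subgroup G} {Z : Set X} {col : Bool → Set X} {x₀ : X}

theorem smul_mem_iff (h : LineSystem Γ Z col x₀) (g : G) (z : X) : g • z ∈ Z ↔ z ∈ Z := by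
  have key : ∀ z, z ∉ Z ↔ ∃ c, z ∈ col c :=
    fun z => ⟨h.wall.exists_mem_col, fun ⟨c, hc⟩ => h.wall.not_mem hc⟩
  rw [← not_iff_not, key, key]
  exact exists_congr fun c => h.smul_mem_col g c z

theorem disj_of_ne (h : LineSystem Γ Z col x₀) {c d : Bool} (hcd : c ≠ d) :
    Disjoint (halfAt Z col c x₀) (halfAt Z col d x₀) := by
  cases c <;> cases d <;> first | exact absurd rfl hcd | exact h.disj | exact h.disj.symm

variable [ContinuousConstSMul G X]

theorem smul_Z (h : LineSystem Γ Z col x₀) (g : G) : g • Z = Z := by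
  ext z
  rw [mem_smul_set_iff_inv_smul_mem, h.smul_mem_iff]

theorem smul_compl (h : LineSystem Γ Z col x₀) (g : G) : g • Zᶜ = Zᶜ := by
  rw [smul_set_compl, h.smul_Z]

theorem smul_line (h : LineSystem Γ Z col x₀) (g : G) (z : X) :
    g • connectedComponentIn Z z = connectedComponentIn Z (g • z) := by
  rw [smul_set_connectedComponentIn, h.smul_Z]

theorem smul_sideAt (h : LineSystem Γ Z col x₀) (g : G) (c : Bool) (z : X) :
    g • sideAt Z col c z = sideAt Z col c (g • z) := by
  ext w
  rw [mem_smul_set_iff_inv_smul_mem]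
  show _ ∧ _ ↔ _ ∧ _
  rw [h.smul_mem_col]
  refine and_congr_right fun _ => ?_
  rw [← smul_mem_smul_set_iff (a := g), ← closure_smul, smul_set_connectedComponentIn,
    h.smul_compl, smul_inv_smul]

theorem smul_halfAt (h : LineSystem Γ Z col x₀) (g : G) (c : Bool) (z : X) :
    g • halfAt Z col c z = halfAt Z col c (g • z) := by
  ext y
  rw [mem_smul_set_iff_inv_smul_mem]
  show (∃ _, _) ↔ (∃ _, _)
  constructor
  · rintro ⟨w, hw, hy⟩
    refine ⟨g • w, by rw [← h.smul_sideAt]; exact smul_mem_smul_set hw, ?_⟩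
    rw [← smul_mem_smul_set_iff (a := g), smul_inv_smul, smul_set_connectedComponentIn,
      smul_set_compl, h.smul_line] at hy
    exact hy
  · rintro ⟨w, hw, hy⟩
    refine ⟨g⁻¹ • w, ?_, ?_⟩
    · rw [← smul_mem_smul_set_iff (a := g), smul_inv_smul, h.smul_sideAt]
      exact hw
    · rw [← smul_mem_smul_set_iff (a := g), smul_inv_smul, smul_set_connectedComponentIn,
        smul_inv_smul, smul_set_compl, h.smul_line]
      exact hy

/-- The stabilizer of the side of colour `c` at `x₀`. -/
def vertexGroup (h : LineSystem Γ Z col x₀) (c : Bool) : Subgroup G where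
  carrier := {g | sideAt Z col c (g • x₀) = sideAt Z col c x₀}
  one_mem' := by simp
  mul_mem' {g k} hg hk := by
    show sideAt Z col c ((g * k) • x₀) = _
    rw [mul_smul, ← h.smul_sideAt, show sideAt Z col c (k • x₀) = _ from hk, h.smul_sideAt]
    exact hg
  inv_mem' {g} hg := by
    show sideAt Z col c (g⁻¹ • x₀) = _
    rw [← h.smul_sideAt, ← show sideAt Z col c (g • x₀) = _ from hg, h.smul_sideAt, inv_smul_smul]
    exact hg.symm

theorem mem_vertexGroup (h : LineSystem Γ Z col x₀) {c : Bool} {g : G} :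
    g ∈ h.vertexGroup c ↔ sideAt Z col c (g • x₀) = sideAt Z col c x₀ := Iff.rfl

theorem smul_x₀_mem (h : LineSystem Γ Z col x₀) (g : G) : g • x₀ ∈ Z :=
  (h.smul_mem_iff g x₀).2 h.mem

theorem le_vertexGroup (h : LineSystem Γ Z col x₀) (c : Bool) : Γ ≤ h.vertexGroup c :=
  fun g hg => h.wall.sideAt_line c ((h.stab g).2 hg)

theorem smul_line_disjoint (h : LineSystem Γ Z col x₀) {g : G} (hg : g ∉ Γ) :
    connectedComponentIn Z (g • x₀) ⊆ (connectedComponentIn Z x₀)ᶜ := by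
  intro y hy hy'
  apply hg
  rw [← h.stab, connectedComponentIn_eq hy', ← connectedComponentIn_eq hy]
  exact mem_connectedComponentIn (h.smul_x₀_mem g)

theorem eq_of_smul_mem_line (h : LineSystem Γ Z col x₀) {g k : G} :
    k • x₀ ∈ connectedComponentIn Z (g • x₀) ↔ g⁻¹ * k ∈ Γ := by
  rw [← h.stab, ← h.smul_line, mem_smul_set_iff_inv_smul_mem, mul_smul]

theorem smul_x₀_mem_halfAt (h : LineSystem Γ Z col x₀) {c : Bool} {g : G}
    (hg : g ∈ h.vertexGroup c) (hgΓ : g ∉ Γ) :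
    connectedComponentIn Z (g • x₀) ⊆ halfAt Z col c x₀ := by
  have hR : IsPreconnected (sideAt Z col c x₀ ∪ connectedComponentIn Z (g • x₀)) := by
    refine (h.wall.isPreconnected_sideAt c h.mem).subset_closure subset_union_left ?_
    refine union_subset subset_closure ?_
    rw [← h.mem_vertexGroup.1 hg]
    exact h.wall.line_subset_closure_sideAt c _
  refine subset_union_right.trans (h.wall.subset_halfAt h.mem hR
    (union_subset (h.wall.sideAt_subset_compl c _ _) (h.smul_line_disjoint hgΓ)) ?_)
  obtain ⟨w, hw⟩ := h.wall.sideAt_nonempty c h.mem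
  exact ⟨w, Or.inl hw, h.wall.sideAt_subset_halfAt c _ hw⟩

theorem smul_disj_of_ne (h : LineSystem Γ Z col x₀) (g : G) {c d : Bool} (hcd : c ≠ d) :
    Disjoint (halfAt Z col c (g • x₀)) (halfAt Z col d (g • x₀)) := by
  rw [← h.smul_halfAt, ← h.smul_halfAt]
  exact (disjoint_image_iff (MulAction.injective g)).2 (h.disj_of_ne hcd)

theorem line_subset_halfAt (h : LineSystem Γ Z col x₀) {c : Bool} {g : G}
    (hg : g ∈ h.vertexGroup c) (hgΓ : g ∉ Γ) :
    connectedComponentIn Z x₀ ⊆ halfAt Z col c (g • x₀) := by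
  have := h.smul_x₀_mem_halfAt (inv_mem hg) (fun h => hgΓ (inv_mem_iff.1 h))
  rw [← smul_set_subset_smul_set_iff (a := g), h.smul_line, h.smul_halfAt, smul_inv_smul] at this
  exact this

theorem nested (h : LineSystem Γ Z col x₀) [LocallyConnectedSpace X] {c : Bool} {g : G}
    (hg : g ∈ h.vertexGroup c) (hgΓ : g ∉ Γ) :
    halfAt Z col (!c) (g • x₀) ∪ connectedComponentIn Z (g • x₀) ⊆ halfAt Z col c x₀ := by
  have hgx := h.smul_x₀_mem g
  have hpre : IsPreconnected (halfAt Z col (!c) (g • x₀) ∪ connectedComponentIn Z (g • x₀)) := by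
    refine (h.wall.isPreconnected_halfAt (!c) hgx).subset_closure subset_union_left ?_
    exact union_subset subset_closure ((h.wall.line_subset_closure_sideAt (!c) _).trans
      (closure_mono (h.wall.sideAt_subset_halfAt (!c) _)))
  refine h.wall.subset_halfAt h.mem hpre (union_subset ?_ (h.smul_line_disjoint hgΓ)) ?_
  · intro y hy hy'
    exact disjoint_left.1 (h.smul_disj_of_ne g (by cases c <;> simp)) hy
      (h.line_subset_halfAt hg hgΓ hy')
  · exact ⟨g • x₀, Or.inr (mem_connectedComponentIn hgx),
      h.smul_x₀_mem_halfAt hg hgΓ (mem_connectedComponentIn hgx)⟩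

theorem smul_mem_halfAt_iff (h : LineSystem Γ Z col x₀) {c : Bool} {g : G} {y z : X} :
    g • z ∈ halfAt Z col c (g • y) ↔ z ∈ halfAt Z col c y := by
  rw [← h.smul_halfAt, smul_mem_smul_set_iff]

theorem generate (h : LineSystem Γ Z col x₀) [LocallyConnectedSpace X] [PreconnectedSpace X] :
    h.vertexGroup true ⊔ h.vertexGroup false = ⊤ := by
  set K := h.vertexGroup true ⊔ h.vertexGroup false with hK
  have hle : ∀ c, h.vertexGroup c ≤ K := by
    intro c
    cases c
    · exact le_sup_right
    · exact le_sup_left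
  have hΓ : Γ ≤ K := (h.le_vertexGroup true).trans (hle true)
  set O : Set X := (⋃ k ∈ K, ⋃ c, sideAt Z col c (k • x₀)) ∪
    ⋃ k ∈ K, connectedComponentIn Z (k • x₀) with hO
  have hside : ∀ k c, sideAt Z col c (k • x₀) ∩ O ≠ ∅ → k ∈ K := by
    intro k c hne
    obtain ⟨w, hw, hwO⟩ := nonempty_iff_ne_empty.2 hne
    rcases hwO with hwO | hwO
    · simp only [mem_iUnion] at hwO
      obtain ⟨k', hk', c', hw'⟩ := hwO
      obtain rfl := h.wall.color_unique hw.1 hw'.1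
      have := h.wall.sideAt_eq_of_mem (h.smul_x₀_mem k) (h.smul_x₀_mem k') hw hw'
      have hm : k'⁻¹ * k ∈ h.vertexGroup c := by
        rw [mem_vertexGroup, mul_smul, ← h.smul_sideAt, this, h.smul_sideAt, inv_smul_smul]
      have := K.mul_mem hk' (hle c hm)
      rwa [mul_inv_cancel_left] at this
    · simp only [mem_iUnion] at hwO
      obtain ⟨k', hk', hw'⟩ := hwO
      exact absurd (connectedComponentIn_subset _ _ hw') (h.wall.not_mem hw.1)
  have hline : ∀ k, (connectedComponentIn Z (k • x₀) ∩ O).Nonempty → k ∈ K := by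
    rintro k ⟨w, hw, hwO⟩
    rcases hwO with hwO | hwO
    · simp only [mem_iUnion] at hwO
      obtain ⟨k', hk', c', hw'⟩ := hwO
      exact absurd (connectedComponentIn_subset _ _ hw) (h.wall.not_mem hw'.1)
    · simp only [mem_iUnion] at hwO
      obtain ⟨k', hk', hw'⟩ := hwO
      have : k'⁻¹ * k ∈ Γ := by
        rw [← h.eq_of_smul_mem_line, connectedComponentIn_eq hw', ← connectedComponentIn_eq hw]
        exact mem_connectedComponentIn (h.smul_x₀_mem k)
      have := K.mul_mem hk' (hΓ this)
      rwa [mul_inv_cancel_left] at this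
  have hsideO : ∀ k ∈ K, ∀ c, sideAt Z col c (k • x₀) ⊆ O := by
    intro k hk c w hw
    left
    simp only [mem_iUnion]
    exact ⟨k, hk, c, hw⟩
  have hlineO : ∀ k ∈ K, connectedComponentIn Z (k • x₀) ⊆ O := by
    intro k hk w hw
    right
    simp only [mem_iUnion]
    exact ⟨k, hk, hw⟩
  have hloc : ∀ z ∈ Z, ∃ k : G, z ∈ connectedComponentIn Z (k • x₀) ∧ ∃ V ∈ 𝓝 z,
      V ⊆ (⋃ c, sideAt Z col c (k • x₀)) ∪ connectedComponentIn Z (k • x₀) := by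
    intro z hz
    obtain ⟨k, hk⟩ := h.trans z hz
    obtain ⟨V, hV, hVc⟩ := h.wall.exists_nhds_subset_sideAt hz
    obtain ⟨W, hW, hWc⟩ := h.wall.exists_nhds_inter_subset_line hz
    refine ⟨k, hk, V ∩ W, Filter.inter_mem hV hW, fun x hx => ?_⟩
    by_cases hxZ : x ∈ Z
    · right
      rw [connectedComponentIn_eq hk]
      exact hWc ⟨hx.2, hxZ⟩
    · left
      obtain ⟨c, hc⟩ := h.wall.exists_mem_col hxZ
      have := hVc c ⟨hx.1, hc⟩
      rw [h.wall.sideAt_line c hk] at this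
      exact mem_iUnion.2 ⟨c, this⟩
  have hclo : IsClopen O := by
    constructor
    · rw [← isOpen_compl_iff, isOpen_iff_mem_nhds]
      intro y hy
      by_cases hyZ : y ∈ Z
      · obtain ⟨k, hyk, V, hV, hVs⟩ := hloc y hyZ
        have hk : k ∉ K := fun hk => hy (hlineO k hk hyk)
        filter_upwards [hV] with x hx hxO
        rcases hVs hx with hx | hx
        · obtain ⟨c, hx⟩ := mem_iUnion.1 hx
          exact hk (hside k c (nonempty_iff_ne_empty.1 ⟨x, hx, hxO⟩))
        · exact hk (hline k ⟨x, hx, hxO⟩)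
      · have hyo : y ∈ Zᶜ := hyZ
        filter_upwards [h.wall.isClosed.isOpen_compl.connectedComponentIn.mem_nhds
          (mem_connectedComponentIn hyo)] with x hx hxO
        rcases hxO with hxO | hxO
        · simp only [mem_iUnion] at hxO
          obtain ⟨k, hk, c, hw⟩ := hxO
          refine hy (hsideO k hk c ?_)
          rw [h.wall.sideAt_eq (h.smul_x₀_mem k) hw, ← connectedComponentIn_eq hx]
          exact mem_connectedComponentIn hyo
        · simp only [mem_iUnion] at hxO
          obtain ⟨k, hk, hw⟩ := hxO
          exact connectedComponentIn_subset _ _ hx (connectedComponentIn_subset _ _ hw)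
    · rw [isOpen_iff_mem_nhds]
      rintro y (hy | hy)
      · simp only [mem_iUnion] at hy
        obtain ⟨k, hk, c, hw⟩ := hy
        refine Filter.mem_of_superset ?_ (hsideO k hk c)
        rw [h.wall.sideAt_eq (h.smul_x₀_mem k) hw]
        exact h.wall.isClosed.isOpen_compl.connectedComponentIn.mem_nhds
          (mem_connectedComponentIn (h.wall.not_mem hw.1))
      · have hyO : y ∈ O := Or.inr hy
        simp only [mem_iUnion] at hy
        obtain ⟨k, hk, hw⟩ := hy
        obtain ⟨k', hyk', V, hV, hVs⟩ := hloc y (connectedComponentIn_subset _ _ hw)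
        have hk' : k' ∈ K := hline k' ⟨y, hyk', hyO⟩
        refine Filter.mem_of_superset hV (hVs.trans (union_subset ?_ (hlineO k' hk')))
        exact iUnion_subset fun c => hsideO k' hk' c
  have huniv := hclo.eq_univ ⟨x₀, Or.inr (by
    simp only [mem_iUnion]
    exact ⟨1, K.one_mem, by rw [one_smul]; exact mem_connectedComponentIn h.mem⟩)⟩
  rw [eq_top_iff]
  intro k _
  exact hline k ⟨k • x₀, mem_connectedComponentIn (h.smul_x₀_mem k), by rw [huniv]; trivial⟩

end LineSystem

/-- Ping-pong data for an amalgam of the two subgroups `H true` and `H false` over `Γ`. -/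
structure PingPong {G : Type*} [Group G] (Γ : Subgroup G) (H : Bool → Subgroup G)
    (s : Bool → G → Prop) : Prop where
  le : ∀ c, Γ ≤ H c
  ping : ∀ c u h, u ∈ H c → u ∉ Γ → h ∈ Γ ∨ s (!c) h → s c (u * h)
  disj : ∀ c h, s c h → ¬ s (!c) h
  not_mem : ∀ c h, s c h → h ∉ Γ
  tri : ∀ h, h ∈ Γ ∨ ∃ c, s c h
  gen : H true ⊔ H false = ⊤

/-- `AltWord Γ H c n h` says that `h` is an alternating product of `n` elements of
`H c`, `H (!c)`, `H c`, … outside `Γ`, followed by an element of `Γ`. -/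
inductive AltWord {G : Type*} [Group G] (Γ : Subgroup G) (H : Bool → Subgroup G) :
    Bool → ℕ → G → Prop
  | base (c : Bool) (h : G) : h ∈ Γ → AltWord Γ H c 0 h
  | step (c : Bool) (n : ℕ) (u h : G) : u ∈ H c → u ∉ Γ → AltWord Γ H (!c) n h →
      AltWord Γ H c (n + 1) (u * h)

section

variable {G : Type*} [Group G] {Γ : Subgroup G} {H : Bool → Subgroup G} {s : Bool → G → Prop}

theorem altWord_zero {c : Bool} {h : G} : AltWord Γ H c 0 h ↔ h ∈ Γ :=
  ⟨fun hh => by cases hh; assumption, AltWord.base c h⟩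

theorem altWord_succ {c : Bool} {n : ℕ} {h : G} : AltWord Γ H c (n + 1) h ↔
    ∃ u ∈ H c, u ∉ Γ ∧ ∃ h', AltWord Γ H (!c) n h' ∧ h = u * h' := by
  constructor
  · intro hh
    cases hh with
    | step c n u h hu hu' hw => exact ⟨u, hu, hu', h, hw, rfl⟩
  · rintro ⟨u, hu, hu', h', hw, rfl⟩
    exact AltWord.step c n u h' hu hu' hw

/-- Two elements are words of the same type. -/
def SameWord (Γ : Subgroup G) (H : Bool → Subgroup G) (h h' : G) : Prop :=
  ∃ c n, AltWord Γ H c n h ∧ AltWord Γ H c n h'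

theorem mul_not_mem {γ u : G} (hγ : γ ∈ Γ) (hu : u ∉ Γ) : γ * u ∉ Γ :=
  fun h => hu ((Γ.mul_mem_cancel_left hγ).1 h)

theorem not_mem_mul {γ u : G} (hγ : γ ∈ Γ) (hu : u ∉ Γ) : u * γ ∉ Γ :=
  fun h => hu ((Γ.mul_mem_cancel_right hγ).1 h)

theorem inv_not_mem {u : G} (hu : u ∉ Γ) : u⁻¹ ∉ Γ := fun h => hu (inv_mem_iff.1 h)

theorem AltWord.mul_right_mem {c : Bool} {n : ℕ} {h γ : G} (hw : AltWord Γ H c n h)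
    (hγ : γ ∈ Γ) : AltWord Γ H c n (h * γ) := by
  induction hw with
  | base c h hh => exact .base c _ (mul_mem hh hγ)
  | step c n u h hu hu' _ ih => rw [mul_assoc]; exact .step c n u _ hu hu' ih

theorem iterate_not_not (n : ℕ) (c : Bool) : not^[n] (!c) = !(not^[n] c) := by
  rw [← Function.iterate_succ_apply, Function.iterate_succ_apply']

namespace PingPong

variable (P : PingPong Γ H s)
include P

theorem mul_left_mem {c : Bool} {n : ℕ} {h γ : G} (hγ : γ ∈ Γ)
    (hw : AltWord Γ H c n h) : AltWord Γ H c n (γ * h) := by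
  cases hw with
  | base _ _ hh => exact .base c _ (mul_mem hγ hh)
  | step _ n u h hu hu' hw =>
    rw [← mul_assoc]
    exact .step c n _ h (mul_mem (P.le c hγ) hu) (mul_not_mem hγ hu') hw

theorem sign_of_altWord {c : Bool} {n : ℕ} {h : G} (hw : AltWord Γ H c (n + 1) h) : s c h := by
  induction n generalizing c h with
  | zero =>
    obtain ⟨u, hu, hu', h', hh', rfl⟩ := altWord_succ.1 hw
    exact P.ping c u h' hu hu' (Or.inl (altWord_zero.1 hh'))
  | succ n ih =>
    obtain ⟨u, hu, hu', h', hh', rfl⟩ := altWord_succ.1 hw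
    exact P.ping c u h' hu hu' (Or.inr (ih hh'))

theorem color_unique {c d : Bool} {h : G} (hc : s c h) (hd : s d h) : c = d := by
  by_contra hcd
  obtain rfl : d = !c := by cases c <;> cases d <;> simp_all
  exact P.disj c h hc hd

theorem altWord_unique {c d : Bool} {n m : ℕ} {h : G} (h1 : AltWord Γ H c n h)
    (h2 : AltWord Γ H d m h) : n = m ∧ (n ≠ 0 → c = d) := by
  induction n generalizing c d m h with
  | zero =>
    cases m with
    | zero => simp
    | succ m => exact absurd (altWord_zero.1 h1) (P.not_mem _ _ (P.sign_of_altWord h2))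
  | succ n ih =>
    cases m with
    | zero => exact absurd (altWord_zero.1 h2) (P.not_mem _ _ (P.sign_of_altWord h1))
    | succ m =>
      obtain rfl := P.color_unique (P.sign_of_altWord h1) (P.sign_of_altWord h2)
      refine ⟨?_, fun _ => rfl⟩
      obtain ⟨u, hu, hu', h', hw, rfl⟩ := altWord_succ.1 h1
      obtain ⟨v, hv, hv', k, hk, he⟩ := altWord_succ.1 h2
      have hke : k = v⁻¹ * u * h' := by rw [mul_assoc, he, inv_mul_cancel_left]
      by_cases hvu : v⁻¹ * u ∈ Γ
      · have := P.mul_left_mem hvu hw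
        rw [← hke] at this
        rw [(ih this hk).1]
      · have hk' : AltWord Γ H c (n + 1) k := by
          rw [hke]
          exact .step c n _ _ (mul_mem (inv_mem hv) hu) hvu hw
        have hs := P.sign_of_altWord hk'
        cases m with
        | zero => exact absurd (altWord_zero.1 hk) (P.not_mem _ _ hs)
        | succ m => exact absurd (P.sign_of_altWord hk) (P.disj _ _ hs)

theorem exists_altWord_mul {d : Bool} {u h : G} (hu : u ∈ H d) (hh : ∃ c n, AltWord Γ H c n h) :
    ∃ c n, AltWord Γ H c n (u * h) := by
  by_cases huΓ : u ∈ Γ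
  · obtain ⟨c, n, hw⟩ := hh
    exact ⟨c, n, P.mul_left_mem huΓ hw⟩
  obtain ⟨c, n, hw⟩ := hh
  cases n with
  | zero => exact ⟨d, 1, .step d 0 u h hu huΓ (.base _ _ (altWord_zero.1 hw))⟩
  | succ n =>
    by_cases hcd : c = d
    · subst hcd
      obtain ⟨v, hv, hv', h', hw', rfl⟩ := altWord_succ.1 hw
      rw [← mul_assoc]
      by_cases huv : u * v ∈ Γ
      · exact ⟨!c, n, P.mul_left_mem huv hw'⟩
      · exact ⟨c, n + 1, .step c n _ _ (mul_mem hu hv) huv hw'⟩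
    · obtain rfl : c = !d := by cases c <;> cases d <;> simp_all
      exact ⟨d, n + 2, .step d (n + 1) u h hu huΓ hw⟩

theorem exists_altWord (h : G) : ∃ c n, AltWord Γ H c n h := by
  have hmem : h ∈ Subgroup.closure ((H true : Set G) ∪ H false) := by
    rw [Subgroup.closure_union, Subgroup.closure_eq, Subgroup.closure_eq, P.gen]
    trivial
  suffices ∀ k, (∃ c n, AltWord Γ H c n k) → ∃ c n, AltWord Γ H c n (h * k) by
    simpa using this 1 ⟨true, 0, .base _ _ Γ.one_mem⟩
  refine Subgroup.closure_induction'' (p := fun h _ => ∀ k, (∃ c n, AltWord Γ H c n k) →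
    ∃ c n, AltWord Γ H c n (h * k)) ?_ ?_ ?_ ?_ hmem
  · rintro x (hx | hx) k hk
    · exact P.exists_altWord_mul hx hk
    · exact P.exists_altWord_mul hx hk
  · rintro x (hx | hx) k hk
    · exact P.exists_altWord_mul (inv_mem hx) hk
    · exact P.exists_altWord_mul (inv_mem hx) hk
  · intro k hk
    rwa [one_mul]
  · intro x y _ _ hx hy k hk
    rw [mul_assoc]
    exact hx _ (hy _ hk)

theorem altWord_of_sign {c : Bool} {h : G} (hs : s c h) : ∃ n, AltWord Γ H c (n + 1) h := by
  obtain ⟨d, n, hw⟩ := P.exists_altWord h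
  cases n with
  | zero => exact absurd (altWord_zero.1 hw) (P.not_mem _ _ hs)
  | succ n =>
    obtain rfl := P.color_unique hs (P.sign_of_altWord hw)
    exact ⟨n, hw⟩

theorem altWord_mul_right {c : Bool} {n : ℕ} {h u : G} (hw : AltWord Γ H c n h)
    (hu : u ∈ H (not^[n] c)) (huΓ : u ∉ Γ) : AltWord Γ H c (n + 1) (h * u) := by
  induction hw with
  | base c h hh =>
    have := AltWord.step c 0 (h * u) 1 (mul_mem (P.le c hh) hu) (mul_not_mem hh huΓ)
      (.base _ _ Γ.one_mem)
    rwa [mul_one] at this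
  | step c n v h hv hv' _ ih =>
    rw [mul_assoc]
    exact .step c (n + 1) v _ hv hv' (ih hu)

theorem altWord_inv {c : Bool} {n : ℕ} {h : G} (hw : AltWord Γ H c n h) :
    AltWord Γ H (!(not^[n] c)) n h⁻¹ := by
  induction hw with
  | base c h hh => exact .base _ _ (inv_mem hh)
  | step c n v h hv hv' _ ih =>
    rw [mul_inv_rev, Function.iterate_succ_apply]
    refine P.altWord_mul_right ih ?_ (inv_not_mem hv')
    have : not^[n] (!not^[n] !c) = c := by
      rw [iterate_not_not n c, Bool.not_not, ← Function.iterate_add_apply, ← two_mul,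
        Function.iterate_mul]
      have : not^[2] = id := by funext b; cases b <;> rfl
      rw [this, Function.iterate_id, id]
    rw [this]
    exact inv_mem hv

theorem sameWord_inv {h h' : G} (hh : SameWord Γ H h h') : SameWord Γ H h⁻¹ h'⁻¹ := by
  obtain ⟨c, n, h1, h2⟩ := hh
  exact ⟨_, n, P.altWord_inv h1, P.altWord_inv h2⟩

theorem sameWord_inv_iff {h h' : G} : SameWord Γ H h⁻¹ h'⁻¹ ↔ SameWord Γ H h h' :=
  ⟨fun hh => by simpa using P.sameWord_inv hh, P.sameWord_inv⟩

theorem not_sign_mul {c d : Bool} {k g : G} (hk : s d k) (hg : g ∈ H c) : ¬ s (!d) (k * g) := by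
  obtain ⟨n, hw⟩ := P.altWord_of_sign hk
  clear hk
  induction n generalizing d k with
  | zero =>
    obtain ⟨u, hu, hu', h', hh', rfl⟩ := altWord_succ.1 hw
    have hh := altWord_zero.1 hh'
    by_cases hcd : c = d
    · subst hcd
      intro hs
      have hm : u * h' * g ∈ H c := mul_mem (mul_mem hu (P.le c hh)) hg
      by_cases hΓ : u * h' * g ∈ Γ
      · exact P.not_mem _ _ hs hΓ
      · have := P.ping c _ 1 hm hΓ (Or.inl Γ.one_mem)
        rw [mul_one] at this
        exact P.disj _ _ this hs
    · obtain rfl : c = !d := by cases c <;> cases d <;> simp_all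
      intro hs
      refine P.disj _ _ (P.ping d u (h' * g) hu hu' ?_) (by rwa [← mul_assoc])
      by_cases hΓ : h' * g ∈ Γ
      · exact Or.inl hΓ
      · right
        have := P.ping (!d) _ 1 (mul_mem (P.le _ hh) hg) hΓ (Or.inl Γ.one_mem)
        rwa [mul_one] at this
  | succ n ih =>
    obtain ⟨u, hu, hu', h', hh', rfl⟩ := altWord_succ.1 hw
    have := ih hh'
    rw [Bool.not_not] at this
    intro hs
    refine P.disj _ _ (P.ping d u (h' * g) hu hu' ?_) (by rwa [← mul_assoc])
    rcases P.tri (h' * g) with h | ⟨e, he⟩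
    · exact Or.inl h
    · right
      by_cases hed : e = d
      · subst hed; exact absurd he this
      · obtain rfl : e = !d := by cases e <;> cases d <;> simp_all
        exact he

theorem mem_iff {c : Bool} {g : G} : g ∈ H c ∧ g ∉ Γ ↔
    s c g ∧ ¬ ∃ k d, s d k⁻¹ ∧ s (!d) (k⁻¹ * g) := by
  constructor
  · rintro ⟨hg, hΓ⟩
    refine ⟨?_, ?_⟩
    · have := P.ping c g 1 hg hΓ (Or.inl Γ.one_mem)
      rwa [mul_one] at this
    · rintro ⟨k, d, h1, h2⟩
      exact P.not_sign_mul h1 hg h2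
  · rintro ⟨hs, hk⟩
    refine ⟨?_, P.not_mem _ _ hs⟩
    obtain ⟨n, hw⟩ := P.altWord_of_sign hs
    obtain ⟨u, hu, hu', h', hh', rfl⟩ := altWord_succ.1 hw
    cases n with
    | zero => exact mul_mem hu (P.le c (altWord_zero.1 hh'))
    | succ n =>
      refine absurd ⟨u, c, ?_, ?_⟩ hk
      · have := P.ping c u⁻¹ 1 (inv_mem hu) (inv_not_mem hu') (Or.inl Γ.one_mem)
        rwa [mul_one] at this
      · rw [inv_mul_cancel_left]
        exact P.sign_of_altWord hh'

theorem groups_eq {H' : Bool → Subgroup G} (P' : PingPong Γ H' s) : H = H' := by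
  funext c
  ext g
  have := P.mem_iff (c := c) (g := g)
  rw [← P'.mem_iff] at this
  by_cases hg : g ∈ Γ
  · exact ⟨fun _ => P'.le c hg, fun _ => P.le c hg⟩
  · simpa [hg] using this

theorem mem_of_sign {c : Bool} {g : G} (hg : g ∈ H c) (hΓ : g ∉ Γ) : s c g :=
  (P.mem_iff.1 ⟨hg, hΓ⟩).1

theorem mem_of_mem_of_mem {c d : Bool} {g : G} (hc : g ∈ H c) (hd : g ∈ H d) (hcd : c ≠ d) :
    g ∈ Γ := by
  by_contra hΓ
  exact hcd (P.color_unique (P.mem_of_sign hc hΓ) (P.mem_of_sign hd hΓ))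

/-- If both groups are two-sided over `Γ`, then words of the same type agree up to `Γ`. -/
theorem sameWord_iff_of_index_two
    (h2 : ∀ c, ∀ u ∈ H c, u ∉ Γ → ∀ v ∈ H c, v ∉ Γ → u⁻¹ * v ∈ Γ) {h h' : G} :
    SameWord Γ H h h' ↔ h⁻¹ * h' ∈ Γ := by
  constructor
  · rintro ⟨c, n, hw, hw'⟩
    induction n generalizing c h h' with
    | zero => exact mul_mem (inv_mem (altWord_zero.1 hw)) (altWord_zero.1 hw')
    | succ n ih =>
      obtain ⟨u, hu, hu', k, hk, rfl⟩ := altWord_succ.1 hw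
      obtain ⟨v, hv, hv', k', hk', rfl⟩ := altWord_succ.1 hw'
      have := ih (!c) hk (P.mul_left_mem (h2 c u hu hu' v hv hv') hk')
      have e : (u * k)⁻¹ * (v * k') = k⁻¹ * (u⁻¹ * v * k') := by group
      rwa [e]
  · intro hm
    obtain ⟨c, n, hw⟩ := P.exists_altWord h
    refine ⟨c, n, hw, ?_⟩
    have := hw.mul_right_mem hm
    rwa [mul_inv_cancel_left] at this

theorem sameWord_mul_left {d : Bool} {m : G} (hm : m ∈ H d) (hmΓ : m ∉ Γ)
    (h2 : ∀ v ∈ H d, v ∉ Γ → m * v ∈ Γ) {h h' : G} (hh : SameWord Γ H h h') :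
    SameWord Γ H (m * h) (m * h') := by
  obtain ⟨c, n, hw, hw'⟩ := hh
  cases n with
  | zero =>
    refine ⟨d, 1, .step d 0 m h hm hmΓ (.base _ _ (altWord_zero.1 hw)),
      .step d 0 m h' hm hmΓ (.base _ _ (altWord_zero.1 hw'))⟩
  | succ n =>
    by_cases hcd : c = d
    · subst hcd
      obtain ⟨u, hu, hu', k, hk, rfl⟩ := altWord_succ.1 hw
      obtain ⟨v, hv, hv', k', hk', rfl⟩ := altWord_succ.1 hw'
      refine ⟨!c, n, ?_, ?_⟩
      · rw [← mul_assoc]; exact P.mul_left_mem (h2 u hu hu') hk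
      · rw [← mul_assoc]; exact P.mul_left_mem (h2 v hv hv') hk'
    · obtain rfl : c = !d := by cases c <;> cases d <;> simp_all
      exact ⟨d, n + 2, .step d (n + 1) m h hm hmΓ hw, .step d (n + 1) m h' hm hmΓ hw'⟩

end PingPong
end

namespace LineSystem

variable {G X : Type*} [Group G] [TopologicalSpace X] [MulAction G X] [ContinuousConstSMul G X]
  {Γ : Subgroup G} {Z : Set X} {col : Bool → Set X} {x₀ : X}

theorem pingPong (h : LineSystem Γ Z col x₀) [LocallyConnectedSpace X] [PreconnectedSpace X] :
    PingPong Γ h.vertexGroup fun c g => g • x₀ ∈ halfAt Z col c x₀ where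
  le := h.le_vertexGroup
  ping c u g hu huΓ hg := by
    apply h.nested hu huΓ
    show (u * g) • x₀ ∈ _
    rw [mul_smul, ← h.smul_halfAt, ← h.smul_line, ← smul_set_union]
    exact smul_mem_smul_set (hg.symm.imp id (h.stab g).2)
  disj c g hg := disjoint_left.1 (h.disj_of_ne (by cases c <;> simp)) hg
  not_mem c g hg hΓ := IsWall.halfAt_subset_compl c _ hg ((h.stab g).2 hΓ)
  tri g := or_iff_not_imp_left.2 fun hg =>
    h.wall.exists_mem_halfAt h.mem (fun hh => hg ((h.stab g).1 hh))
  gen := h.generate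

end LineSystem

section

variable {G : Type*} [Group G]

/-- The elements `g` such that `g * a ^ k = a ^ l * g` for some nonzero `k` and `l`. -/
def powCommensurator (a : G) : Subgroup G where
  carrier := {g | ∃ k l : ℤ, k ≠ 0 ∧ l ≠ 0 ∧ g * a ^ k = a ^ l * g}
  one_mem' := ⟨1, 1, one_ne_zero, one_ne_zero, by simp⟩
  mul_mem' := by
    rintro g h ⟨k, l, hk, hl, e⟩ ⟨k', l', hk', hl', e'⟩
    have conj : ∀ {x : G} {p q : ℤ}, x * a ^ p = a ^ q * x → ∀ r : ℤ,
        x * a ^ (p * r) = a ^ (q * r) * x := by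
      intro x p q hx r
      have : SemiconjBy x (a ^ p) (a ^ q) := hx
      rw [zpow_mul, zpow_mul]
      exact (this.zpow_right r).eq
    refine ⟨k' * k, l * l', mul_ne_zero hk' hk, mul_ne_zero hl hl', ?_⟩
    have e1 := conj e' k
    have e2 := conj e l'
    rw [mul_assoc, e1, ← mul_assoc, mul_comm l' k, e2, mul_assoc]
  inv_mem' := by
    rintro g ⟨k, l, hk, hl, e⟩
    exact ⟨l, k, hl, hk, by
      rw [eq_mul_inv_iff_mul_eq, mul_assoc, ← e, inv_mul_cancel_left]⟩

theorem zpowers_le_powCommensurator (a : G) : Subgroup.zpowers a ≤ powCommensurator a := by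
  rintro _ ⟨n, rfl⟩
  refine ⟨1, 1, one_ne_zero, one_ne_zero, ?_⟩
  simp only
  rw [← zpow_add, ← zpow_add, add_comm]

/-- A properly discontinuous action on the plane in which `a` is the unit vertical translation. -/
structure StripAction [MulAction G ℂ] (a : G) : Prop where
  smul_eq : ∀ z : ℂ, a • z = z + Complex.I
  finite : ∀ K₀ K₁ : Set ℂ, IsCompact K₀ → IsCompact K₁ → {g : G | (g • K₀ ∩ K₁).Nonempty}.Finite

namespace StripAction

variable [MulAction G ℂ] {a : G}

theorem zpow_smul (h : StripAction a) (n : ℤ) (z : ℂ) : a ^ n • z = z + n * Complex.I := by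
  induction n with
  | zero => simp
  | succ n ih =>
    rw [zpow_add_one, mul_smul, h.smul_eq]
    have : ∀ m : ℕ, ∀ w : ℂ, a ^ (m : ℤ) • w = w + m * Complex.I := by
      intro m
      induction m with
      | zero => simp
      | succ m ih =>
        intro w
        push_cast
        rw [zpow_add_one, mul_smul, h.smul_eq, ih]
        ring
    rw [this]
    push_cast
    ring
  | pred n ih =>
    rw [sub_eq_add_neg, add_comm, zpow_add, mul_smul, ih, zpow_neg_one, inv_smul_eq_iff, h.smul_eq]
    push_cast
    ring

theorem eq_zero_of_zpow (h : StripAction a) {n : ℤ} (hn : a ^ n = 1) : n = 0 := by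
  have := h.zpow_smul n 0
  rw [hn, one_smul] at this
  simpa using this.symm

theorem re_zpow_smul (h : StripAction a) (n : ℤ) (z : ℂ) : (a ^ n • z).re = z.re := by
  rw [h.zpow_smul]; simp

theorem im_zpow_smul (h : StripAction a) (n : ℤ) (z : ℂ) : (a ^ n • z).im = z.im + n := by
  rw [h.zpow_smul]; simp

theorem mem_of_forall_bounded (h : StripAction a) {g : G} {K₀ : Set ℂ} (hK : IsCompact K₀) (R : ℝ)
    (hb : ∀ i : ℤ, ∃ z ∈ K₀, |((g * a ^ i) • z).re| ≤ R) : g ∈ powCommensurator a := by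
  choose z hz hzR using hb
  set j : ℤ → ℤ := fun i => -⌊((g * a ^ i) • z i).im⌋ with hj
  have hbox : IsCompact (Icc (-R) R ×ℂ Icc 0 1) := isCompact_Icc.reProdIm isCompact_Icc
  have hf : ∀ i, a ^ j i * (g * a ^ i) ∈ {g : G | (g • K₀ ∩ (Icc (-R) R ×ℂ Icc 0 1)).Nonempty} := by
    intro i
    refine ⟨(a ^ j i * (g * a ^ i)) • z i, smul_mem_smul_set (hz i), ?_⟩
    rw [mul_smul, Complex.mem_reProdIm, h.re_zpow_smul, h.im_zpow_smul]
    refine ⟨abs_le.1 (hzR i), ?_⟩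
    have e : ((g * a ^ i) • z i).im + (j i : ℝ) = Int.fract ((g * a ^ i) • z i).im := by
      simp only [hj, Int.fract]
      push_cast
      ring
    rw [e]
    exact ⟨Int.fract_nonneg _, (Int.fract_lt_one _).le⟩
  have hfin := h.finite K₀ _ hK hbox
  have : ¬ Function.Injective fun i => a ^ j i * (g * a ^ i) := fun hinj =>
    infinite_range_of_injective hinj (hfin.subset (range_subset_iff.2 hf))
  simp only [Function.Injective, not_forall] at this
  obtain ⟨i, i', e, hne⟩ := this
  have e' : g * a ^ (i - i') = a ^ (j i' - j i) * g := by
    rw [sub_eq_add_neg, zpow_add, sub_eq_neg_add, zpow_add, zpow_neg, zpow_neg, ← mul_assoc,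
      mul_inv_eq_iff_eq_mul, mul_assoc, mul_assoc, eq_inv_mul_iff_mul_eq]
    exact e
  refine ⟨i - i', j i' - j i, sub_ne_zero.2 hne, ?_, e'⟩
  intro h0
  rw [h0, zpow_zero, one_mul, mul_eq_left] at e'
  exact hne (sub_eq_zero.1 (h.eq_zero_of_zpow e'))

theorem exists_bound [ContinuousConstSMul G ℂ] (h : StripAction a) {g : G}
    (hg : g ∈ powCommensurator a) (R : ℝ) : ∃ R', ∀ z : ℂ, |z.re| ≤ R → |(g • z).re| ≤ R' := by
  obtain ⟨k, l, hk, -, e⟩ := hg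
  have hbox : IsCompact (Icc (-R) R ×ℂ Icc (-|(k : ℝ)|) |(k : ℝ)|) :=
    isCompact_Icc.reProdIm isCompact_Icc
  obtain ⟨R', hR'⟩ := (hbox.image (continuous_const_smul g)).isBounded.exists_norm_le
  refine ⟨R', fun z hz => ?_⟩
  set q := ⌊z.im / k⌋ with hq
  have hkR : (k : ℝ) ≠ 0 := Int.cast_ne_zero.2 hk
  have e1 : g • z = a ^ (l * q) • g • a ^ (-(k * q)) • z := by
    have : SemiconjBy g (a ^ k) (a ^ l) := e
    have := (this.zpow_right q).eq
    rw [← zpow_mul, ← zpow_mul] at this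
    rw [← mul_smul, ← mul_smul, ← this, mul_assoc, ← zpow_add]
    simp
  rw [e1, h.re_zpow_smul]
  refine (Complex.abs_re_le_norm _).trans (hR' _ (mem_image_of_mem _ ?_))
  rw [Complex.mem_reProdIm, h.re_zpow_smul, h.im_zpow_smul]
  refine ⟨abs_le.1 hz, abs_le.1 ?_⟩
  have e2 : z.im + ((-(k * q) : ℤ) : ℝ) = k * Int.fract (z.im / k) := by
    rw [Int.fract, ← hq]
    push_cast
    field_simp
    ring
  rw [e2, abs_mul, Int.abs_fract]
  exact mul_le_of_le_one_right (abs_nonneg _) (Int.fract_lt_one _).le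

end StripAction
end

/-- The right end (for `c = true`) or left end (for `c = false`) of the plane beyond `R`. -/
def endSet (c : Bool) (R : ℝ) : Set ℂ := {z | R < cond c z.re (-z.re)}

theorem isPreconnected_endSet (c : Bool) (R : ℝ) : IsPreconnected (endSet c R) := by
  cases c
  · have : endSet false R = {z | z.re < -R} := by
      ext z
      show R < -z.re ↔ z.re < -R
      constructor <;> intro h <;> linarith
    rw [this]
    exact (convex_halfSpace_re_lt (-R)).isPreconnected
  · exact (convex_halfSpace_re_gt R).isPreconnected

theorem isOpen_endSet (c : Bool) (R : ℝ) : IsOpen (endSet c R) := by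
  cases c
  · exact isOpen_lt continuous_const Complex.continuous_re.neg
  · exact isOpen_lt continuous_const Complex.continuous_re

theorem lt_abs_of_mem_endSet {c : Bool} {R : ℝ} {z : ℂ} (h : z ∈ endSet c R) : R < |z.re| := by
  cases c
  · exact lt_of_lt_of_le h (neg_le_abs _)
  · exact lt_of_lt_of_le h (le_abs_self _)

theorem exists_mem_endSet_of_lt {R : ℝ} {z : ℂ} (h : R < |z.re|) : ∃ c, z ∈ endSet c R := by
  rcases lt_abs.1 h with h | h
  · exact ⟨true, h⟩
  · exact ⟨false, h⟩

theorem endSet_anti (c : Bool) {R R' : ℝ} (h : R ≤ R') : endSet c R' ⊆ endSet c R :=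
  fun _ hz => lt_of_le_of_lt h hz

theorem endSet_nonempty (c : Bool) (R : ℝ) : (endSet c R).Nonempty := by
  cases c
  · exact ⟨((-(R + 1) : ℝ) : ℂ), by show R < -(((-(R + 1) : ℝ) : ℂ)).re; simp⟩
  · exact ⟨((R + 1 : ℝ) : ℂ), by show R < (((R + 1 : ℝ) : ℂ)).re; simp⟩

theorem endSet_disjoint (c : Bool) {R : ℝ} (hR : 0 ≤ R) :
    Disjoint (endSet c R) (endSet (!c) R) := by
  rw [disjoint_left]
  intro z h1 h2
  cases c <;> (simp only [endSet, mem_ofPred_eq, cond_true, cond_false, Bool.not_true,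
    Bool.not_false] at h1 h2; linarith)

theorem subset_endSet {A : Set ℂ} (hA : IsPreconnected A) {R : ℝ} (hR : 0 ≤ R)
    (h : ∀ z ∈ A, R < |z.re|) {c : Bool} {z : ℂ} (hz : z ∈ A) (hzc : z ∈ endSet c R) :
    A ⊆ endSet c R := by
  refine hA.subset_left_of_subset_union (isOpen_endSet c R) (isOpen_endSet (!c) R)
    (endSet_disjoint c hR) (fun w hw => ?_) ⟨z, hz, hzc⟩
  obtain ⟨d, hd⟩ := exists_mem_endSet_of_lt (h w hw)
  by_cases hcd : d = c
  · exact Or.inl (hcd ▸ hd)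
  · obtain rfl : d = !c := by cases c <;> cases d <;> simp_all
    exact Or.inr hd

/-- A line system in the plane whose base line separates the two ends of the plane. -/
structure StripSystem {G : Type*} [Group G] [MulAction G ℂ] (a : G)
    (Z : Set ℂ) (col : Bool → Set ℂ) (x₀ : ℂ) : Prop
    extends LineSystem (Subgroup.zpowers a) Z col x₀ where
  ends : ∃ Y, 0 ≤ Y ∧ ∀ c, endSet c Y ⊆ halfAt Z col c x₀

namespace StripSystem

variable {G : Type*} [Group G] [MulAction G ℂ] [ContinuousConstSMul G ℂ] {a : G}
  {Z : Set ℂ} {col : Bool → Set ℂ} {x₀ : ℂ}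

/-- The stabilizer of the side of colour `c` at `x₀`. -/
abbrev vert (S : StripSystem a Z col x₀) (c : Bool) : Subgroup G :=
  S.toLineSystem.vertexGroup c

theorem endSet_subset_halfAt (S : StripSystem a Z col x₀) (A : StripAction a) {c : Bool} {u : G}
    (hu : u ∈ S.vert c) (huΓ : u ∉ Subgroup.zpowers a) (huN : u ∈ powCommensurator a) :
    ∃ R, endSet c R ⊆ halfAt Z col (!c) (u • x₀) := by
  obtain ⟨Y, hY, hends⟩ := S.ends
  obtain ⟨R', hR'⟩ := A.exists_bound huN Y
  set R₀ := max R' Y with hR₀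
  have hout : ∀ z : ℂ, R₀ < |z.re| → Y < |(u⁻¹ • z).re| := by
    intro z hz
    by_contra hc
    have := hR' _ (not_lt.1 hc)
    rw [smul_inv_smul] at this
    exact absurd (lt_of_le_of_lt (le_max_left _ _) hz) (not_lt.2 this)
  refine ⟨R₀, fun z hz => ?_⟩
  obtain ⟨d, hd⟩ := exists_mem_endSet_of_lt (hout z (lt_abs_of_mem_endSet hz))
  by_cases hdc : d = c
  · exfalso
    subst hdc
    have h1 : u⁻¹ • endSet d R₀ ⊆ endSet d Y := by
      refine subset_endSet ((isPreconnected_endSet d R₀).image _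
        (continuous_const_smul u⁻¹).continuousOn) hY ?_ (smul_mem_smul_set hz) hd
      rintro _ ⟨w, hw, rfl⟩
      exact hout w (lt_abs_of_mem_endSet hw)
    have hall : ∀ w : ℂ, R₀ < |w.re| → u⁻¹ • w ∈ endSet d Y := by
      intro w hw
      obtain ⟨e, he⟩ := exists_mem_endSet_of_lt hw
      by_cases hed : e = d
      · subst hed
        exact h1 (smul_mem_smul_set he)
      · obtain rfl : e = !d := by cases e <;> cases d <;> simp_all
        have hwK := hends _ (endSet_anti _ (le_max_right R' Y) he)
        have hK : u⁻¹ • w ∈ halfAt Z col d x₀ := by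
          apply S.nested (inv_mem hu) (inv_not_mem huΓ)
          left
          rwa [S.smul_mem_halfAt_iff]
        obtain ⟨f, hf⟩ := exists_mem_endSet_of_lt (hout w hw)
        by_cases hfd : f = d
        · exact hfd ▸ hf
        · exact absurd (hends f hf) (disjoint_left.1 (S.disj_of_ne (Ne.symm hfd)) hK)
    obtain ⟨R'', hR''⟩ := A.exists_bound (inv_mem huN) R₀
    obtain ⟨y, hy⟩ := endSet_nonempty (!d) (max R'' Y)
    have hy1 : R₀ < |(u • y).re| := by
      by_contra hc
      have := hR'' _ (not_lt.1 hc)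
      rw [inv_smul_smul] at this
      exact absurd (lt_of_le_of_lt (le_max_left _ _) (lt_abs_of_mem_endSet hy)) (not_lt.2 this)
    have hy2 := hall _ hy1
    rw [inv_smul_smul] at hy2
    exact disjoint_left.1 (endSet_disjoint d hY) hy2 (endSet_anti _ (le_max_right _ _) hy)
  · obtain rfl : d = !c := by cases c <;> cases d <;> simp_all
    have := hends _ hd
    rwa [← S.smul_mem_halfAt_iff (g := u), smul_inv_smul] at this

theorem inv_mul_mem (S : StripSystem a Z col x₀) (A : StripAction a) {c : Bool} {u v : G}
    (hu : u ∈ S.vert c) (huΓ : u ∉ Subgroup.zpowers a) (huN : u ∈ powCommensurator a)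
    (hv : v ∈ S.vert c) (hvΓ : v ∉ Subgroup.zpowers a) : u⁻¹ * v ∈ Subgroup.zpowers a := by
  by_contra hw
  obtain ⟨Y, hY, hends⟩ := S.ends
  obtain ⟨R, hR⟩ := S.endSet_subset_halfAt A hu huΓ huN
  have hne : c ≠ !c := by cases c <;> simp
  have hb : ∀ z ∈ halfAt Z col (!c) (v • x₀), |z.re| ≤ max R Y := by
    intro z hz
    by_contra hcon
    obtain ⟨d, hd⟩ := exists_mem_endSet_of_lt (not_le.1 hcon)
    by_cases hdc : d = c
    · subst hdc
      have h1 := hR (endSet_anti _ (le_max_left R Y) hd)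
      have h2 : u⁻¹ • z ∈ halfAt Z col d x₀ := by
        apply S.nested (mul_mem (inv_mem hu) hv) hw
        left
        rw [mul_smul, S.smul_mem_halfAt_iff]
        exact hz
      have h3 : u⁻¹ • z ∈ halfAt Z col (!d) x₀ := by
        rwa [← S.smul_mem_halfAt_iff (g := u), smul_inv_smul]
      exact disjoint_left.1 (S.disj_of_ne hne) h2 h3
    · obtain rfl : d = !c := by cases c <;> cases d <;> simp_all
      exact disjoint_left.1 (S.disj_of_ne hne) (S.nested hv hvΓ (Or.inl hz))
        (hends _ (endSet_anti _ (le_max_right R Y) hd))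
  obtain ⟨p, hp⟩ := endSet_nonempty (!c) Y
  have hvN : v ∈ powCommensurator a := by
    refine A.mem_of_forall_bounded (isCompact_singleton (x := p)) (max R Y)
      fun i => ⟨p, rfl, hb _ ?_⟩
    rw [mul_smul, S.smul_mem_halfAt_iff]
    apply hends
    show Y < _
    rw [A.re_zpow_smul]
    exact hp
  obtain ⟨M, hM⟩ := A.exists_bound (inv_mem hvN) (max R Y)
  obtain ⟨q, hq⟩ := endSet_nonempty (!c) (max M Y)
  have h1 := hM (v • q) (hb _ (S.smul_mem_halfAt_iff.2
    (hends _ (endSet_anti _ (le_max_right M Y) hq))))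
  rw [inv_smul_smul] at h1
  exact absurd (lt_of_le_of_lt (le_max_left M Y) (lt_abs_of_mem_endSet hq)) (not_lt.2 h1)

theorem sign_iff (S : StripSystem a Z col x₀) (A : StripAction a) {Z' : Set ℂ}
    {col' : Bool → Set ℂ} {y₀ : ℂ} (S' : StripSystem a Z' col' y₀) {g : G}
    (hg : g ∉ powCommensurator a) (c : Bool) :
    g • x₀ ∈ halfAt Z col c x₀ ↔ g • y₀ ∈ halfAt Z' col' c y₀ := by
  obtain ⟨Y, hY, hends⟩ := S.ends
  obtain ⟨Y', hY', hends'⟩ := S'.ends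
  obtain ⟨i, hi⟩ : ∃ i : ℤ, ∀ z ∈ segment ℝ x₀ y₀, max Y Y' < |((g * a ^ i) • z).re| := by
    by_contra hcon
    push Not at hcon
    refine hg (A.mem_of_forall_bounded ?_ (max Y Y') hcon)
    rw [segment_eq_image_lineMap]
    exact isCompact_Icc.image AffineMap.lineMap_continuous
  obtain ⟨d, hd⟩ := exists_mem_endSet_of_lt (hi x₀ (left_mem_segment ℝ x₀ y₀))
  have hsub : (g * a ^ i) • segment ℝ x₀ y₀ ⊆ endSet d (max Y Y') := by
    refine subset_endSet ((convex_segment x₀ y₀).isPreconnected.image _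
      (continuous_const_smul _).continuousOn) (le_max_of_le_left hY) ?_
      (smul_mem_smul_set (left_mem_segment ℝ x₀ y₀)) hd
    rintro _ ⟨w, hw, rfl⟩
    exact hi w hw
  have h1 := hends d (endSet_anti _ (le_max_left Y Y') hd)
  have h2 := hends' d (endSet_anti _ (le_max_right Y Y')
    (hsub (smul_mem_smul_set (right_mem_segment ℝ x₀ y₀))))
  have hP := S.toLineSystem.pingPong
  have hP' := S'.toLineSystem.pingPong
  have key : ∀ {H : Bool → Subgroup G} {s : Bool → G → Prop},
      PingPong (Subgroup.zpowers a) H s → s d (g * a ^ i) → (s c g ↔ c = d) := by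
    intro H s P hs
    obtain ⟨n, hn⟩ := P.altWord_of_sign hs
    have := hn.mul_right_mem (inv_mem (zpow_mem (Subgroup.mem_zpowers a) i))
    rw [mul_inv_cancel_right] at this
    exact ⟨fun h => P.color_unique h (P.sign_of_altWord this),
      fun h => h ▸ P.sign_of_altWord this⟩
  rw [key hP h1, key hP' h2]

theorem mem_powCommensurator_of_mul (S : StripSystem a Z col x₀) (A : StripAction a) {c : Bool}
    {m : ℕ} {u n : G} (hu : u ∈ S.vert c)
    (hn : AltWord (Subgroup.zpowers a) S.vert (!c) m n)
    (hun : u * n ∈ powCommensurator a) : u ∈ powCommensurator a := by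
  obtain ⟨k, l, hk, hl, e⟩ := hun
  have hP := S.toLineSystem.pingPong
  have e' : u⁻¹ * a ^ l * u * n = n * a ^ k := by
    rw [mul_assoc, mul_assoc, ← e, mul_assoc, inv_mul_cancel_left]
  have hx : u⁻¹ * a ^ l * u ∈ S.vert c :=
    mul_mem (mul_mem (inv_mem hu) (S.le_vertexGroup c (zpow_mem (Subgroup.mem_zpowers a) l))) hu
  by_cases hxΓ : u⁻¹ * a ^ l * u ∈ Subgroup.zpowers a
  · obtain ⟨j, hj⟩ := hxΓ
    have e2 : u * a ^ j = a ^ l * u := by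
      simp only at hj
      rw [hj, mul_assoc, mul_inv_cancel_left]
    refine ⟨j, l, ?_, hl, e2⟩
    rintro rfl
    rw [zpow_zero, mul_one, right_eq_mul] at e2
    exact hl (A.eq_zero_of_zpow e2)
  · have h1 := AltWord.step c m _ n hx hxΓ hn
    rw [e'] at h1
    have := (hP.altWord_unique h1 (hn.mul_right_mem (zpow_mem (Subgroup.mem_zpowers a) k))).1
    omega

/-- The group `vert c` contains an element of the commensurator outside `zpowers a`. -/
def IsThin (S : StripSystem a Z col x₀) (c : Bool) : Prop :=
  ∃ u ∈ S.vert c, u ∉ Subgroup.zpowers a ∧ u ∈ powCommensurator a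

theorem IsThin.inv_mul_mem {S : StripSystem a Z col x₀} {c : Bool} (h : S.IsThin c)
    (A : StripAction a) {u v : G} (hu : u ∈ S.vert c)
    (huΓ : u ∉ Subgroup.zpowers a) (hv : v ∈ S.vert c)
    (hvΓ : v ∉ Subgroup.zpowers a) : u⁻¹ * v ∈ Subgroup.zpowers a := by
  obtain ⟨w, hw, hwΓ, hwN⟩ := h
  have h1 := StripSystem.inv_mul_mem S A hw hwΓ hwN hu huΓ
  have h2 := StripSystem.inv_mul_mem S A hw hwΓ hwN hv hvΓ
  have := mul_mem (inv_mem h1) h2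
  rwa [show (w⁻¹ * u)⁻¹ * (w⁻¹ * v) = u⁻¹ * v by group] at this

theorem le_vert_of_not_isThin (S : StripSystem a Z col x₀) (A : StripAction a) {c : Bool}
    (hc : ¬ S.IsThin (!c)) : powCommensurator a ≤ S.vert c := by
  have hP := S.toLineSystem.pingPong
  intro n hn
  obtain ⟨d, m, hw⟩ := hP.exists_altWord n
  cases m with
  | zero => exact S.le_vertexGroup c (altWord_zero.1 hw)
  | succ m =>
    obtain ⟨u, hu, huΓ, n', hn', rfl⟩ := altWord_succ.1 hw
    have huN := S.mem_powCommensurator_of_mul A hu hn' hn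
    obtain rfl : d = c := by
      by_contra hdc
      obtain rfl : d = !c := by cases c <;> cases d <;> simp_all
      exact hc ⟨u, hu, huΓ, huN⟩
    cases m with
    | zero => exact mul_mem hu (S.le_vertexGroup d (altWord_zero.1 hn'))
    | succ m =>
      exfalso
      have hn'N : n' ∈ powCommensurator a := ((powCommensurator a).mul_mem_cancel_left huN).1 hn
      obtain ⟨v, hv, hvΓ, n'', hn'', rfl⟩ := altWord_succ.1 hn'
      exact hc ⟨v, hv, hvΓ, S.mem_powCommensurator_of_mul A hv hn'' hn'N⟩

theorem sameWord_iff_of_matching (S : StripSystem a Z col x₀) (A : StripAction a) {Z' : Set ℂ}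
    {col' : Bool → Set ℂ} {y₀ : ℂ} (S' : StripSystem a Z' col' y₀)
    (hN : ∀ g ∈ powCommensurator a, g ∉ Subgroup.zpowers a → ∀ c,
      (g • x₀ ∈ halfAt Z col c x₀ ↔ g • y₀ ∈ halfAt Z' col' c y₀)) (h h' : G) :
    SameWord (Subgroup.zpowers a) S.vert h h' ↔
      SameWord (Subgroup.zpowers a) S'.vert h h' := by
  have hP := S.toLineSystem.pingPong
  have hP' := S'.toLineSystem.pingPong
  have hs : (fun c g => g • x₀ ∈ halfAt Z col c x₀) =
      fun c (g : G) => g • y₀ ∈ halfAt Z' col' c y₀ := by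
    funext c g
    by_cases hg : g ∈ powCommensurator a
    · by_cases hΓ : g ∈ Subgroup.zpowers a
      · exact propext (iff_of_false (fun h => hP.not_mem _ _ h hΓ) fun h => hP'.not_mem _ _ h hΓ)
      · exact propext (hN g hg hΓ c)
    · exact propext (S.sign_iff A S' hg c)
  rw [← hs] at hP'
  have : S.vert = S'.vert := hP.groups_eq hP'
  rw [this]

theorem forall_isThin (S : StripSystem a Z col x₀) (A : StripAction a) {Z' : Set ℂ}
    {col' : Bool → Set ℂ} {y₀ : ℂ} (S' : StripSystem a Z' col' y₀) (h : ∀ c, S.IsThin c)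
    (c : Bool) :
    S'.IsThin c := by
  by_contra hc
  obtain ⟨u, hu, huΓ, huN⟩ := h c
  obtain ⟨v, hv, hvΓ, hvN⟩ := h (!c)
  have hle := S'.le_vert_of_not_isThin A (c := !c) (by rwa [Bool.not_not])
  have hthin : S'.IsThin (!c) := ⟨u, hle huN, huΓ, huN⟩
  have h1 := hthin.inv_mul_mem A (hle huN) huΓ (hle hvN) hvΓ
  have hv' : v ∈ S.vert c := by
    have := mul_mem hu (S.le_vertexGroup c h1)
    rwa [mul_inv_cancel_left] at this
  exact hvΓ (S.toLineSystem.pingPong.mem_of_mem_of_mem hv' hv (by cases c <;> simp))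

end StripSystem

theorem AltWord.conj {G : Type*} [Group G] {Γ : Subgroup G} {H H' : Bool → Subgroup G} {m : G}
    (hΓ : ∀ g, m⁻¹ * g * m ∈ Γ ↔ g ∈ Γ) (hH : ∀ c g, m⁻¹ * g * m ∈ H (!c) ↔ g ∈ H' c)
    {c : Bool} {n : ℕ} {h : G} (hw : AltWord Γ H' c n h) : AltWord Γ H (!c) n (m⁻¹ * h * m) := by
  induction hw with
  | base c h hh => exact .base _ _ ((hΓ h).2 hh)
  | step c n u h hu huΓ _ ih =>
    have := AltWord.step (!c) n (m⁻¹ * u * m) _ ((hH c u).2 hu) (fun hh => huΓ ((hΓ u).1 hh)) ih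
    rwa [show m⁻¹ * u * m * (m⁻¹ * h * m) = m⁻¹ * (u * h) * m by group] at this

theorem IsWall.swap {M : Type*} [TopologicalSpace M] {Z : Set M} {col : Bool → Set M}
    (h : IsWall Z col) : IsWall Z fun c => col (!c) where
  isClosed := h.isClosed
  isOpen c := h.isOpen _
  disjoint := h.disjoint.symm
  union := (union_comm _ _).trans h.union
  subset_closure c := h.subset_closure _
  side m hm U hU := by
    obtain ⟨V, hV, hVU, hc⟩ := h.side m hm U hU
    exact ⟨V, hV, hVU, fun c => hc _⟩
  along := h.along

namespace StripSystem

variable {G : Type*} [Group G] [MulAction G ℂ] [ContinuousConstSMul G ℂ] {a : G}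
  {Z : Set ℂ} {col : Bool → Set ℂ} {x₀ : ℂ}

theorem swap_smul (S : StripSystem a Z col x₀) (A : StripAction a) {d : Bool} {m : G}
    (hm : m ∈ S.vert d) (hmΓ : m ∉ Subgroup.zpowers a) (hmN : m ∈ powCommensurator a)
    (hconj : ∀ g, m⁻¹ * g * m ∈ Subgroup.zpowers a ↔ g ∈ Subgroup.zpowers a) :
    StripSystem a Z (fun c => col (!c)) (m • x₀) where
  wall := S.wall.swap
  smul_mem_col g c z := S.smul_mem_col g _ z
  mem := S.smul_x₀_mem m
  trans z hz := by
    obtain ⟨g, hg⟩ := S.trans z hz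
    exact ⟨g * m⁻¹, by rwa [mul_smul, inv_smul_smul]⟩
  stab g := by
    rw [← mul_smul, S.eq_of_smul_mem_line, ← mul_assoc, hconj]
  disj := S.smul_disj_of_ne m (by simp)
  ends := by
    obtain ⟨Y, hY, hends⟩ := S.ends
    obtain ⟨R, hR⟩ := S.endSet_subset_halfAt A hm hmΓ hmN
    refine ⟨max R Y, le_max_of_le_right hY, fun c => ?_⟩
    show _ ⊆ halfAt Z col (!c) (m • x₀)
    by_cases hc : c = d
    · subst hc
      exact (endSet_anti _ (le_max_left _ _)).trans hR
    · obtain rfl : c = !d := by cases c <;> cases d <;> simp_all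
      rw [Bool.not_not]
      refine (endSet_anti _ (le_max_right _ _)).trans ((hends _).trans ?_)
      have := S.nested (inv_mem hm) (inv_not_mem hmΓ)
      intro z hz
      rw [← smul_inv_smul m z, S.smul_mem_halfAt_iff]
      apply this
      left
      rwa [S.smul_mem_halfAt_iff]

theorem sameWord_iff (S : StripSystem a Z col x₀) (A : StripAction a) {Z' : Set ℂ}
    {col' : Bool → Set ℂ} {y₀ : ℂ} (S' : StripSystem a Z' col' y₀) (h h' : G) :
    SameWord (Subgroup.zpowers a) S.vert h h' ↔ SameWord (Subgroup.zpowers a) S'.vert h h' := by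
  have hP := S.toLineSystem.pingPong
  have hP' := S'.toLineSystem.pingPong
  by_cases hN : ∀ g ∈ powCommensurator a, g ∈ Subgroup.zpowers a
  · exact S.sameWord_iff_of_matching A S' (fun g hg hgΓ => absurd (hN g hg) hgΓ) h h'
  push Not at hN
  obtain ⟨m, hmN, hmΓ⟩ := hN
  by_cases hall : ∀ c, S.IsThin c
  · have hall' := S.forall_isThin A S' hall
    rw [hP.sameWord_iff_of_index_two fun c u hu huΓ v hv hvΓ =>
        (hall c).inv_mul_mem A hu huΓ hv hvΓ,
      hP'.sameWord_iff_of_index_two fun c u hu huΓ v hv hvΓ =>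
        (hall' c).inv_mul_mem A hu huΓ hv hvΓ]
  have hall' : ¬ ∀ c, S'.IsThin c := fun hh => hall (S'.forall_isThin A S hh)
  have choose_color : ∀ {p : Bool → Prop}, (¬ ∀ c, p c) → ∃ c, ¬ p (!c) := by
    intro p hp
    push Not at hp
    obtain ⟨c, hc⟩ := hp
    exact ⟨!c, by rwa [Bool.not_not]⟩
  obtain ⟨c, hc⟩ := choose_color hall
  obtain ⟨d, hd⟩ := choose_color hall'
  have hle := S.le_vert_of_not_isThin A hc
  have hle' := S'.le_vert_of_not_isThin A hd
  have match_of_le : ∀ {Z' : Set ℂ} {col' : Bool → Set ℂ} {y₀ : ℂ}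
      (S' : StripSystem a Z' col' y₀), powCommensurator a ≤ S'.vert c → ∀ h h',
      SameWord (Subgroup.zpowers a) S.vert h h' ↔
        SameWord (Subgroup.zpowers a) S'.vert h h' := by
    intro Z' col' y₀ S' hle' h h'
    refine S.sameWord_iff_of_matching A S' (fun g hg hgΓ e => ?_) h h'
    have h1 := hP.mem_of_sign (hle hg) hgΓ
    have h2 := S'.toLineSystem.pingPong.mem_of_sign (hle' hg) hgΓ
    exact ⟨fun he => hP.color_unique h1 he ▸ h2,
      fun he => S'.toLineSystem.pingPong.color_unique h2 he ▸ h1⟩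
  by_cases hcd : d = c
  · subst hcd
    exact match_of_le S' hle' h h'
  obtain rfl : c = !d := by cases c <;> cases d <;> simp_all
  have hthin : S'.IsThin d := ⟨m, hle' hmN, hmΓ, hmN⟩
  have htwo : ∀ u ∈ powCommensurator a, u ∉ Subgroup.zpowers a → ∀ v ∈ powCommensurator a,
      v ∉ Subgroup.zpowers a → u⁻¹ * v ∈ Subgroup.zpowers a := fun u hu huΓ v hv hvΓ =>
    hthin.inv_mul_mem A (hle' hu) huΓ (hle' hv) hvΓ
  have conj_mem : ∀ u ∈ powCommensurator a, u ∉ Subgroup.zpowers a → ∀ g ∈ Subgroup.zpowers a,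
      u⁻¹ * g * u ∈ Subgroup.zpowers a := by
    intro u hu huΓ g hg
    rw [mul_assoc]
    exact htwo u hu huΓ _ (mul_mem (zpowers_le_powCommensurator a hg) hu) (mul_not_mem hg huΓ)
  have hconj : ∀ g, m⁻¹ * g * m ∈ Subgroup.zpowers a ↔ g ∈ Subgroup.zpowers a := by
    intro g
    refine ⟨fun hg => ?_, conj_mem m hmN hmΓ g⟩
    have := conj_mem m⁻¹ (inv_mem hmN) (inv_not_mem hmΓ) _ hg
    rwa [show m⁻¹⁻¹ * (m⁻¹ * g * m) * m⁻¹ = g by group] at this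
  set S'' := S'.swap_smul A (hle' hmN) hmΓ hmN hconj
  have hvert : ∀ e g, m⁻¹ * g * m ∈ S'.vert (!e) ↔ g ∈ S''.vert e := by
    intro e g
    rw [LineSystem.mem_vertexGroup, LineSystem.mem_vertexGroup, mul_assoc, mul_smul,
      ← S'.smul_sideAt, inv_smul_eq_iff, S'.smul_sideAt, mul_smul]
    rfl
  have hvert' : ∀ e g, (m⁻¹)⁻¹ * g * m⁻¹ ∈ S''.vert (!e) ↔ g ∈ S'.vert e := by
    intro e g
    rw [← hvert, Bool.not_not, show m⁻¹ * (m⁻¹⁻¹ * g * m⁻¹) * m = g by group]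
  have hconj' : ∀ g, (m⁻¹)⁻¹ * g * m⁻¹ ∈ Subgroup.zpowers a ↔ g ∈ Subgroup.zpowers a := by
    intro g
    rw [← hconj, show m⁻¹ * (m⁻¹⁻¹ * g * m⁻¹) * m = g by group]
  have hleft : ∀ {u : G}, u ∈ powCommensurator a → u ∉ Subgroup.zpowers a → ∀ {k k' : G},
      SameWord (Subgroup.zpowers a) S'.vert k k' →
        SameWord (Subgroup.zpowers a) S'.vert (u * k) (u * k') := by
    intro u hu huΓ k k' hk
    refine hP'.sameWord_mul_left (hle' hu) huΓ (fun v hv hvΓ => ?_) hk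
    have := hthin.inv_mul_mem A (inv_mem (hle' hu)) (inv_not_mem huΓ) hv hvΓ
    rwa [inv_inv] at this
  have hright : ∀ {u : G}, u ∈ powCommensurator a → u ∉ Subgroup.zpowers a → ∀ {k k' : G},
      SameWord (Subgroup.zpowers a) S'.vert k k' →
        SameWord (Subgroup.zpowers a) S'.vert (k * u) (k' * u) := by
    intro u hu huΓ k k' hk
    rw [← hP'.sameWord_inv_iff, mul_inv_rev, mul_inv_rev]
    exact hleft (inv_mem hu) (inv_not_mem huΓ) (hP'.sameWord_inv hk)
  have hinv := inv_mem hmN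
  have hinvΓ := inv_not_mem hmΓ
  rw [match_of_le S'' (fun n hn => (hvert _ n).1 ?_) h h']
  · constructor
    · rintro ⟨e, n, h1, h2⟩
      have := hleft hmN hmΓ (hright hinv hinvΓ ⟨!e, n, AltWord.conj hconj hvert h1,
        AltWord.conj hconj hvert h2⟩)
      simpa [mul_assoc] using this
    · intro hh
      obtain ⟨e, n, h1, h2⟩ := hleft hinv hinvΓ (hright hmN hmΓ hh)
      have e1 := AltWord.conj hconj' hvert' h1
      have e2 := AltWord.conj hconj' hvert' h2
      refine ⟨!e, n, ?_, ?_⟩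
      · simpa [mul_assoc] using e1
      · simpa [mul_assoc] using e2
  · rw [Bool.not_not]
    exact hle' (mul_mem (mul_mem hinv hn) hmN)

end StripSystem

/-- The covering map `ℂ → ℂ ∖ {0}` whose deck group is generated by the translation by `n * I`. -/
def expCover (n : ℕ) (z : ℂ) : ℂ := Complex.exp (2 * Real.pi * z / n)

theorem continuous_expCover (n : ℕ) : Continuous (expCover n) := by
  unfold expCover
  fun_prop

theorem norm_expCover (n : ℕ) (z : ℂ) : ‖expCover n z‖ = Real.exp (2 * Real.pi * z.re / n) := by
  have h : 2 * Real.pi * z / n = ((2 * Real.pi / n : ℝ) : ℂ) * z := by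
    push_cast
    ring
  rw [expCover, Complex.norm_exp, h, Complex.re_ofReal_mul]
  ring_nf

theorem expCover_eq_iff {n : ℕ} (hn : 0 < n) {z w : ℂ} :
    expCover n z = expCover n w ↔ ∃ k : ℤ, z = w + k * (n * Complex.I) := by
  have hn' : (n : ℂ) ≠ 0 := by exact_mod_cast hn.ne'
  have hpi : (Real.pi : ℂ) ≠ 0 := by exact_mod_cast Real.pi_ne_zero
  rw [expCover, expCover, Complex.exp_eq_exp_iff_exists_int]
  refine exists_congr fun k => ?_
  constructor
  · intro h
    field_simp at h
    linear_combination h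
  · rintro rfl
    field_simp

theorem add_int_mul_mem {L : Set ℂ} {d : ℂ} (hinv : ∀ z, z + d ∈ L ↔ z ∈ L) (k : ℤ) (z : ℂ) :
    z + k * d ∈ L ↔ z ∈ L := by
  induction k using Int.induction_on with
  | zero => simp
  | succ i ih =>
    rw [← ih, ← hinv (z + (i : ℤ) * d)]
    push_cast
    ring_nf
  | pred i ih =>
    rw [← ih, ← hinv (z + ((-(i : ℤ) - 1 : ℤ) : ℂ) * d)]
    push_cast
    ring_nf

theorem expCover_mem_image {n : ℕ} (hn : 0 < n) {L : Set ℂ}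
    (hinv : ∀ z, z + n * Complex.I ∈ L ↔ z ∈ L) {z : ℂ} :
    expCover n z ∈ expCover n '' L ↔ z ∈ L := by
  refine ⟨?_, mem_image_of_mem _⟩
  rintro ⟨w, hw, hwz⟩
  obtain ⟨k, hk⟩ := (expCover_eq_iff hn).1 hwz
  rw [hk, add_int_mul_mem hinv] at hw
  exact hw

theorem isCompact_expCover_image {n : ℕ} (hn : 0 < n) {L : Set ℂ} (hL : IsClosed L)
    (hinv : ∀ z, z + n * Complex.I ∈ L ↔ z ∈ L) {Y : ℝ} (hY : ∀ z ∈ L, |z.re| ≤ Y) :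
    IsCompact (expCover n '' L) := by
  have hn' : (0 : ℝ) < n := by exact_mod_cast hn
  have h : expCover n '' L =
      expCover n '' (L ∩ Icc (-Y) Y ×ℂ Icc 0 (n : ℝ)) := by
    apply Subset.antisymm _ (image_mono inter_subset_left)
    rintro _ ⟨z, hz, rfl⟩
    have hw : z + (-⌊z.im / n⌋ : ℤ) * (n * Complex.I) ∈ L := (add_int_mul_mem hinv _ _).2 hz
    refine ⟨_, ⟨hw, Complex.mem_reProdIm.2 ⟨?_, ?_⟩⟩, (expCover_eq_iff hn).2 ⟨_, rfl⟩⟩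
    · exact abs_le.1 (hY _ hw)
    · have him : (z + (-⌊z.im / n⌋ : ℤ) * (n * Complex.I)).im = z.im - ⌊z.im / n⌋ * n := by
        simp [sub_eq_add_neg]
      have h1 := mul_le_mul_of_nonneg_right (Int.floor_le (z.im / n)) hn'.le
      have h2 := mul_le_mul_of_nonneg_right (Int.lt_floor_add_one (z.im / n)).le hn'.le
      rw [div_mul_cancel₀ _ hn'.ne'] at h1 h2
      rw [him]
      constructor <;> linarith
  rw [h]
  exact ((isCompact_Icc.reProdIm isCompact_Icc).inter_left hL).image (continuous_expCover n)

theorem zero_mem_closure_expCover {n : ℕ} (hn : 0 < n) (Y : ℝ) :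
    0 ∈ closure (expCover n '' endSet false Y) := by
  have hn' : (0 : ℝ) < n := by exact_mod_cast hn
  have ht : Filter.Tendsto (fun x : ℝ => expCover n x) Filter.atBot (𝓝 0) := by
    rw [tendsto_zero_iff_norm_tendsto_zero]
    simp only [norm_expCover, Complex.ofReal_re]
    have : (fun x : ℝ => 2 * Real.pi * x / n) = fun x : ℝ => (2 * Real.pi / n) * x := by
      ext x
      ring
    refine Real.tendsto_exp_atBot.comp ?_
    rw [this]
    exact Filter.tendsto_id.const_mul_atBot (by positivity)
  refine mem_closure_of_tendsto ht ?_
  filter_upwards [Filter.eventually_lt_atBot (-Y)] with x hx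
  refine mem_image_of_mem _ ?_
  show Y < -(x : ℂ).re
  rw [Complex.ofReal_re]
  linarith

/-- A periodic continuum separates the two ends of the plane. -/
theorem ends_separated {L T : Set ℂ} {n : ℕ} (hn : 0 < n) (hL : IsClosed L)
    (hLc : IsPreconnected L) (hne : L.Nonempty) (hinv : ∀ z, z + n * Complex.I ∈ L ↔ z ∈ L)
    {Y : ℝ} (hY : ∀ z ∈ L, |z.re| ≤ Y) (hT : IsPreconnected T) (hTL : Disjoint T L)
    (ht : (T ∩ endSet true Y).Nonempty) (hf : (T ∩ endSet false Y).Nonempty) : False := by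
  have hn' : (0 : ℝ) < n := by exact_mod_cast hn
  have hpi := Real.pi_pos
  set K := expCover n '' L with hK
  have hend : ∀ c, Disjoint (endSet c Y) L := fun c => disjoint_left.2 fun z hz hzL =>
    (lt_abs_of_mem_endSet hz).not_ge (hY z hzL)
  set U := endSet false Y ∪ T ∪ endSet true Y with hU
  have hUp : IsPreconnected U := by
    refine IsPreconnected.union' ?_ ?_ (isPreconnected_endSet _ _)
    · exact ht.mono (inter_subset_inter_left _ subset_union_right)
    · exact IsPreconnected.union' (by rwa [inter_comm]) (isPreconnected_endSet _ _) hT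
  have hUL : Disjoint U L := ((hend false).union_left hTL).union_left (hend true)
  have hT' : IsPreconnected (insert 0 (expCover n '' U)) := by
    refine (hUp.image _ (continuous_expCover n).continuousOn).subset_closure (subset_insert _ _) ?_
    refine insert_subset ?_ subset_closure
    refine closure_mono (image_mono ?_) (zero_mem_closure_expCover hn Y)
    exact subset_union_left.trans subset_union_left
  have hK0 : ∀ z ∈ K, z ≠ 0 := by
    rintro _ ⟨w, -, rfl⟩
    exact Complex.exp_ne_zero _
  have hTK : Disjoint (insert 0 (expCover n '' U)) K := by
    rw [disjoint_insert_left]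
    refine ⟨fun h => hK0 0 h rfl, disjoint_left.2 ?_⟩
    rintro _ ⟨u, hu, rfl⟩ hu'
    exact disjoint_left.1 hUL hu ((expCover_mem_image hn hinv).1 hu')
  have hKc : IsCompact K := isCompact_expCover_image hn hL hinv hY
  obtain ⟨x, hx⟩ := endSet_nonempty true Y
  set p := expCover n x with hp
  have hp0 : p ≠ 0 := Complex.exp_ne_zero _
  have hlt : ∀ z ∈ K, ‖z‖ < ‖p‖ := by
    rintro _ ⟨w, hw, rfl⟩
    rw [hp, norm_expCover, norm_expCover, Real.exp_lt_exp]
    have h1 : w.re < x.re := (le_abs_self _).trans_lt ((hY w hw).trans_lt hx)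
    gcongr
  have hlog : HasLogOn K (fun z => z) := by
    have h1 : HasLogOn K (fun z => (z - 0) / (z - p)) :=
      hasLogOn_div hKc.isClosed hT' hTK (mem_insert _ _)
        (mem_insert_of_mem _ (mem_image_of_mem _ (Or.inr hx)))
    have h2 : HasLogOn K (fun z => 1 - z / p) := by
      refine hasLogOn_of_near_one (by fun_prop) fun z hz => ?_
      have : ‖z / p‖ < 1 := by
        rw [norm_div, div_lt_one (norm_pos_iff.2 hp0)]
        exact hlt z hz
      simpa using this
    have h3 : HasLogOn K (fun _ => -p) :=
      ⟨fun _ => Complex.log (-p), continuousOn_const,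
        fun _ _ => Complex.exp_log (neg_ne_zero.2 hp0)⟩
    refine ((h1.mul h2).mul h3).congr fun z hz => ?_
    have hzp : z - p ≠ 0 := fun h => (hlt z hz).ne (by rw [sub_eq_zero.1 h])
    field_simp
    ring
  obtain ⟨g, hg, hgexp⟩ := hlog
  obtain ⟨w, hw⟩ := hne
  have hconst := eq_of_exp_eq_one (φ := fun z => g (expCover n z) - 2 * Real.pi * z / n) hLc
    ((hg.comp (continuous_expCover n).continuousOn fun z hz => mem_image_of_mem _ hz).sub
      (by fun_prop))
    (fun z hz => by
      rw [Complex.exp_sub, hgexp _ (mem_image_of_mem _ hz)]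
      exact div_self (Complex.exp_ne_zero _)) hw ((hinv w).2 hw)
  have hper : expCover n (w + n * Complex.I) = expCover n w :=
    (expCover_eq_iff hn).2 ⟨1, by simp⟩
  simp only [hper] at hconst
  have hn0 : (n : ℂ) ≠ 0 := by exact_mod_cast hn.ne'
  have hpi0 : (Real.pi : ℂ) ≠ 0 := by exact_mod_cast hpi.ne'
  field_simp at hconst
  have : (2 * Real.pi * n : ℂ) * Complex.I = 0 := by linear_combination hconst
  simp [hn0, hpi0] at this

/-- A local homeomorphism from the plane through which all maps from the plane lift. -/
structure IsPlaneCover {S : Type*} [TopologicalSpace S] (P : ℂ → S) : Prop where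
  isLocalHomeomorph : IsLocalHomeomorph P
  exists_lift : ∀ (f : C(ℂ, S)) (z w : ℂ), P w = f z → ∃ F : C(ℂ, ℂ), F z = w ∧ P ∘ F = f

/-- The deck transformations of a map. -/
def deckGroup {X S : Type*} [TopologicalSpace X] (P : X → S) : Subgroup (X ≃ₜ X) where
  carrier := {g | ∀ z, P (g z) = P z}
  mul_mem' {g h} hg hh z := (hg (h z)).trans (hh z)
  one_mem' _ := rfl
  inv_mem' {g} hg z := by
    have h := hg (g⁻¹ z)
    rwa [Homeomorph.inv_apply, Homeomorph.apply_symm_apply, eq_comm] at h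

instance {X S : Type*} [TopologicalSpace X] (P : X → S) : MulAction (deckGroup P) X where
  smul g z := g.1 z
  one_smul _ := rfl
  mul_smul _ _ _ := rfl

instance {X S : Type*} [TopologicalSpace X] (P : X → S) :
    ContinuousConstSMul (deckGroup P) X where
  continuous_const_smul g := g.1.continuous

theorem deck_smul {X S : Type*} [TopologicalSpace X] {P : X → S} (g : deckGroup P) (z : X) :
    P (g • z) = P z :=
  g.2 z

namespace IsPlaneCover

variable {S : Type*} [TopologicalSpace S] {P : ℂ → S}

theorem eq_of_comp_eq (hP : IsPlaneCover P) {A : Type*} [TopologicalSpace A] [PreconnectedSpace A]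
    {f g : A → ℂ} (hf : Continuous f) (hg : Continuous g) (h : ∀ x, P (f x) = P (g x)) {x : A}
    (hx : f x = g x) : f = g :=
  IsSeparatedMap.eq_of_comp_eq (T2Space.isSeparatedMap P) hP.isLocalHomeomorph.isLocallyInjective
    hf hg (funext h) x hx

theorem eq_of_smul_eq (hP : IsPlaneCover P) {g h : deckGroup P} {z : ℂ} (hz : g • z = h • z) :
    g = h :=
  Subtype.ext (Homeomorph.ext fun w => congrFun (hP.eq_of_comp_eq g.1.continuous h.1.continuous
    (fun x => (g.2 x).trans (h.2 x).symm) hz) w)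

theorem exists_smul_eq (hP : IsPlaneCover P) {z w : ℂ} (h : P z = P w) :
    ∃ g : deckGroup P, g • z = w := by
  have hc := hP.isLocalHomeomorph.continuous
  obtain ⟨F, hF, hPF⟩ := hP.exists_lift ⟨P, hc⟩ z w h.symm
  obtain ⟨F', hF', hPF'⟩ := hP.exists_lift ⟨P, hc⟩ w z h
  have h1 : F' ∘ F = id := hP.eq_of_comp_eq (F'.continuous.comp F.continuous) continuous_id
    (fun x => (congrFun hPF' (F x)).trans (congrFun hPF x)) (x := z)
    (by simp only [Function.comp_apply, hF, hF', id])
  have h2 : F ∘ F' = id := hP.eq_of_comp_eq (F.continuous.comp F'.continuous) continuous_id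
    (fun x => (congrFun hPF (F' x)).trans (congrFun hPF' x)) (x := w)
    (by simp only [Function.comp_apply, hF, hF', id])
  exact ⟨⟨⟨⟨F, F', congrFun h1, congrFun h2⟩, F.continuous, F'.continuous⟩, congrFun hPF⟩, hF⟩

theorem finite_smul_inter (hP : IsPlaneCover P) [T2Space S] {K₀ K₁ : Set ℂ} (h₀ : IsCompact K₀)
    (h₁ : IsCompact K₁) : {g : deckGroup P | (g • K₀ ∩ K₁).Nonempty}.Finite := by
  have hc := hP.isLocalHomeomorph.continuous
  set C : Set (ℂ × ℂ) := K₀ ×ˢ K₁ ∩ {q | P q.1 = P q.2} with hC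
  have hCc : IsCompact C := (h₀.prod h₁).inter_right
    (isClosed_eq (hc.comp continuous_fst) (hc.comp continuous_snd))
  have key : {g : deckGroup P | ∃ q ∈ C, g • q.1 = q.2}.Finite := by
    refine hCc.induction_on (p := fun s => {g : deckGroup P | ∃ q ∈ s, g • q.1 = q.2}.Finite)
      (by simp) (fun s t hst ht => ht.subset fun g ⟨q, hq, hg⟩ => ⟨q, hst hq, hg⟩)
      (fun s t hs ht => (hs.union ht).subset ?_) ?_
    · rintro g ⟨q, hq | hq, hg⟩
      · exact Or.inl ⟨q, hq, hg⟩
      · exact Or.inr ⟨q, hq, hg⟩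
    · rintro ⟨x, y⟩ hxy
      obtain ⟨g, hg⟩ := hP.exists_smul_eq hxy.2
      obtain ⟨U, hU, hyU, hinj⟩ := hP.isLocalHomeomorph.isLocallyInjective y
      refine ⟨C ∩ {q | g • q.1 ∈ U ∧ q.2 ∈ U}, ?_, (finite_singleton g).subset ?_⟩
      · refine inter_mem_nhdsWithin _ (IsOpen.mem_nhds ?_ ⟨?_, hyU⟩)
        · exact (hU.preimage ((continuous_const_smul g).comp continuous_fst)).inter
            (hU.preimage continuous_snd)
        · show g • x ∈ U
          rwa [hg]
      · rintro g' ⟨⟨x', y'⟩, ⟨hC', hx', hy'⟩, hg'⟩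
        refine hP.eq_of_smul_eq (z := x') ?_
        rw [hg']
        exact hinj hy' hx' (hC'.2.symm.trans (deck_smul g x').symm)
  refine key.subset ?_
  rintro g ⟨_, ⟨x, hx, rfl⟩, hy⟩
  exact ⟨(x, g • x), ⟨⟨hx, hy⟩, (deck_smul g x).symm⟩, rfl⟩

theorem stripAction (hP : IsPlaneCover P) [T2Space S] {a : deckGroup P}
    (ha : ∀ z : ℂ, a • z = z + Complex.I) : StripAction a :=
  ⟨ha, fun _ _ h₀ h₁ => hP.finite_smul_inter h₀ h₁⟩

end IsPlaneCover

/-- The universal covering map of the annulus. -/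
def annulusCover (z : ℂ) : Circle1 × ℝ := ((z.im : Circle1), z.re)

theorem annulusCover_eq_iff {z w : ℂ} :
    annulusCover z = annulusCover w ↔ ∃ k : ℤ, z = w + k * Complex.I := by
  rw [annulusCover, annulusCover, Prod.mk.injEq, coe_circle_eq_iff]
  constructor
  · rintro ⟨⟨n, hn⟩, h⟩
    exact ⟨n, Complex.ext (by simp [h]) (by simp [hn])⟩
  · rintro ⟨k, rfl⟩
    exact ⟨⟨k, by simp⟩, by simp⟩

theorem annulusCover_surjective : Function.Surjective annulusCover := by
  rintro ⟨s, t⟩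
  obtain ⟨x, rfl⟩ := QuotientAddGroup.mk_surjective s
  exact ⟨⟨t, x⟩, rfl⟩

theorem continuous_annulusCover : Continuous annulusCover :=
  ((AddCircle.isCoveringMap_coe (1 : ℝ)).continuous.comp Complex.continuous_im).prodMk
    Complex.continuous_re

theorem isOpenMap_annulusCover : IsOpenMap annulusCover := by
  have h : annulusCover = Prod.map ((↑) : ℝ → Circle1) id ∘ Prod.swap ∘ Complex.equivRealProdCLM :=
    rfl
  rw [h]
  exact ((AddCircle.isLocalHomeomorph_coe (1 : ℝ)).isOpenMap.prodMap IsOpenMap.id).comp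
    ((Homeomorph.prodComm ℝ ℝ).isOpenMap.comp Complex.equivRealProdCLM.toHomeomorph.isOpenMap)

theorem isLocalHomeomorph_annulusCover : IsLocalHomeomorph annulusCover := by
  rw [isLocalHomeomorph_iff_isOpenEmbedding_restrict]
  intro z
  refine ⟨Metric.ball z (1 / 2), Metric.ball_mem_nhds _ (by norm_num), ?_⟩
  refine Topology.IsOpenEmbedding.of_continuous_injective_isOpenMap
    (continuous_annulusCover.comp continuous_subtype_val) ?_
    (isOpenMap_annulusCover.comp Metric.isOpen_ball.isOpenMap_subtype_val)
  rintro ⟨x, hx⟩ ⟨y, hy⟩ hxy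
  obtain ⟨k, hk : x = y + k * Complex.I⟩ := annulusCover_eq_iff.1 hxy
  have h1 : ‖x - y‖ < 1 := by
    have := dist_triangle_right x y z
    rw [Metric.mem_ball] at hx hy
    rw [← dist_eq_norm]
    linarith
  have h2 : ‖x - y‖ = |(k : ℝ)| := by
    rw [hk]
    simp
  rw [h2] at h1
  have h3 : k = 0 := Int.abs_lt_one_iff.1 (by exact_mod_cast h1)
  ext1
  simpa [h3] using hk

theorem exists_lift_annulusCover {A : Type*} [TopologicalSpace A] [SimplyConnectedSpace A]
    [LocallyPathConnectedSpace A] (f : C(A, Circle1 × ℝ)) (z : A) (w : ℂ)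
    (h : annulusCover w = f z) : ∃ F : C(A, ℂ), F z = w ∧ annulusCover ∘ F = f := by
  obtain ⟨F, ⟨hF, hpF⟩, -⟩ := (AddCircle.isCoveringMap_coe (1 : ℝ)).existsUnique_continuousMap_lifts
    (ContinuousMap.fst.comp f) z w.im (congrArg Prod.fst h)
  refine ⟨⟨fun x => ⟨(f x).2, F x⟩, ?_⟩, Complex.ext ?_ hF, ?_⟩
  · have : (fun x => (⟨(f x).2, F x⟩ : ℂ)) =
        fun x => Complex.equivRealProdCLM.symm ((f x).2, F x) :=
      rfl
    rw [this]
    fun_prop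
  · exact (congrArg Prod.snd h).symm
  · exact funext fun x => Prod.ext (congrFun hpF x) rfl

section

/-- A component of the complement of a continuum containing an end of the plane is invariant under
the translations which preserve the continuum. -/
theorem add_mem_component {L : Set ℂ} {Y : ℝ} (hY : ∀ z ∈ L, |z.re| ≤ Y) {c : Bool} {w : ℂ}
    (hw : w ∈ endSet c Y) {d : ℂ} (hd : d.re = 0)
    (hdisj : ∀ z ∈ connectedComponentIn Lᶜ w, z + d ∉ L) {z : ℂ}
    (hz : z ∈ connectedComponentIn Lᶜ w) : z + d ∈ connectedComponentIn Lᶜ w := by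
  have hend : endSet c Y ⊆ Lᶜ := fun u hu huL => (lt_abs_of_mem_endSet hu).not_ge (hY u huL)
  have hendV : endSet c Y ⊆ connectedComponentIn Lᶜ w :=
    (isPreconnected_endSet c Y).subset_connectedComponentIn hw hend
  have hre : ∀ u e : ℂ, e.re = 0 → u ∈ endSet c Y → u + e ∈ endSet c Y := by
    intro u e he hu
    show Y < cond c (u + e).re (-(u + e).re)
    rw [Complex.add_re, he, add_zero]
    exact hu
  have himg : (fun u => u + d) '' connectedComponentIn Lᶜ w ⊆ connectedComponentIn Lᶜ w := by
    refine (isPreconnected_connectedComponentIn.image _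
      (by fun_prop)).subset_connectedComponentIn ?_ ?_
    · refine ⟨w - d, hendV ?_, sub_add_cancel _ _⟩
      rw [sub_eq_add_neg]
      exact hre w (-d) (by simp [hd]) hw
    · rintro _ ⟨u, hu, rfl⟩
      exact hdisj u hu
  exact himg (mem_image_of_mem _ hz)

theorem exists_translate_mem {L : Set ℂ} {n : ℕ} (hn : 0 < n) (hL : IsClosed L)
    (hLc : IsPreconnected L) (hne : L.Nonempty) (hinv : ∀ z, z + n * Complex.I ∈ L ↔ z ∈ L)
    {Y : ℝ} (hY : ∀ z ∈ L, |z.re| ≤ Y) : ∃ z ∈ L, z + Complex.I ∈ L := by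
  by_contra! hdis
  set L' := (fun z => z + Complex.I) '' L with hL'
  have hL'p : IsPreconnected L' := hLc.image _ (by fun_prop)
  have key : ∀ c, ∃ w ∈ endSet c Y, (connectedComponentIn Lᶜ w ∩ L').Nonempty := by
    intro c
    obtain ⟨w, hw⟩ := endSet_nonempty c Y
    have hwL : w ∈ Lᶜ := fun h => (lt_abs_of_mem_endSet hw).not_ge (hY w h)
    refine ⟨w, hw, ?_⟩
    by_contra hemp
    set V := connectedComponentIn Lᶜ w with hV
    have hVL : V ⊆ Lᶜ := connectedComponentIn_subset _ _
    have hsub : ∀ z ∈ V, z + -Complex.I ∈ V := fun z hz =>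
      add_mem_component hY hw (by simp) (fun u hu huL =>
        hemp ⟨u, hu, u + -Complex.I, huL, by simp⟩) hz
    have hsubn : ∀ k : ℕ, ∀ z ∈ V, z + -(k * Complex.I) ∈ V := by
      intro k
      induction k with
      | zero => simp
      | succ k ih =>
        intro z hz
        convert hsub _ (ih z hz) using 1
        push_cast
        ring
    have haddn : ∀ z ∈ V, z + n * Complex.I ∈ V := fun z hz =>
      add_mem_component hY hw (by simp) (fun u hu huL => hVL hu ((hinv u).1 huL)) hz
    have hadd : ∀ z, z + Complex.I ∈ V → z ∈ V := fun z hz => by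
      simpa using hsub _ hz
    have hfrontier : (closure V ∩ L).Nonempty := by
      by_contra hno
      have hclosed : IsClosed V := by
        refine isClosed_of_closure_subset fun z hz => ?_
        exact (closure_connectedComponentIn_subset hL w hz).resolve_right fun h => hno ⟨z, hz, h⟩
      have huniv := (IsClopen.eq_univ ⟨hclosed, hL.isOpen_compl.connectedComponentIn⟩
        ⟨w, mem_connectedComponentIn hwL⟩ : V = univ)
      obtain ⟨z, hz⟩ := hne
      exact hVL (huniv.symm ▸ mem_univ z : z ∈ V) hz
    obtain ⟨z, hzV, hzL⟩ := hfrontier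
    have hV' : ∀ u ∈ V, u + Complex.I ∈ V := by
      intro u hu
      convert hsubn (n - 1) _ (haddn u hu) using 1
      obtain ⟨m, rfl⟩ : ∃ m, n = m + 1 := ⟨n - 1, by omega⟩
      push_cast
      ring
    have hcl : z + Complex.I ∈ closure V :=
      map_mem_closure (f := fun u => u + Complex.I) (by fun_prop) hzV hV'
    have := (closure_connectedComponentIn_subset hL w hcl).resolve_right (hdis z hzL)
    exact hVL (hadd z this) hzL
  obtain ⟨w, hw, hwL⟩ := key true
  obtain ⟨w', hw', hwL'⟩ := key false
  have hsub : ∀ c, endSet c Y ⊆ Lᶜ := fun c u hu huL => (lt_abs_of_mem_endSet hu).not_ge (hY u huL)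
  refine ends_separated hn hL hLc hne hinv hY
    (T := connectedComponentIn Lᶜ w ∪ L' ∪ connectedComponentIn Lᶜ w') ?_ ?_ ?_ ?_
  · refine IsPreconnected.union' ?_ ?_ isPreconnected_connectedComponentIn
    · refine (inter_comm _ _ ▸ hwL').mono (inter_subset_inter_left _ subset_union_right)
    · exact IsPreconnected.union' hwL isPreconnected_connectedComponentIn hL'p
  · rw [← subset_compl_iff_disjoint_right]
    refine union_subset (union_subset (connectedComponentIn_subset _ _) ?_)
      (connectedComponentIn_subset _ _)
    rintro _ ⟨u, hu, rfl⟩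
    exact hdis u hu
  · exact ⟨w, Or.inl (Or.inl (mem_connectedComponentIn (hsub _ hw))), hw⟩
  · exact ⟨w', Or.inr (mem_connectedComponentIn (hsub _ hw')), hw'⟩

variable {S : Type} [TopologicalSpace S]

/-- A universal covering map of an annular cover. -/
def toAnnCover (C : AnnCover S) : ℂ → C.Tot :=
  C.annulus.some.symm ∘ annulusCover

/-- The universal covering map of a surface, factoring through an annular cover. -/
def planeCover (C : AnnCover S) : ℂ → S :=
  C.p ∘ toAnnCover C

variable (C : AnnCover S)

theorem toAnnCover_eq_iff {z w : ℂ} :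
    toAnnCover C z = toAnnCover C w ↔ ∃ k : ℤ, z = w + k * Complex.I := by
  rw [toAnnCover, Function.comp_apply, Function.comp_apply, C.annulus.some.symm.injective.eq_iff,
    annulusCover_eq_iff]

theorem toAnnCover_surjective : Function.Surjective (toAnnCover C) :=
  C.annulus.some.symm.surjective.comp annulusCover_surjective

theorem isLocalHomeomorph_toAnnCover : IsLocalHomeomorph (toAnnCover C) :=
  C.annulus.some.symm.isLocalHomeomorph.comp isLocalHomeomorph_annulusCover

theorem exists_lift_toAnnCover {A : Type*} [TopologicalSpace A] [SimplyConnectedSpace A]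
    [LocallyPathConnectedSpace A] (f : C(A, C.Tot)) (z : A) (w : ℂ) (h : toAnnCover C w = f z) :
    ∃ F : C(A, ℂ), F z = w ∧ toAnnCover C ∘ F = f := by
  obtain ⟨F, hF, hF'⟩ := exists_lift_annulusCover
    ((⟨C.annulus.some, C.annulus.some.continuous⟩ : C(C.Tot, Circle1 × ℝ)).comp f) z w
    (by
      rw [ContinuousMap.comp_apply, ← h]
      exact (C.annulus.some.apply_symm_apply _).symm)
  refine ⟨F, hF, funext fun x => ?_⟩
  have := congrFun hF' x
  simp only [Function.comp_apply, ContinuousMap.comp_apply, ContinuousMap.coe_mk] at this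
  rw [Function.comp_apply, toAnnCover, Function.comp_apply, this, Homeomorph.symm_apply_apply]

theorem isPlaneCover_planeCover : IsPlaneCover (planeCover C) where
  isLocalHomeomorph := C.cov.isLocalHomeomorph.comp (isLocalHomeomorph_toAnnCover C)
  exists_lift f z w h := by
    obtain ⟨F, ⟨hF, hpF⟩, -⟩ := C.cov.existsUnique_continuousMap_lifts f z (toAnnCover C w) h
    obtain ⟨F', hF', hpF'⟩ := exists_lift_toAnnCover C F z w hF.symm
    refine ⟨F', hF', ?_⟩
    rw [planeCover, Function.comp_assoc, hpF', hpF]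

/-- The generator of the deck group of the plane over the annular cover. -/
def coreTranslation : deckGroup (planeCover C) :=
  ⟨Homeomorph.addRight Complex.I, fun z => congrArg C.p
    ((toAnnCover_eq_iff C).2 ⟨1, by simp⟩)⟩

theorem stripAction_coreTranslation [T2Space S] : StripAction (coreTranslation C) :=
  (isPlaneCover_planeCover C).stripAction fun _ => rfl

theorem coreTranslation_zpow_smul [T2Space S] (k : ℤ) (z : ℂ) :
    coreTranslation C ^ k • z = z + k * Complex.I :=
  (stripAction_coreTranslation C).zpow_smul k z

end

section

variable {S : Type} [TopologicalSpace S] {C : AnnCover S} {γ : Set S}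

/-- The closed curve in the annular cover lifting a parametrization of a simple closed curve. -/
theorem CurveLift.exists_lift [T2Space S] (D : CurveLift C γ) {f : C(Circle1, S)}
    (hf : range f = γ) :
    ∃ F : C(Circle1, C.Tot), range F = hatSet D ∧ ∀ t, C.p (F t) = f t := by
  have hmem : ∀ t, f t ∈ C.p '' hatSet D := fun t => by
    rw [hatSet, D.bij.image_eq, ← hf]
    exact mem_range_self t
  choose F hF hpF using hmem
  have hcont : Continuous F := by
    rw [continuous_iff_isClosed]
    intro s hs
    have h : F ⁻¹' s = f ⁻¹' (C.p '' (hatSet D ∩ s)) := by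
      ext t
      refine ⟨fun ht => ⟨F t, ⟨hF t, ht⟩, hpF t⟩, ?_⟩
      rintro ⟨x, ⟨hx, hxs⟩, hxt⟩
      have : x = F t := D.bij.injOn hx (hF t) (hxt.trans (hpF t).symm)
      exact (this ▸ hxs : F t ∈ s)
    rw [h]
    exact (((D.compact.inter_right hs).image C.cov.continuous).isClosed).preimage f.continuous
  refine ⟨⟨F, hcont⟩, Subset.antisymm (range_subset_iff.2 hF) fun x hx => ?_, hpF⟩
  obtain ⟨t, ht⟩ : C.p x ∈ range f := by
    rw [hf]
    exact D.bij.mapsTo hx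
  exact ⟨t, D.bij.injOn (hF t) hx ((hpF t).trans ht)⟩

/-- An essential simple closed curve in the annular cover lifts to a periodic curve in the plane
with nonzero period. -/
theorem exists_periodic_lift [T2Space S] {f : C(Circle1, S)}
    (hf : ¬ ∃ x : S, f.Homotopic (ContinuousMap.const Circle1 x)) {F : C(Circle1, C.Tot)}
    (hF : ∀ t, C.p (F t) = f t) :
    ∃ (e : C(ℝ, ℂ)) (n : ℤ), n ≠ 0 ∧ (∀ t : ℝ, toAnnCover C (e t) = F t) ∧
      ∀ t, e (t + 1) = e t + n * Complex.I := by
  obtain ⟨w, hw⟩ := toAnnCover_surjective C (F ((0 : ℝ) : Circle1))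
  obtain ⟨e, -, he⟩ := exists_lift_toAnnCover C
    (F.comp ⟨((↑) : ℝ → Circle1), AddCircle.continuous_mk' 1⟩) (0 : ℝ) w hw
  have he' : ∀ t : ℝ, toAnnCover C (e t) = F t := congrFun he
  have hone : ∀ t : ℝ, ((t + 1 : ℝ) : Circle1) = t := fun t => coe_circle_eq_iff.2 ⟨1, by simp⟩
  obtain ⟨n, hn⟩ := (toAnnCover_eq_iff C).1
    (show toAnnCover C (e (0 + 1)) = toAnnCover C (e 0) by rw [he', he', hone])
  have hper : ∀ t, e (t + 1) = e t + n * Complex.I := by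
    refine congrFun ((isPlaneCover_planeCover C).eq_of_comp_eq (x := (0 : ℝ))
      (e.continuous.comp (continuous_add_const 1)) (e.continuous.add_const _) (fun t => ?_) hn)
    have h1 : toAnnCover C (e t + n * Complex.I) = toAnnCover C (e t) :=
      (toAnnCover_eq_iff C).2 ⟨n, rfl⟩
    simp only [Function.comp_apply, planeCover, h1, he', hone]
  refine ⟨e, n, ?_, he', hper⟩
  rintro rfl
  have hp : Function.Periodic e 1 := fun t => by simpa using hper t
  have hcont : Continuous (hp.lift : Circle1 → ℂ) :=
    continuous_quot_lift _ e.continuous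
  obtain ⟨x, hx⟩ := ((id_nullhomotopic ℂ).comp_right
    ⟨planeCover C, (isPlaneCover_planeCover C).isLocalHomeomorph.continuous⟩).comp_left
    (⟨hp.lift, hcont⟩ : C(Circle1, ℂ))
  refine hf ⟨x, ?_⟩
  convert hx using 1
  ext t
  obtain ⟨t, rfl⟩ := QuotientAddGroup.mk_surjective t
  exact ((congrArg C.p (he' t)).trans (hF t)).symm

theorem mem_preimage_hatSet_add (D : CurveLift C γ) (z : ℂ) (k : ℤ) :
    z + k * Complex.I ∈ toAnnCover C ⁻¹' hatSet D ↔ z ∈ toAnnCover C ⁻¹' hatSet D := by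
  rw [mem_preimage, mem_preimage, (toAnnCover_eq_iff C).2 ⟨k, rfl⟩]

/-- The preimage in the plane of the compact elevation is a periodic continuum. -/
theorem preimage_hatSet [T2Space S] (hγ : IsEssentialSCC γ) (D : CurveLift C γ) :
    IsClosed (toAnnCover C ⁻¹' hatSet D) ∧ IsPreconnected (toAnnCover C ⁻¹' hatSet D) ∧
      ∃ Y, 0 ≤ Y ∧ ∀ z ∈ toAnnCover C ⁻¹' hatSet D, |z.re| ≤ Y := by
  obtain ⟨f, hfi, hf⟩ := hγ.1
  obtain ⟨F, hFr, hF⟩ := D.exists_lift hf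
  obtain ⟨e, n, hn, he, hper⟩ := exists_periodic_lift (hγ.2 f hf) hF
  have hinv : ∀ z, z + n * Complex.I ∈ range e ↔ z ∈ range e := by
    intro z
    constructor
    · rintro ⟨t, ht⟩
      refine ⟨t - 1, ?_⟩
      have := hper (t - 1)
      rw [sub_add_cancel, ht] at this
      exact (add_right_cancel this).symm
    · rintro ⟨t, rfl⟩
      exact ⟨t + 1, hper t⟩
  have hpern : ∀ (k : ℤ) t, e (t + k) = e t + k * (n * Complex.I) := by
    intro k
    induction k using Int.induction_on with
    | zero => simp
    | succ i ih =>
      intro t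
      have := hper (t + i)
      push_cast at ih ⊢
      rw [← add_assoc, this, ih]
      ring
    | pred i ih =>
      intro t
      have := hper (t + (-i - 1))
      rw [show t + (-i - 1) + 1 = t + -(i : ℝ) by ring] at this
      push_cast at ih ⊢
      rw [ih] at this
      linear_combination -this
  obtain ⟨N, hN⟩ : ∃ N, N = n.natAbs := ⟨_, rfl⟩
  have hN0 : 0 < N := hN ▸ Int.natAbs_pos.2 hn
  have hNn : (n : ℂ) = N ∨ (n : ℂ) = -N := by
    obtain h | h := hN ▸ Int.natAbs_eq n
    · exact Or.inl (by exact_mod_cast h)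
    · exact Or.inr (by exact_mod_cast h)
  have hNinv : ∀ z, z + N * Complex.I ∈ range e ↔ z ∈ range e := by
    intro z
    rcases hNn with h | h
    · rw [← hinv z, h]
    · rw [← hinv (z + N * Complex.I), h, neg_mul, add_neg_cancel_right]
  obtain ⟨Y, hY0, hYI⟩ : ∃ Y, 0 ≤ Y ∧ ∀ t ∈ Icc (0 : ℝ) 1, |(e t).re| ≤ Y := by
    obtain ⟨Y, hY⟩ := isCompact_Icc.exists_bound_of_continuousOn
      (f := fun t : ℝ => (e t).re) (s := Icc (0 : ℝ) 1)
      (Complex.continuous_re.comp e.continuous).continuousOn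
    exact ⟨Y, (abs_nonneg _).trans (hY 0 ⟨le_rfl, zero_le_one⟩), hY⟩
  have hfract : ∀ t, e t = e (Int.fract t) + ⌊t⌋ * (n * Complex.I) := fun t => by
    rw [← hpern, Int.fract_add_floor]
  have hfract_mem : ∀ t : ℝ, Int.fract t ∈ Icc (0 : ℝ) 1 := fun t =>
    ⟨Int.fract_nonneg t, (Int.fract_lt_one t).le⟩
  have hY : ∀ z ∈ range e, |z.re| ≤ Y := by
    rintro _ ⟨t, rfl⟩
    rw [hfract]
    simpa using hYI _ (hfract_mem t)
  have hclosed : IsClosed (range e) := by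
    have h : range e = expCover N ⁻¹' (expCover N '' (e '' Icc 0 1)) := by
      ext z
      constructor
      · rintro ⟨t, rfl⟩
        refine ⟨_, ⟨_, hfract_mem t, rfl⟩, ?_⟩
        rw [eq_comm, expCover_eq_iff hN0]
        rcases hNn with h | h
        · exact ⟨⌊t⌋, by rw [hfract t, h]⟩
        · refine ⟨-⌊t⌋, ?_⟩
          rw [hfract t, h]
          push_cast
          ring
      · rintro ⟨_, ⟨t, -, rfl⟩, ht⟩
        exact (expCover_mem_image hN0 hNinv).1 ⟨e t, mem_range_self t, ht⟩
    rw [h]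
    exact ((isCompact_Icc.image e.continuous).image
      (continuous_expCover N)).isClosed.preimage (continuous_expCover N)
  have hpre : IsPreconnected (range e) := isPreconnected_range e.continuous
  obtain ⟨_, ⟨t, rfl⟩, s, hs⟩ := exists_translate_mem hN0 hclosed hpre (range_nonempty e) hNinv hY
  have hFi : Function.Injective F := fun s t hst => hfi (by rw [← hF, ← hF, hst])
  have hst : (s : Circle1) = t := hFi (by
    rw [← he, ← he, toAnnCover_eq_iff]
    exact ⟨1, by simpa using hs⟩)
  obtain ⟨k, rfl⟩ := coe_circle_eq_iff.1 hst
  rw [hpern] at hs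
  have hkn : k * n = 1 := by
    have h1 := congrArg Complex.im (add_left_cancel hs)
    simp at h1
    exact_mod_cast h1
  have hNI : N = 1 := by
    rcases Int.eq_one_or_neg_one_of_mul_eq_one' hkn with ⟨-, h⟩ | ⟨-, h⟩ <;> simp [hN, h]
  have hrange : toAnnCover C ⁻¹' hatSet D = range e := by
    apply Subset.antisymm
    · intro z hz
      rw [mem_preimage, ← hFr] at hz
      obtain ⟨u, hu⟩ := hz
      obtain ⟨t, rfl⟩ := QuotientAddGroup.mk_surjective u
      obtain ⟨j, rfl⟩ := (toAnnCover_eq_iff C).1 (hu.symm.trans (he t).symm)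
      refine (add_int_mul_mem (fun z => ?_) j _).2 (mem_range_self t)
      simpa [hNI] using hNinv z
    · rintro _ ⟨t, rfl⟩
      rw [mem_preimage, he, ← hFr]
      exact mem_range_self _
  rw [hrange]
  exact ⟨hclosed, hpre, Y, hY0, hY⟩

end

section

theorem IsOrientedSurface.isPlanar {S : Type} [TopologicalSpace S] {g b : ℕ}
    (hS : IsOrientedSurface g b S ∅) : IsPlanar S := by
  intro m
  obtain ⟨U, hU, hm, ⟨φ⟩⟩ := hS.2.2.2.2.2.1 m (notMem_empty m)
  refine ⟨Subtype.val ∘ φ.symm ∘ Complex.equivRealProdCLM.toHomeomorph,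
    hU.isOpenEmbedding_subtypeVal.comp (φ.symm.isOpenEmbedding.comp
      Complex.equivRealProdCLM.toHomeomorph.isOpenEmbedding), ?_⟩
  refine ⟨Complex.equivRealProdCLM.toHomeomorph.symm (φ ⟨m, hm⟩), ?_⟩
  simp only [Function.comp_apply, Homeomorph.apply_symm_apply, Homeomorph.symm_apply_apply]

variable {S : Type} [TopologicalSpace S] {C : AnnCover S} {γ : Set S}

theorem connectedComponentIn_preimage [T2Space S] (hγ : IsEssentialSCC γ) (D : CurveLift C γ)
    {x : ℂ} (hx : toAnnCover C x = D.x0) :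
    connectedComponentIn (planeCover C ⁻¹' γ) x = toAnnCover C ⁻¹' hatSet D := by
  have hc := (isLocalHomeomorph_toAnnCover C).continuous
  apply Subset.antisymm
  · rw [← image_subset_iff]
    refine (isPreconnected_connectedComponentIn.image _ hc.continuousOn).subset_connectedComponentIn
      ⟨x, mem_connectedComponentIn ?_, hx⟩ ?_
    · show C.p (toAnnCover C x) ∈ γ
      rw [hx]
      exact D.mem
    · rw [image_subset_iff]
      exact connectedComponentIn_subset _ _
  · refine (preimage_hatSet hγ D).2.1.subset_connectedComponentIn ?_ ?_
    · rw [mem_preimage, hx]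
      exact mem_connectedComponentIn D.mem
    · exact fun z hz => connectedComponentIn_subset (C.p ⁻¹' γ) _ hz

theorem smul_connectedComponentIn_preimage (g : deckGroup (planeCover C)) (γ : Set S) (x : ℂ) :
    g • connectedComponentIn (planeCover C ⁻¹' γ) x =
      connectedComponentIn (planeCover C ⁻¹' γ) (g • x) := by
  have h : g • (planeCover C ⁻¹' γ) = planeCover C ⁻¹' γ := by
    ext z
    rw [mem_smul_set_iff_inv_smul_mem, mem_preimage, mem_preimage,
      deck_smul (P := planeCover C)]
  rw [smul_set_connectedComponentIn, h]

/-- Up to exchanging the colours, each end of the plane lies in the half plane of its colour. -/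
theorem exists_endSet_subset_halfAt {Z : Set ℂ} {col : Bool → Set ℂ} (h : IsWall Z col) {x : ℂ}
    (hx : x ∈ Z) (hinv : ∀ z, z + Complex.I ∈ connectedComponentIn Z x ↔
      z ∈ connectedComponentIn Z x) {Y : ℝ} (hY : ∀ z ∈ connectedComponentIn Z x, |z.re| ≤ Y) :
    Disjoint (halfAt Z col true x) (halfAt Z col false x) ∧
      ∃ σ : Bool, ∀ c, endSet c Y ⊆ halfAt Z col (xor σ c) x := by
  have hsep : ∀ T : Set ℂ, IsPreconnected T → Disjoint T (connectedComponentIn Z x) →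
      (T ∩ endSet true Y).Nonempty → (T ∩ endSet false Y).Nonempty → False := fun T hT hTL =>
    ends_separated one_pos (h.isClosed_line x) isPreconnected_connectedComponentIn
      ⟨x, mem_connectedComponentIn hx⟩ (by simpa using hinv) hY hT hTL
  have hend : ∀ c, ∃ d, endSet c Y ⊆ halfAt Z col d x := by
    intro c
    obtain ⟨w, hw⟩ := endSet_nonempty c Y
    have hsub : endSet c Y ⊆ (connectedComponentIn Z x)ᶜ := fun u hu huL =>
      (lt_abs_of_mem_endSet hu).not_ge (hY u huL)
    obtain ⟨d, hd⟩ := h.exists_mem_halfAt hx (hsub hw)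
    exact ⟨d, h.subset_halfAt hx (isPreconnected_endSet c Y) hsub ⟨w, hw, hd⟩⟩
  obtain ⟨σ, hσ⟩ : ∃ σ : Bool, ∀ c, endSet c Y ⊆ halfAt Z col (xor σ c) x := by
    obtain ⟨d, hd⟩ := hend true
    obtain ⟨d', hd'⟩ := hend false
    have hne : d ≠ d' := by
      rintro rfl
      obtain ⟨u, hu⟩ := endSet_nonempty true Y
      obtain ⟨v, hv⟩ := endSet_nonempty false Y
      exact hsep _ (h.isPreconnected_halfAt d hx)
        (subset_compl_iff_disjoint_right.1 (IsWall.halfAt_subset_compl d x))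
        ⟨u, hd hu, hu⟩ ⟨v, hd' hv, hv⟩
    refine ⟨d', fun c => ?_⟩
    cases c
    · simpa using hd'
    · have : d = !d' := by cases d <;> cases d' <;> simp_all
      simpa [this] using hd
  refine ⟨disjoint_left.2 fun z hz hz' => ?_, σ, hσ⟩
  have hp := IsPreconnected.union z hz hz' (h.isPreconnected_halfAt true hx)
    (h.isPreconnected_halfAt false hx)
  have hmem : ∀ c, endSet c Y ⊆ halfAt Z col true x ∪ halfAt Z col false x := by
    intro c
    refine (hσ c).trans ?_
    cases xor σ c
    · exact subset_union_right
    · exact subset_union_left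
  obtain ⟨u, hu⟩ := endSet_nonempty true Y
  obtain ⟨v, hv⟩ := endSet_nonempty false Y
  refine hsep _ hp ?_ ⟨u, hmem _ hu, hu⟩ ⟨v, hmem _ hv, hv⟩
  rw [h.halfAt_union hx]
  exact disjoint_compl_left

/-- The lifts of a separating curve to the plane form a strip system. -/
theorem exists_stripSystem [T2Space S] [ConnectedSpace S] (hS : IsPlanar S)
    (hγ : IsEssentialSCC γ) (hsep : IsSeparating γ) (D : CurveLift C γ) {x : ℂ}
    (hx : toAnnCover C x = D.x0) :
    ∃ col, StripSystem (coreTranslation C) (planeCover C ⁻¹' γ) col x := by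
  obtain ⟨f, hfi, rfl⟩ := hγ.1
  obtain ⟨col₀, hcol₀⟩ := exists_isWall hS hfi hsep
  have hP := isPlaneCover_planeCover C
  have hwall := hcol₀.preimage hP.isLocalHomeomorph
  have hxZ : x ∈ planeCover C ⁻¹' range f := by
    show C.p (toAnnCover C x) ∈ range f
    rw [hx]
    exact D.mem
  have hline := connectedComponentIn_preimage hγ D hx
  obtain ⟨-, -, Y, hY0, hY⟩ := preimage_hatSet hγ D
  obtain ⟨hdisj, σ, hσ⟩ := exists_endSet_subset_halfAt hwall hxZ (Y := Y)
    (fun z => by simpa [hline] using mem_preimage_hatSet_add D z 1) (by rwa [hline])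
  have hstab : ∀ g : deckGroup (planeCover C), g • x ∈ connectedComponentIn
      (planeCover C ⁻¹' range f) x ↔ g ∈ Subgroup.zpowers (coreTranslation C) := by
    intro g
    rw [hline, Subgroup.mem_zpowers_iff]
    constructor
    · intro hg
      have h1 : toAnnCover C (g • x) = toAnnCover C x := by
        refine D.bij.injOn hg ?_ (deck_smul g x)
        rw [hx]
        exact mem_connectedComponentIn D.mem
      obtain ⟨k, hk⟩ := (toAnnCover_eq_iff C).1 h1
      exact ⟨k, hP.eq_of_smul_eq (z := x) ((coreTranslation_zpow_smul C k x).trans hk.symm)⟩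
    · rintro ⟨k, rfl⟩
      rw [coreTranslation_zpow_smul, mem_preimage_hatSet_add, ← hline]
      exact mem_connectedComponentIn hxZ
  have htrans : ∀ z ∈ planeCover C ⁻¹' range f, ∃ g : deckGroup (planeCover C),
      z ∈ connectedComponentIn (planeCover C ⁻¹' range f) (g • x) := by
    intro z hz
    obtain ⟨y, hy, hyz⟩ := D.bij.surjOn hz
    obtain ⟨w, rfl⟩ := toAnnCover_surjective C y
    obtain ⟨g, rfl⟩ := hP.exists_smul_eq (z := w) (w := z) hyz
    refine ⟨g, ?_⟩
    rw [← smul_connectedComponentIn_preimage, smul_mem_smul_set_iff, hline]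
    exact hy
  have hwall' : IsWall (planeCover C ⁻¹' range f)
      (fun c => (fun c => planeCover C ⁻¹' col₀ c) (xor σ c)) := by
    cases σ
    · simpa using hwall
    · simpa using hwall.swap
  refine ⟨_, ⟨⟨hwall', fun g c z => ?_, hxZ, htrans, hstab, ?_⟩, Y, hY0, hσ⟩⟩
  · exact iff_of_eq (congrArg (· ∈ col₀ (xor σ c)) (deck_smul (P := planeCover C) g z))
  · cases σ
    · exact hdisj
    · exact hdisj.symm

end

namespace PingPong

variable {G : Type*} [Group G] {Γ : Subgroup G} {H : Bool → Subgroup G} {s : Bool → G → Prop}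
  (P : PingPong Γ H s)
include P

theorem exists_eq_mul {c : Bool} {n : ℕ} {h : G} (hw : AltWord Γ H c (n + 1) h) :
    ∃ h' u, AltWord Γ H c n h' ∧ u ∈ H (not^[n] c) ∧ u ∉ Γ ∧ h = h' * u := by
  induction n generalizing c h with
  | zero =>
    obtain ⟨u, hu, huΓ, h', hh', rfl⟩ := altWord_succ.1 hw
    have hh' := altWord_zero.1 hh'
    exact ⟨1, u * h', altWord_zero.2 (one_mem _), mul_mem hu (P.le c hh'), not_mem_mul hh' huΓ,
      (one_mul _).symm⟩
  | succ n ih =>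
    obtain ⟨u, hu, huΓ, h₁, hh₁, rfl⟩ := altWord_succ.1 hw
    obtain ⟨h', v, hh', hv, hvΓ, rfl⟩ := ih hh₁
    exact ⟨u * h', v, altWord_succ.2 ⟨u, hu, huΓ, h', hh', rfl⟩, hv, hvΓ, (mul_assoc _ _ _).symm⟩

theorem exists_altWord_mul_le {c d : Bool} {n : ℕ} {g k : G} (hg : AltWord Γ H c n g)
    (hk : k ∈ H d) : ∃ c' n', AltWord Γ H c' n' (g * k) ∧ n' ≤ n + 1 := by
  by_cases hkΓ : k ∈ Γ
  · exact ⟨c, n, hg.mul_right_mem hkΓ, n.le_succ⟩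
  cases n with
  | zero =>
    exact ⟨d, 1, P.altWord_mul_right (altWord_zero.2 (altWord_zero.1 hg)) hk hkΓ, le_rfl⟩
  | succ n =>
    obtain ⟨h', u, hh', hu, huΓ, rfl⟩ := P.exists_eq_mul hg
    by_cases hd : d = not^[n] c
    · subst hd
      rw [mul_assoc]
      by_cases huk : u * k ∈ Γ
      · exact ⟨c, n, hh'.mul_right_mem huk, by lia⟩
      · exact ⟨c, n + 1, P.altWord_mul_right hh' (mul_mem hu hk) huk, by lia⟩
    · have hd' : d = not^[n + 1] c := by
        rw [Function.iterate_succ_apply']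
        revert hd
        generalize not^[n] c = e
        cases d <;> cases e <;> simp
      subst hd'
      exact ⟨c, n + 2, P.altWord_mul_right hg hk hkΓ, le_rfl⟩

/-- A surjection from the group onto the vertices of a graph whose adjacency is given by the double
cosets of the vertex groups sends a word of length `n` to a vertex at distance `n`. -/
theorem dist_eq {V : Type*} {T : SimpleGraph V} {E : G → V}
    (hsurj : Function.Surjective E)
    (heq : ∀ g g', E g = E g' ↔ ∃ m ∈ Γ, g⁻¹ * m * g' ∈ Γ)
    (hadj : ∀ g g', T.Adj (E g) (E g') ↔ E g ≠ E g' ∧ ∃ m ∈ Γ, ∃ c, g⁻¹ * m * g' ∈ H c)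
    {c : Bool} {n : ℕ} {h : G} (hw : AltWord Γ H c n h) :
    T.dist (E 1) (E h) = n := by
  have h1 : ∀ m ∈ Γ, E m = E 1 := fun m hm => (heq _ _).2 ⟨1, one_mem _, by simpa using hm⟩
  have hupper : ∃ p : T.Walk (E 1) (E h), p.length ≤ n := by
    induction n generalizing c h with
    | zero => exact ⟨SimpleGraph.Walk.nil.copy rfl (h1 _ (altWord_zero.1 hw)).symm, by simp⟩
    | succ n ih =>
      obtain ⟨h', u, hh', hu, -, rfl⟩ := P.exists_eq_mul hw
      obtain ⟨p, hp⟩ := ih hh'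
      by_cases he : E h' = E (h' * u)
      · exact ⟨p.copy rfl he, by simpa using hp.trans n.le_succ⟩
      · have ha : T.Adj (E h') (E (h' * u)) :=
          (hadj _ _).2 ⟨he, 1, one_mem _, _, by simpa using hu⟩
        exact ⟨p.concat ha, by simpa using hp⟩
  have hlower : ∀ {v : V} (p : T.Walk v (E 1)) (g : G), E g = v →
      ∃ d m, AltWord Γ H d m g ∧ m ≤ p.length := by
    intro v p
    induction hp : p.length generalizing v with
    | zero =>
      intro g hg
      obtain rfl := SimpleGraph.Walk.eq_of_length_eq_zero hp
      obtain ⟨m, hm, hm'⟩ := (heq _ _).1 hg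
      rw [mul_one, Γ.mul_mem_cancel_right hm] at hm'
      exact ⟨true, 0, altWord_zero.2 (inv_mem_iff.1 hm'), le_rfl⟩
    | succ l ih =>
      intro g hg
      cases p with
      | nil => simp at hp
      | cons ha q =>
        rename_i w
        obtain ⟨g', rfl⟩ := hsurj w
        subst hg
        obtain ⟨-, m, hm, c', hk⟩ := (hadj _ _).1 ha
        obtain ⟨d, j, hj, hjl⟩ := ih q (by simpa using hp) g' rfl
        obtain ⟨d', j', hj', hjl'⟩ := P.exists_altWord_mul_le (P.mul_left_mem hm hj) (inv_mem hk)
        rw [show m * g' * (g⁻¹ * m * g')⁻¹ = g by group] at hj'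
        exact ⟨d', j', hj', by lia⟩
  obtain ⟨p, hp⟩ := hupper
  refine le_antisymm ((SimpleGraph.dist_le p).trans hp) ?_
  obtain ⟨q, hq⟩ := (SimpleGraph.Walk.reachable p).exists_walk_length_eq_dist
  obtain ⟨d, m, hm, hmq⟩ := hlower q.reverse h rfl
  rw [(P.altWord_unique hw hm).1, ← hq]
  simpa using hmq

end PingPong

/-- A map which is the quotient by a subgroup maps components of preimages onto components. -/
theorem image_connectedComponentIn_preimage {G X T : Type*} [Group G] [TopologicalSpace X]
    [TopologicalSpace T] [MulAction G X] [ContinuousConstSMul G X] {Γ : Subgroup G} {π : X → T}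
    (hπ : IsOpenQuotientMap π) (hfib : ∀ z w, π z = π w ↔ ∃ m ∈ Γ, z = m • w) {W : Set T}
    (hW : ∀ z ∈ π ⁻¹' W, ∃ N ∈ 𝓝 z, N ∩ π ⁻¹' W ⊆ connectedComponentIn (π ⁻¹' W) z)
    {w : X} (hw : π w ∈ W) :
    π '' connectedComponentIn (π ⁻¹' W) w = connectedComponentIn W (π w) := by
  have hinv : ∀ m ∈ Γ, m • (π ⁻¹' W) = π ⁻¹' W := by
    intro m hm
    ext z
    rw [mem_smul_set_iff_inv_smul_mem, mem_preimage, mem_preimage,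
      (hfib (m⁻¹ • z) z).2 ⟨m⁻¹, inv_mem hm, rfl⟩]
  have key : ∀ z z', z' ∈ connectedComponentIn (π ⁻¹' W) z →
      π z ∈ π '' connectedComponentIn (π ⁻¹' W) w →
      π z' ∈ π '' connectedComponentIn (π ⁻¹' W) w := by
    rintro z z' hz' ⟨y, hy, hyz⟩
    obtain ⟨m, hm, rfl⟩ := (hfib _ _).1 hyz
    refine ⟨m • z', ?_, (hfib _ _).2 ⟨m, hm, rfl⟩⟩
    rw [connectedComponentIn_eq hy, ← hinv m hm, ← smul_set_connectedComponentIn]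
    exact smul_mem_smul_set hz'
  apply Subset.antisymm
  · refine (isPreconnected_connectedComponentIn.image _
      hπ.continuous.continuousOn).subset_connectedComponentIn
      ⟨w, mem_connectedComponentIn hw, rfl⟩ ?_
    rw [image_subset_iff]
    exact connectedComponentIn_subset _ _
  · intro t ht
    have h := (isPreconnected_connectedComponentIn (F := W) (x := π w)).induction₂'
      (fun x y => x ∈ π '' connectedComponentIn (π ⁻¹' W) w →
        y ∈ π '' connectedComponentIn (π ⁻¹' W) w) (fun x hx => ?_)
      (fun x y z _ _ _ h h' hx => h' (h hx)) (mem_connectedComponentIn hw) ht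
    · exact h ⟨w, mem_connectedComponentIn hw, rfl⟩
    · obtain ⟨z, rfl⟩ := hπ.surjective x
      obtain ⟨N, hN, hNs⟩ := hW z (connectedComponentIn_subset W (π w) hx)
      filter_upwards [mem_nhdsWithin_of_mem_nhds (hπ.isOpenMap.image_mem_nhds hN),
        self_mem_nhdsWithin] with y hy hyW
      obtain ⟨z', hz', rfl⟩ := hy
      have hz'z := hNs ⟨hz', (connectedComponentIn_subset W (π w) hyW : π z' ∈ W)⟩
      refine ⟨key _ _ hz'z, key _ _ ?_⟩
      rw [← connectedComponentIn_eq hz'z]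
      exact mem_connectedComponentIn (connectedComponentIn_subset W (π w) hx : π z ∈ W)

namespace LineSystem

variable {G X T : Type*} [Group G] [TopologicalSpace X] [TopologicalSpace T] [MulAction G X]
  [ContinuousConstSMul G X] {Γ : Subgroup G} {π : X → T} {W : Set T}
  {col : Bool → Set X} {x₀ : X}

theorem image_line (h : LineSystem Γ (π ⁻¹' W) col x₀) (hπ : IsOpenQuotientMap π)
    (hfib : ∀ z w, π z = π w ↔ ∃ m ∈ Γ, z = m • w) {z : X} (hz : π z ∈ W) :
    π '' connectedComponentIn (π ⁻¹' W) z = connectedComponentIn W (π z) :=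
  image_connectedComponentIn_preimage hπ hfib
    (fun _ => h.wall.exists_nhds_inter_subset_line) hz

theorem connectedComponentIn_eq_iff (h : LineSystem Γ (π ⁻¹' W) col x₀) (hπ : IsOpenQuotientMap π)
    (hfib : ∀ z w, π z = π w ↔ ∃ m ∈ Γ, z = m • w) (g g' : G) :
    connectedComponentIn W (π (g • x₀)) = connectedComponentIn W (π (g' • x₀)) ↔
      ∃ m ∈ Γ, g⁻¹ * m * g' ∈ Γ := by
  have hmem : ∀ g : G, π (g • x₀) ∈ W := h.smul_x₀_mem
  rw [← h.image_line hπ hfib (hmem g)]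
  constructor
  · intro he
    have : π (g' • x₀) ∈ π '' connectedComponentIn (π ⁻¹' W) (g • x₀) := by
      rw [he]
      exact mem_connectedComponentIn (hmem g')
    obtain ⟨z, hz, hzg⟩ := this
    obtain ⟨m, hm, rfl⟩ := (hfib _ _).1 hzg
    rw [← mul_smul, h.eq_of_smul_mem_line, ← mul_assoc] at hz
    exact ⟨m, hm, hz⟩
  · rintro ⟨m, hm, hm'⟩
    rw [mul_assoc, ← h.eq_of_smul_mem_line, mul_smul] at hm'
    rw [h.image_line hπ hfib (hmem g), connectedComponentIn_eq (y := π (g' • x₀))]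
    rw [← h.image_line hπ hfib (hmem g)]
    exact ⟨_, hm', (hfib _ _).2 ⟨m, hm, rfl⟩⟩

variable [LocallyConnectedSpace X]

theorem image_compl_component (h : LineSystem Γ (π ⁻¹' W) col x₀) (hπ : IsOpenQuotientMap π)
    (hfib : ∀ z w, π z = π w ↔ ∃ m ∈ Γ, z = m • w) {z : X} (hz : π z ∉ W) :
    π '' connectedComponentIn (π ⁻¹' W)ᶜ z = connectedComponentIn Wᶜ (π z) :=
  image_connectedComponentIn_preimage (W := Wᶜ) hπ hfib (fun _ hz => ⟨_,
    (h.wall.isClosed.isOpen_compl.connectedComponentIn.mem_nhds (mem_connectedComponentIn hz)),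
    inter_subset_left⟩) hz

theorem common_side_iff (h : LineSystem Γ (π ⁻¹' W) col x₀) (hπ : IsOpenQuotientMap π)
    (hfib : ∀ z w, π z = π w ↔ ∃ m ∈ Γ, z = m • w) (g g' : G) :
    (∃ t ∈ Wᶜ, connectedComponentIn W (π (g • x₀)) ⊆ closure (connectedComponentIn Wᶜ t) ∧
      connectedComponentIn W (π (g' • x₀)) ⊆ closure (connectedComponentIn Wᶜ t)) ↔
      ∃ m ∈ Γ, ∃ c, g⁻¹ * m * g' ∈ h.vertexGroup c := by
  have hmem : ∀ g : G, π (g • x₀) ∈ W := h.smul_x₀_mem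
  constructor
  · rintro ⟨t, ht, hg, hg'⟩
    obtain ⟨w, rfl⟩ := hπ.surjective t
    rw [← h.image_compl_component hπ hfib ht] at hg hg'
    have key : ∀ g : G, π (g • x₀) ∈ closure (π '' connectedComponentIn (π ⁻¹' W)ᶜ w) →
        ∃ m ∈ Γ, ∃ c, m • w ∈ sideAt (π ⁻¹' W) col c (g • x₀) := by
      intro g hg
      obtain ⟨V, hV, hVs⟩ := h.wall.exists_nhds_subset_sideAt (h.smul_x₀_mem g)
      obtain ⟨_, ⟨v, hv, rfl⟩, y, hy, hyv⟩ :=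
        mem_closure_iff_nhds.1 hg _ (hπ.isOpenMap.image_mem_nhds hV)
      obtain ⟨m, hm, rfl⟩ := (hfib _ _).1 hyv.symm
      obtain ⟨c, hc⟩ := h.wall.exists_mem_col (connectedComponentIn_subset _ _ hy)
      have hs := hVs c ⟨hv, (h.smul_mem_col m c y).2 hc⟩
      refine ⟨m, hm, c, ?_⟩
      rw [h.wall.sideAt_eq (h.smul_x₀_mem g) hs, ← h.smul_compl m, ← smul_set_connectedComponentIn,
        ← connectedComponentIn_eq hy]
      exact smul_mem_smul_set (mem_connectedComponentIn ht)
    obtain ⟨m, hm, c, hc⟩ := key g (hg (mem_connectedComponentIn (hmem g)))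
    obtain ⟨m', hm', c', hc'⟩ := key g' (hg' (mem_connectedComponentIn (hmem g')))
    obtain rfl : c = c' := h.wall.color_unique ((h.smul_mem_col _ _ _).1 hc.1)
      ((h.smul_mem_col _ _ _).1 hc'.1)
    refine ⟨m * m'⁻¹, mul_mem hm (inv_mem hm'), c, ?_⟩
    have hc₂ : m • w ∈ sideAt (π ⁻¹' W) col c ((m * m'⁻¹ * g') • x₀) := by
      rw [mul_smul, mul_smul, ← h.smul_sideAt, ← h.smul_sideAt]
      exact smul_mem_smul_set (mem_smul_set_iff_inv_smul_mem.2 (by simpa using hc'))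
    rw [mem_vertexGroup, mul_assoc, mul_smul, ← h.smul_sideAt,
      h.wall.sideAt_eq_of_mem (h.smul_x₀_mem _) (h.smul_x₀_mem _) hc₂ hc, h.smul_sideAt,
      inv_smul_smul]
  · rintro ⟨m, hm, c, hc⟩
    obtain ⟨w, hw⟩ := h.wall.sideAt_nonempty c (h.smul_x₀_mem g)
    have hwW : π w ∉ W := h.wall.not_mem hw.1
    have hs : sideAt (π ⁻¹' W) col c ((m * g') • x₀) = sideAt (π ⁻¹' W) col c (g • x₀) := by
      rw [mem_vertexGroup, mul_assoc, mul_smul, ← h.smul_sideAt] at hc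
      rw [← h.smul_sideAt g, ← hc, smul_inv_smul]
    have key : ∀ k : G, sideAt (π ⁻¹' W) col c (k • x₀) = sideAt (π ⁻¹' W) col c (g • x₀) →
        connectedComponentIn W (π (k • x₀)) ⊆ closure (connectedComponentIn Wᶜ (π w)) := by
      intro k hk
      rw [← h.image_line hπ hfib (hmem k), ← h.image_compl_component hπ hfib hwW,
        ← h.wall.sideAt_eq (h.smul_x₀_mem g) hw, ← hk]
      exact (image_mono (h.wall.line_subset_closure_sideAt c _)).trans
        (image_closure_subset_closure_image hπ.continuous)
    refine ⟨π w, hwW, key g rfl, ?_⟩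
    have := key (m * g') hs
    rwa [mul_smul, (hfib (m • g' • x₀) (g' • x₀)).2 ⟨m, hm, rfl⟩] at this

end LineSystem

theorem halfAt_line {X : Type*} [TopologicalSpace X] {Z : Set X} {col : Bool → Set X}
    (h : IsWall Z col) (c : Bool) {z z' : X} (hz' : z' ∈ connectedComponentIn Z z) :
    halfAt Z col c z' = halfAt Z col c z := by
  rw [halfAt, halfAt, h.sideAt_line c hz', connectedComponentIn_eq hz']

section

variable {S : Type} [TopologicalSpace S] {C : AnnCover S} {γ : Set S}
  {col : Bool → Set ℂ} {x : ℂ}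

theorem isOpenQuotientMap_toAnnCover (C : AnnCover S) : IsOpenQuotientMap (toAnnCover C) :=
  ⟨toAnnCover_surjective C, (isLocalHomeomorph_toAnnCover C).continuous,
    (isLocalHomeomorph_toAnnCover C).isOpenMap⟩

namespace StripSystem

/-- The elevation through the image of `g • x` in the annular cover. -/
def elev (h : StripSystem (coreTranslation C) (planeCover C ⁻¹' γ) col x)
    (g : deckGroup (planeCover C)) : Elev C γ :=
  ⟨connectedComponentIn (C.p ⁻¹' γ) (toAnnCover C (g • x)), _,
    h.toLineSystem.smul_x₀_mem g, rfl⟩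

theorem elev_one (h : StripSystem (coreTranslation C) (planeCover C ⁻¹' γ) col x)
    {D : CurveLift C γ} (hx : toAnnCover C x = D.x0) : h.elev 1 = hatElev D := by
  refine Subtype.ext ?_
  show connectedComponentIn _ _ = connectedComponentIn _ _
  rw [one_smul, hx]

end StripSystem

variable [T2Space S]

theorem toAnnCover_eq_iff_smul (C : AnnCover S) (z w : ℂ) :
    toAnnCover C z = toAnnCover C w ↔ ∃ m ∈ Subgroup.zpowers (coreTranslation C), z = m • w := by
  rw [toAnnCover_eq_iff]
  constructor
  · rintro ⟨k, rfl⟩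
    exact ⟨_, zpow_mem (Subgroup.mem_zpowers _) k, (coreTranslation_zpow_smul C k w).symm⟩
  · rintro ⟨m, hm, rfl⟩
    obtain ⟨k, rfl⟩ := Subgroup.mem_zpowers_iff.1 hm
    exact ⟨k, coreTranslation_zpow_smul C k w⟩

namespace StripSystem

theorem elev_val (h : StripSystem (coreTranslation C) (planeCover C ⁻¹' γ) col x)
    (g : deckGroup (planeCover C)) :
    (h.elev g).val = toAnnCover C '' connectedComponentIn (planeCover C ⁻¹' γ) (g • x) :=
  (LineSystem.image_line (W := C.p ⁻¹' γ) h.toLineSystem (isOpenQuotientMap_toAnnCover C)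
    (toAnnCover_eq_iff_smul C) (h.toLineSystem.smul_x₀_mem g)).symm

theorem elev_surjective (h : StripSystem (coreTranslation C) (planeCover C ⁻¹' γ) col x) :
    Function.Surjective h.elev := by
  rintro ⟨A, t, ht, rfl⟩
  obtain ⟨z, rfl⟩ := toAnnCover_surjective C t
  obtain ⟨g, hg⟩ := h.toLineSystem.trans z ht
  refine ⟨g, Subtype.ext ?_⟩
  refine connectedComponentIn_eq (F := C.p ⁻¹' γ) ?_
  rw [← LineSystem.image_line (W := C.p ⁻¹' γ) h.toLineSystem (isOpenQuotientMap_toAnnCover C)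
    (toAnnCover_eq_iff_smul C) (h.toLineSystem.smul_x₀_mem g)]
  exact ⟨z, hg, rfl⟩

theorem dist_elev (h : StripSystem (coreTranslation C) (planeCover C ⁻¹' γ) col x)
    {D : CurveLift C γ} (hx : toAnnCover C x = D.x0) {c : Bool} {n : ℕ}
    {g : deckGroup (planeCover C)}
    (hg : AltWord (Subgroup.zpowers (coreTranslation C)) h.vert c n g) :
    (elevTree C γ).dist (hatElev D) (h.elev g) = n := by
  rw [← h.elev_one hx]
  have hside := LineSystem.common_side_iff (W := C.p ⁻¹' γ) h.toLineSystem
    (isOpenQuotientMap_toAnnCover C) (toAnnCover_eq_iff_smul C)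
  refine h.toLineSystem.pingPong.dist_eq h.elev_surjective (fun g g' => ?_) (fun g g' => ?_) hg
  · rw [← LineSystem.connectedComponentIn_eq_iff (W := C.p ⁻¹' γ) h.toLineSystem
      (isOpenQuotientMap_toAnnCover C) (toAnnCover_eq_iff_smul C)]
    exact Subtype.ext_iff
  · rw [elevTree, SimpleGraph.fromRel_adj]
    refine and_congr_right fun _ => ?_
    refine Iff.trans ?_ (hside g g')
    refine ⟨?_, Or.inl⟩
    rintro (hr | ⟨t, ht, h₁, h₂⟩)
    · exact hr
    · exact ⟨t, ht, h₂, h₁⟩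

theorem exists_elev_subset_iff (h : StripSystem (coreTranslation C) (planeCover C ⁻¹' γ) col x)
    (hγ : IsEssentialSCC γ) {D : CurveLift C γ} (hx : toAnnCover C x = D.x0) :
    ∃ c, ∀ g, (h.elev g).val ⊆ connectedComponentIn (hatSet D)ᶜ D.pos ↔
      g • x ∈ halfAt (planeCover C ⁻¹' γ) col c x := by
  obtain ⟨w, hw⟩ := toAnnCover_surjective C D.pos
  have hpre : toAnnCover C ⁻¹' (hatSet D)ᶜ = (connectedComponentIn (planeCover C ⁻¹' γ) x)ᶜ := by
    rw [connectedComponentIn_preimage hγ D hx, preimage_compl]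
  have hwhat : toAnnCover C w ∈ (hatSet D)ᶜ := by
    rw [hw]
    exact D.pos_notin
  have hwl : w ∉ connectedComponentIn (planeCover C ⁻¹' γ) x := by
    rw [← mem_compl_iff, ← hpre]
    exact hwhat
  obtain ⟨c, hc⟩ := h.wall.exists_mem_halfAt h.mem hwl
  have himg : toAnnCover C '' halfAt (planeCover C ⁻¹' γ) col c x =
      connectedComponentIn (hatSet D)ᶜ D.pos := by
    rw [h.wall.halfAt_eq_component h.mem hc, ← hw, ← hpre]
    refine image_connectedComponentIn_preimage (isOpenQuotientMap_toAnnCover C)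
      (toAnnCover_eq_iff_smul C) (fun z hz => ⟨_, IsOpen.mem_nhds ?_
        (mem_connectedComponentIn hz), inter_subset_left⟩) hwhat
    rw [hpre]
    exact (h.wall.isClosed_line x).isOpen_compl.connectedComponentIn
  refine ⟨c, fun g => ?_⟩
  rw [← himg, h.elev_val]
  have hgmem := mem_connectedComponentIn (h.toLineSystem.smul_x₀_mem g)
  constructor
  · intro hsub
    obtain ⟨y, hy, hyg⟩ := hsub ⟨_, hgmem, rfl⟩
    obtain ⟨m, hm, hmy⟩ := (toAnnCover_eq_iff_smul C _ _).1 hyg.symm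
    rw [hmy, ← halfAt_line h.wall c ((h.stab m).2 hm), h.toLineSystem.smul_mem_halfAt_iff]
    exact hy
  · intro hg
    refine image_mono (h.wall.subset_halfAt h.mem isPreconnected_connectedComponentIn
      (h.toLineSystem.smul_line_disjoint fun hgΓ => ?_) ⟨_, hgmem, hg⟩)
    exact IsWall.halfAt_subset_compl c x hg ((h.stab g).2 hgΓ)

theorem level_elev_eq_iff (h : StripSystem (coreTranslation C) (planeCover C ⁻¹' γ) col x)
    (hγ : IsEssentialSCC γ) {D : CurveLift C γ} (hx : toAnnCover C x = D.x0)
    (g g' : deckGroup (planeCover C)) :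
    level D (h.elev g) = level D (h.elev g') ↔
      SameWord (Subgroup.zpowers (coreTranslation C)) h.vert g g' := by
  have P := h.toLineSystem.pingPong
  obtain ⟨c₀, hc₀⟩ := h.exists_elev_subset_iff hγ hx
  have hlevel : ∀ {c n g}, AltWord (Subgroup.zpowers (coreTranslation C)) h.vert c n g →
      level D (h.elev g) = if c = c₀ then (n : ℤ) else -(n : ℤ) := by
    intro c n g hg
    rw [level, h.dist_elev hx hg]
    cases n with
    | zero => simp
    | succ n =>
      have hs := P.sign_of_altWord hg
      have : (h.elev g).val ⊆ connectedComponentIn (hatSet D)ᶜ D.pos ↔ c = c₀ := by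
        rw [hc₀]
        exact ⟨fun hs' => P.color_unique hs hs', fun hcc => hcc ▸ hs⟩
      simp only [this]
  constructor
  · intro he
    obtain ⟨c, n, hg⟩ := P.exists_altWord g
    obtain ⟨c', n', hg'⟩ := P.exists_altWord g'
    rw [hlevel hg, hlevel hg'] at he
    have hn : n = n' := by split_ifs at he <;> lia
    subst hn
    rcases Nat.eq_zero_or_pos n with rfl | hn
    · exact ⟨c, 0, hg, altWord_zero.2 (altWord_zero.1 hg')⟩
    · have hcc : c = c' := by
        cases c <;> cases c' <;> cases c₀ <;> simp at he ⊢ <;> lia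
      exact ⟨c, n, hg, hcc ▸ hg'⟩
  · rintro ⟨c, n, hg, hg'⟩
    rw [hlevel hg, hlevel hg']

theorem levelsMet_eq (h : StripSystem (coreTranslation C) (planeCover C ⁻¹' γ) col x)
    (D : CurveLift C γ) (T : Set C.Tot) :
    levelsMet D T = (fun g => level D (h.elev g)) '' {g | (connectedComponentIn
      (planeCover C ⁻¹' γ) (g • x) ∩ toAnnCover C ⁻¹' T).Nonempty} := by
  ext k
  constructor
  · rintro ⟨A, rfl, hA⟩
    obtain ⟨g, rfl⟩ := h.elev_surjective A
    refine ⟨g, ?_, rfl⟩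
    rw [h.elev_val] at hA
    exact image_inter_nonempty_iff.1 hA
  · rintro ⟨g, hg, rfl⟩
    refine ⟨h.elev g, rfl, ?_⟩
    rw [h.elev_val]
    exact image_inter_nonempty_iff.2 hg

end StripSystem

theorem ncard_image_eq_of_eq_iff {A B B' : Type*} {f : A → B} {f' : A → B'} {T : Set A}
    (hff : ∀ a ∈ T, ∀ b ∈ T, f a = f b ↔ f' a = f' b) : (f '' T).ncard = (f' '' T).ncard := by
  refine ncard_congr (fun b hb => f' hb.choose) (fun b hb => ⟨_, hb.choose_spec.1, rfl⟩) ?_ ?_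
  · intro a b ha hb he
    rw [← ha.choose_spec.2, ← hb.choose_spec.2]
    exact (hff _ ha.choose_spec.1 _ hb.choose_spec.1).2 he
  · rintro _ ⟨a, ha, rfl⟩
    have hfa : f a ∈ f '' T := ⟨a, ha, rfl⟩
    exact ⟨f a, hfa, (hff _ hfa.choose_spec.1 _ ha).1 hfa.choose_spec.2⟩

theorem ncard_levelsMet_comm [ConnectedSpace S] (hS : IsPlanar S) {β : Set S}
    (hβ : IsEssentialSCC β) (hγ : IsEssentialSCC γ) (hβsep : IsSeparating β)
    (hγsep : IsSeparating γ) (Dβ : CurveLift C β) (Dγ : CurveLift C γ) :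
    (levelsMet Dγ (hatSet Dβ)).ncard = (levelsMet Dβ (hatSet Dγ)).ncard := by
  obtain ⟨x, hx⟩ := toAnnCover_surjective C Dγ.x0
  obtain ⟨y, hy⟩ := toAnnCover_surjective C Dβ.x0
  obtain ⟨col, h⟩ := exists_stripSystem hS hγ hγsep Dγ hx
  obtain ⟨col', h'⟩ := exists_stripSystem hS hβ hβsep Dβ hy
  rw [h.levelsMet_eq, h'.levelsMet_eq, ← connectedComponentIn_preimage hγ Dγ hx,
    ← connectedComponentIn_preimage hβ Dβ hy]
  set T := {g : deckGroup (planeCover C) | (connectedComponentIn (planeCover C ⁻¹' γ) (g • x) ∩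
    connectedComponentIn (planeCover C ⁻¹' β) y).Nonempty} with hT
  have hT' : {g : deckGroup (planeCover C) | (connectedComponentIn (planeCover C ⁻¹' β) (g • y) ∩
      connectedComponentIn (planeCover C ⁻¹' γ) x).Nonempty} = Inv.inv '' T := by
    ext g
    rw [image_inv_eq_inv, mem_inv, hT, mem_ofPred_eq, mem_ofPred_eq,
      ← smul_connectedComponentIn_preimage, ← smul_connectedComponentIn_preimage, inter_comm]
    constructor
    · rintro ⟨z, hz, hz'⟩
      refine ⟨g⁻¹ • z, smul_mem_smul_set hz, mem_smul_set_iff_inv_smul_mem.1 hz'⟩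
    · rintro ⟨z, hz, hz'⟩
      exact ⟨g • z, by rwa [mem_smul_set_iff_inv_smul_mem, inv_inv] at hz, smul_mem_smul_set hz'⟩
  rw [hT', image_image]
  refine ncard_image_eq_of_eq_iff fun g _ g' _ => ?_
  rw [h.level_elev_eq_iff hγ hx, h'.level_elev_eq_iff hβ hy,
    h'.toLineSystem.pingPong.sameWord_inv_iff, h.sameWord_iff (stripAction_coreTranslation C) h']

theorem crossing_comm [ConnectedSpace S] (hS : IsPlanar S) {β : Set S}
    (hβ : IsEssentialSCC β) (hγ : IsEssentialSCC γ) (hβsep : IsSeparating β)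
    (hγsep : IsSeparating γ) (Dβ : CurveLift C β) (Dγ : CurveLift C γ) :
    crossing Dγ Dβ = crossing Dβ Dγ := by
  rw [crossing, crossing, ncard_levelsMet_comm hS hβ hγ hβsep hγsep, if_congr eq_comm rfl rfl]

end

end

/-- Let `S` be a closed orientable surface of genus `g ≥ 2`.  For any
isotopic separating essential simple closed curves `β` and `γ`, the crossing numbers are
symmetric: `C_γ(β) = C_β(γ)`. -/
theorem stmt13 (g : ℕ) (hg : 2 ≤ g)
    (S : Type) [TopologicalSpace S] (hS : IsOrientedSurface g 0 S ∅)
    (βc γc : Set S) (hβ : IsEssentialCurve ∅ βc) (hγ : IsEssentialCurve ∅ γc)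
    (hβsep : IsSeparating βc) (hγsep : IsSeparating γc)
    (hiso : CurvesIsotopic βc γc)
    (C : AnnCover S) (Dβ : CurveLift C βc) (Dγ : CurveLift C γc) :
    crossing Dγ Dβ = crossing Dβ Dγ := by
  have := hS.1
  have := hS.2.1
  have := hS.2.2.1
  exact crossing_comm hS.isPlanar hβ.2.1 hγ.2.1 hβsep hγsep Dβ Dγ
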